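/- The integral cohomology of SL₂(ℤ[1/2]) is: Hⁱ(SL₂(ℤ[1/2]), ℤ) ≅ 0 for all odd i ≥ 1, ℤ ⊕ ℤ/3 for i = 2, and ℤ/24 ⊕ ℤ/3 for all even i ≥ 4. -/

import Mathlib

set_option linter.all false

namespace SLC

set_option linter.unusedVariables false
set_option linter.unusedSectionVars false
set_option linter.style.longLine false

open CategoryTheory


section General

variable {k : Type} [CommRing k] {G : Type} [Group G]

/-- Build a morphism of representations from an equivariant linear map. -/
noncomputable def mkH {A B : Rep.{0} k G} (φ : A.V →ₗ[k] B.V)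
    (h : ∀ g a, φ (A.ρ g a) = B.ρ g (φ a)) : A ⟶ B :=
  Rep.ofHom (ρ := A.ρ) (σ := B.ρ) (Representation.IntertwiningMap.mk φ
    (fun g => LinearMap.ext (h g)))

@[simp] lemma mkH_apply {A B : Rep.{0} k G} (φ : A.V →ₗ[k] B.V) (h) (a : A.V) :
    (mkH φ h).hom a = φ a := rfl

/-- Morphism extensionality, pointwise. -/
lemma hom_ext' {A B : Rep.{0} k G} {f g : A ⟶ B} (h : ∀ a, f.hom a = g.hom a) : f = g :=
  Rep.hom_ext (Representation.IntertwiningMap.ext (LinearMap.ext h))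

/-- The cohomology groups. -/
abbrev Hc (A : Rep.{0} k G) (n : ℕ) : Type := groupCohomology A n

/-- The map induced on cohomology. -/
noncomputable def hmap {A B : Rep.{0} k G} (f : A ⟶ B) (n : ℕ) : Hc A n →+ Hc B n :=
  (groupCohomology.map (MonoidHom.id G) f n).hom.toAddMonoidHom

lemma hmap_id (A : Rep.{0} k G) (n : ℕ) (x : Hc A n) : hmap (𝟙 A) n x = x :=
  congr($(groupCohomology.map_id (B := A) (n := n)).hom x)

lemma hmap_comp {A B C : Rep.{0} k G} (f : A ⟶ B) (g : B ⟶ C) (n : ℕ) (x : Hc A n) :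
    hmap (f ≫ g) n x = hmap g n (hmap f n x) :=
  congr($(groupCohomology.map_id_comp f g n).hom x)

lemma hmap_add {A B : Rep.{0} k G} (f g : A ⟶ B) (n : ℕ) (x : Hc A n) :
    hmap (f + g) n x = hmap f n x + hmap g n x := by
  have h1 : groupCohomology.cochainsMap (MonoidHom.id G) (f + g) =
      groupCohomology.cochainsMap (MonoidHom.id G) f +
      groupCohomology.cochainsMap (MonoidHom.id G) g := by
    rfl
  have : groupCohomology.map (MonoidHom.id G) (f + g) n =
      groupCohomology.map (MonoidHom.id G) f n + groupCohomology.map (MonoidHom.id G) g n := by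
    unfold groupCohomology.map
    rw [h1, HomologicalComplex.homologyMap_add]
    rfl
  exact congr($(this).hom x)

lemma hmap_zero {A B : Rep.{0} k G} (n : ℕ) (x : Hc A n) :
    hmap (0 : A ⟶ B) n x = 0 := by
  have := hmap_add (0 : A ⟶ B) 0 n x
  simpa using this

/-- A short exact sequence of representations. -/
structure SES {A B C : Rep.{0} k G} (f : A ⟶ B) (g : B ⟶ C) : Prop where
  inj : Function.Injective f.hom
  surj : Function.Surjective g.hom
  zero : ∀ a, g.hom (f.hom a) = 0
  ex : ∀ b, g.hom b = 0 → ∃ a, f.hom a = b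

namespace SES

variable {A B C : Rep.{0} k G} {f : A ⟶ B} {g : B ⟶ C} (h : SES f g)

include h in
lemma comp_zero : f ≫ g = 0 := hom_ext' fun a => by
  simpa using h.zero a

/-- The underlying short complex. -/
abbrev sc : ShortComplex (Rep.{0} k G) := ShortComplex.mk f g h.comp_zero

lemma shortExact : h.sc.ShortExact where
  exact := by
    have hF : (h.sc.map (forget₂ (Rep.{0} k G) (ModuleCat.{0} k))).Exact := by
      rw [ShortComplex.moduleCat_exact_iff]
      intro x hx
      exact h.ex x hx
    exact (ShortComplex.exact_map_iff_of_faithful _ _).1 hF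
  mono_f := (Rep.mono_iff_injective f).2 h.inj
  epi_g := (Rep.epi_iff_surjective g).2 h.surj

/-- The connecting map. -/
noncomputable def δ (n : ℕ) : Hc C n →+ Hc A (n + 1) :=
  (groupCohomology.δ h.shortExact n (n + 1) rfl).hom.toAddMonoidHom

lemma ex_A (n : ℕ) (x : Hc A (n + 1)) (hx : hmap f (n + 1) x = 0) : ∃ y, h.δ n y = x := by
  have := groupCohomology.mapShortComplex₁_exact h.shortExact (rfl : n + 1 = n + 1)
  rw [ShortComplex.moduleCat_exact_iff] at this
  exact this x hx

include h in
lemma ex_B (n : ℕ) (x : Hc B n) (hx : hmap g n x = 0) : ∃ y, hmap f n y = x := by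
  have := groupCohomology.mapShortComplex₂_exact h.shortExact n
  rw [ShortComplex.moduleCat_exact_iff] at this
  exact this x hx

lemma ex_C (n : ℕ) (x : Hc C n) (hx : h.δ n x = 0) : ∃ y, hmap g n y = x := by
  have := groupCohomology.mapShortComplex₃_exact h.shortExact (rfl : n + 1 = n + 1)
  rw [ShortComplex.moduleCat_exact_iff] at this
  exact this x hx

lemma zero_A (n : ℕ) (x : Hc C n) : hmap f (n + 1) (h.δ n x) = 0 :=
  congr($((groupCohomology.mapShortComplex₁ h.shortExact (rfl : n + 1 = n + 1)).zero).hom x)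

include h in
lemma zero_B (n : ℕ) (x : Hc A n) : hmap g n (hmap f n x) = 0 := by
  rw [← hmap_comp, h.comp_zero, hmap_zero]

lemma zero_C (n : ℕ) (x : Hc B n) : h.δ n (hmap g n x) = 0 :=
  congr($((groupCohomology.mapShortComplex₃ h.shortExact (rfl : n + 1 = n + 1)).zero).hom x)

lemma δ_nat {A' B' C' : Rep.{0} k G} {f' : A' ⟶ B'} {g' : B' ⟶ C'} (h' : SES f' g')
    (a : A ⟶ A') (b : B ⟶ B') (c : C ⟶ C') (hab : f ≫ b = a ≫ f') (hbc : g ≫ c = b ≫ g')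
    (n : ℕ) (x : Hc C n) :
    h'.δ n (hmap c n x) = hmap a (n + 1) (h.δ n x) := by
  have := groupCohomology.δ_naturality h.shortExact h'.shortExact
    (ShortComplex.homMk a b c hab.symm hbc.symm) n (n + 1) rfl
  exact (congr($(this).hom x)).symm

include h in
lemma inj_zero : Function.Injective (hmap f 0) := by
  have := (Rep.mono_iff_injective f).2 h.inj
  have h2 := groupCohomology.mono_map_0_of_mono f
  exact (ModuleCat.mono_iff_injective _).1 h2

end SES

/-- Higher cohomology vanishing from degree `d`. -/
def Acyc (A : Rep.{0} k G) (d : ℕ) : Prop := ∀ n, d ≤ n → ∀ x : Hc A n, x = 0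

lemma Acyc.mono {A : Rep.{0} k G} {d e : ℕ} (h : Acyc A d) (hde : d ≤ e) : Acyc A e :=
  fun n hn => h n (hde.trans hn)

lemma Acyc.retract {A B : Rep.{0} k G} {d : ℕ} (hB : Acyc B d) (i : A ⟶ B) (r : B ⟶ A)
    (h : i ≫ r = 𝟙 A) : Acyc A d := by
  intro n hn x
  rw [← hmap_id A n x, ← h, hmap_comp, hB n hn (hmap i n x), map_zero]

lemma Acyc.mid {A B C : Rep.{0} k G} {f : A ⟶ B} {g : B ⟶ C} (h : SES f g) {d : ℕ}
    (hA : Acyc A d) (hC : Acyc C d) : Acyc B d := by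
  intro n hn x
  obtain ⟨y, rfl⟩ := h.ex_B n x (hC n hn _)
  rw [hA n hn y, map_zero]

lemma Acyc.left {A B C : Rep.{0} k G} {f : A ⟶ B} {g : B ⟶ C} (h : SES f g) {d : ℕ}
    (hB : Acyc B (d + 1)) (hC : Acyc C d) : Acyc A (d + 1) := by
  rintro (_ | n) hn x
  · omega
  obtain ⟨y, rfl⟩ := h.ex_A n x (hB _ hn _)
  rw [hC n (by omega) y, map_zero]

/-- The representation on functions on a `G`-set. -/
noncomputable def frho (X : Type) [MulAction G X] (M : Rep.{0} k G) :
    Representation k G (X → M.V) where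
  toFun g :=
    { toFun := fun f x => M.ρ g (f (g⁻¹ • x))
      map_add' := fun a b => by ext x; simp
      map_smul' := fun a b => by ext x; simp }
  map_one' := by ext1 f; funext x; simp
  map_mul' a b := by ext1 f; funext x; simp [mul_smul]

/-- Functions on a `G`-set with values in a representation. -/
noncomputable abbrev FR (X : Type) [MulAction G X] (M : Rep.{0} k G) : Rep.{0} k G :=
  Rep.of (frho X M)

lemma FR_rho {X : Type} [MulAction G X] (M : Rep.{0} k G) (g : G) (f : X → M.V) (x : X) :
    ((FR X M).ρ g f : X → M.V) x = M.ρ g (f (g⁻¹ • x)) := rfl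

end General
end SLC

namespace SLC
set_option linter.unusedVariables false
open CategoryTheory
section General2

variable {k : Type} [CommRing k] {G : Type} [Group G]

lemma hom_rho {A B : Rep.{0} k G} (f : A ⟶ B) (g : G) (a : A.V) :
    f.hom (A.ρ g a) = B.ρ g (f.hom a) := Rep.hom_comm_apply f g a

/-- The class in degree zero of an invariant element. -/
noncomputable def h0 {A : Rep.{0} k G} (a : A.V) (ha : ∀ g, A.ρ g a = a) : Hc A 0 :=
  (groupCohomology.H0Iso A).inv ⟨a, ha⟩

lemma h0_surj {A : Rep.{0} k G} (x : Hc A 0) : ∃ a ha, x = h0 (A := A) a ha := by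
  refine ⟨((groupCohomology.H0Iso A).hom x).1, ((groupCohomology.H0Iso A).hom x).2, ?_⟩
  unfold h0
  simp

lemma h0_inj {A : Rep.{0} k G} (a b : A.V) (ha hb) (h : h0 (A := A) a ha = h0 b hb) : a = b := by
  have := congr((groupCohomology.H0Iso A).hom $h)
  simpa [h0] using congrArg Subtype.val (by simpa [h0] using this : (⟨a, ha⟩ : A.ρ.invariants) = ⟨b, hb⟩)

lemma hmap_h0 {A B : Rep.{0} k G} (f : A ⟶ B) (a : A.V) (ha) :
    hmap f 0 (h0 a ha) = h0 (f.hom a) (fun g => by rw [← hom_rho, ha]) := by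
  have h1 := congr($(groupCohomology.map_id_comp_H0Iso_hom f) (h0 a ha))
  apply ((groupCohomology.H0Iso B).toLinearEquiv.injective)
  refine Eq.trans h1 ?_
  have e1 : (groupCohomology.H0Iso A).hom (h0 a ha) = ⟨a, ha⟩ := by simp [h0]
  have e2 : ∀ z, (groupCohomology.H0Iso B).toLinearEquiv ((groupCohomology.H0Iso B).inv z) = z :=
    fun z => (groupCohomology.H0Iso B).toLinearEquiv.apply_symm_apply z
  refine Eq.trans ?_ (e2 _).symm
  change (Rep.invariantsFunctor k G).map f ((groupCohomology.H0Iso A).hom (h0 a ha)) = _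
  rw [e1]
  rfl

lemma h0_zero {A : Rep.{0} k G} (ha) : h0 (A := A) 0 ha = 0 := by
  unfold h0
  exact map_zero (groupCohomology.H0Iso A).inv.hom


/-- Functoriality of `FR` in the coefficients. -/
noncomputable def FRmap (X : Type) [MulAction G X] {A B : Rep.{0} k G} (f : A ⟶ B) :
    FR X A ⟶ FR X B :=
  mkH (A := FR X A) (B := FR X B)
    { toFun := fun u x => f.hom (u x)
      map_add' := fun a b => funext fun x => map_add f.hom _ _
      map_smul' := fun a b => funext fun x => map_smul f.hom _ _ }
    (fun g a => funext fun x => hom_rho f g _)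

@[simp] lemma FRmap_apply (X : Type) [MulAction G X] {A B : Rep.{0} k G} (f : A ⟶ B)
    (u : X → A.V) (x : X) : ((FRmap X f).hom u : X → B.V) x = f.hom (u x) := rfl

/-- Pullback along an equivariant map. -/
noncomputable def pull {X Y : Type} [MulAction G X] [MulAction G Y] (p : X → Y)
    (hp : ∀ (g : G) x, p (g • x) = g • p x) (M : Rep.{0} k G) : FR Y M ⟶ FR X M :=
  mkH (A := FR Y M) (B := FR X M)
    { toFun := fun u x => u (p x)
      map_add' := fun a b => rfl
      map_smul' := fun a b => rfl }
    (fun g a => funext fun x => congrArg (fun y => M.ρ g (a y)) (hp g⁻¹ x).symm)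

@[simp] lemma pull_apply {X Y : Type} [MulAction G X] [MulAction G Y] (p : X → Y)
    (hp : ∀ (g : G) x, p (g • x) = g • p x) (M : Rep.{0} k G) (u : Y → M.V) (x : X) :
    ((pull p hp M).hom u : X → M.V) x = u (p x) := rfl

lemma SES.FR {A B C : Rep.{0} k G} {f : A ⟶ B} {g : B ⟶ C} (h : SES f g) (X : Type)
    [MulAction G X] : SES (FRmap X f) (FRmap X g) where
  inj := fun a b hab => funext fun x => h.inj (congrFun hab x)
  surj := fun c => ⟨fun x => (h.surj (c x)).choose, funext fun x => (h.surj (c x)).choose_spec⟩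
  zero := fun a => funext fun x => h.zero (a x)
  ex := fun b hb => ⟨fun x => (h.ex (b x) (congrFun hb x)).choose,
    funext fun x => (h.ex (b x) (congrFun hb x)).choose_spec⟩

lemma acyc_G (N : Rep.{0} k G) : Acyc (FR G N) 1 := by
  let A : Rep.{0} k (⊥ : Subgroup G) := Rep.trivial k (⊥ : Subgroup G) N.V
  have hA : Acyc (Rep.coind (⊥ : Subgroup G).subtype A) 1 := by
    rintro (_ | n) hn x
    · omega
    have h1 : Limits.IsZero (groupCohomology A (n + 1)) :=
      isZero_groupCohomology_succ_of_subsingleton A n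
    have h2 := h1.of_iso (groupCohomology.coindIso A (n + 1))
    have := ModuleCat.subsingleton_of_isZero h2
    exact Subsingleton.elim _ _
  let i : FR G N ⟶ Rep.coind (⊥ : Subgroup G).subtype A :=
    mkH (A := FR G N) (B := Rep.coind (⊥ : Subgroup G).subtype A)
      { toFun := fun f => ⟨fun x => N.ρ x (f x⁻¹), by
          rintro ⟨g, hg⟩ h
          obtain rfl := Subgroup.mem_bot.1 hg
          simp [A]⟩
        map_add' := fun a b => Subtype.ext (funext fun x => map_add (N.ρ x) _ _)
        map_smul' := fun a b => Subtype.ext (funext fun x => map_smul (N.ρ x) _ _) }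
      (fun g a => Subtype.ext (funext fun x => by
        change N.ρ x (N.ρ g (a (g⁻¹ * x⁻¹))) = N.ρ (x * g) (a (x * g)⁻¹)
        simp))
  let r : Rep.coind (⊥ : Subgroup G).subtype A ⟶ FR G N :=
    mkH (A := Rep.coind (⊥ : Subgroup G).subtype A) (B := FR G N)
      { toFun := fun f x => N.ρ x (f.1 x⁻¹)
        map_add' := fun a b => funext fun x => map_add (N.ρ x) _ _
        map_smul' := fun a b => funext fun x => map_smul (N.ρ x) _ _ }
      (fun g a => funext fun x => by
        change N.ρ x (a.1 (x⁻¹ * g)) = N.ρ g (N.ρ (g⁻¹ * x) (a.1 (g⁻¹ * x)⁻¹))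
        simp)
  refine hA.retract i r (hom_ext' fun f => funext fun x => ?_)
  change N.ρ x (N.ρ x⁻¹ (f x⁻¹⁻¹)) = f x
  simp

/-- A free `G`-set maps equivariantly to `G`. -/
lemma free_map {Z : Type} [MulAction G Z] (h : ∀ (g : G) (z : Z), g • z = z → g = 1) :
    ∃ c : Z → G, ∀ g z, c (g • z) = g * c z := by
  have h1 : ∀ z : Z, ∃ g : G, g • (Quotient.out (⟦z⟧ : MulAction.orbitRel.Quotient G Z)) = z := by
    intro z
    have := Quotient.mk_out (s := MulAction.orbitRel G Z) z
    obtain ⟨g, hg⟩ := (MulAction.orbitRel_apply.1 this)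
    exact ⟨g⁻¹, by
      change g⁻¹ • (Quotient.out (Quotient.mk (MulAction.orbitRel G Z) z)) = z
      rw [← hg, inv_smul_smul]⟩
  choose c hc using h1
  refine ⟨c, fun g z => ?_⟩
  have e : (Quotient.mk (MulAction.orbitRel G Z) (g • z)) = Quotient.mk _ z :=
    Quotient.sound (MulAction.orbitRel_apply.2 ⟨g, rfl⟩)
  have h2 := hc (g • z)
  have h3 := hc z
  rw [show (⟦g • z⟧ : MulAction.orbitRel.Quotient G Z) = ⟦z⟧ from e] at h2
  set w := Quotient.out (⟦z⟧ : MulAction.orbitRel.Quotient G Z)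
  have : ((g * c z)⁻¹ * c (g • z)) • w = w := by
    rw [mul_smul, h2, inv_smul_eq_iff, mul_smul, h3]
  have := h _ _ this
  rw [inv_mul_eq_one] at this
  exact this.symm

lemma acyc_free {Z : Type} [MulAction G Z] (h : ∀ (g : G) (z : Z), g • z = z → g = 1)
    (M : Rep.{0} k G) : Acyc (FR Z M) 1 := by
  obtain ⟨c, hc⟩ := free_map h
  let i : FR Z M ⟶ FR G (FR Z M) :=
    mkH (A := FR Z M) (B := FR G (FR Z M))
      { toFun := fun f _ => f
        map_add' := fun a b => rfl
        map_smul' := fun a b => rfl } (fun g a => rfl)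
  let r : FR G (FR Z M) ⟶ FR Z M :=
    mkH (A := FR G (FR Z M)) (B := FR Z M)
      { toFun := fun f z => f (c z) z
        map_add' := fun a b => rfl
        map_smul' := fun a b => rfl } (fun g a => funext fun z => by
          change M.ρ g (a (g⁻¹ * c z) (g⁻¹ • z)) = M.ρ g (a (c (g⁻¹ • z)) (g⁻¹ • z))
          rw [hc])
  exact (acyc_G (FR Z M)).retract i r (hom_ext' fun f => rfl)

/-- Extension by zero from the first summand. -/
noncomputable def extL (X Y : Type) [MulAction G X] [MulAction G Y] (M : Rep.{0} k G) :
    FR X M ⟶ FR (X ⊕ Y) M :=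
  mkH (A := FR X M) (B := FR (X ⊕ Y) M)
    { toFun := fun f => Sum.elim f 0
      map_add' := fun a b => by funext x; rcases x with x | x <;> simp
      map_smul' := fun a b => by funext x; rcases x with x | x <;> simp }
    (fun g a => by
      funext x
      rcases x with x | x
      · rfl
      · exact (map_zero (M.ρ g)).symm)

/-- Extension by zero from the second summand. -/
noncomputable def extR (X Y : Type) [MulAction G X] [MulAction G Y] (M : Rep.{0} k G) :
    FR Y M ⟶ FR (X ⊕ Y) M :=
  mkH (A := FR Y M) (B := FR (X ⊕ Y) M)
    { toFun := fun f => Sum.elim 0 f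
      map_add' := fun a b => by funext x; rcases x with x | x <;> simp
      map_smul' := fun a b => by funext x; rcases x with x | x <;> simp }
    (fun g a => by
      funext x
      rcases x with x | x
      · exact (map_zero (M.ρ g)).symm
      · rfl)

/-- Restriction to the first summand. -/
noncomputable def resL (X Y : Type) [MulAction G X] [MulAction G Y] (M : Rep.{0} k G) :
    FR (X ⊕ Y) M ⟶ FR X M := pull (Sum.inl : X → X ⊕ Y) (fun _ _ => rfl) M

/-- Restriction to the second summand. -/
noncomputable def resR (X Y : Type) [MulAction G X] [MulAction G Y] (M : Rep.{0} k G) :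
    FR (X ⊕ Y) M ⟶ FR Y M := pull (Sum.inr : Y → X ⊕ Y) (fun _ _ => rfl) M

section SumLemmas
variable (X Y : Type) [MulAction G X] [MulAction G Y] (M : Rep.{0} k G)

lemma extL_resL : extL X Y M ≫ resL X Y M = 𝟙 _ := hom_ext' fun _ => rfl
lemma extR_resR : extR X Y M ≫ resR X Y M = 𝟙 _ := hom_ext' fun _ => rfl
lemma extL_resR : extL X Y M ≫ resR X Y M = 0 := hom_ext' fun _ => rfl
lemma extR_resL : extR X Y M ≫ resL X Y M = 0 := hom_ext' fun _ => rfl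
lemma res_ext : resL X Y M ≫ extL X Y M + resR X Y M ≫ extR X Y M = 𝟙 _ := by
  refine hom_ext' fun f => ?_
  funext x
  rcases x with x | x
  · exact add_zero _
  · exact zero_add _

lemma hsum_ext (n : ℕ) (x y : Hc (FR (X ⊕ Y) M) n) (h1 : hmap (resL X Y M) n x = hmap (resL X Y M) n y)
    (h2 : hmap (resR X Y M) n x = hmap (resR X Y M) n y) : x = y := by
  rw [← hmap_id _ n x, ← hmap_id _ n y, ← res_ext, hmap_add, hmap_add, hmap_comp, hmap_comp,
    hmap_comp, hmap_comp, h1, h2]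

lemma hsum_surj (n : ℕ) (a : Hc (FR X M) n) (b : Hc (FR Y M) n) :
    ∃ x, hmap (resL X Y M) n x = a ∧ hmap (resR X Y M) n x = b := by
  refine ⟨hmap (extL X Y M) n a + hmap (extR X Y M) n b, ?_, ?_⟩
  · rw [map_add, ← hmap_comp, ← hmap_comp, extL_resL, extR_resL, hmap_id, hmap_zero, add_zero]
  · rw [map_add, ← hmap_comp, ← hmap_comp, extL_resR, extR_resR, hmap_id, hmap_zero, zero_add]

lemma acyc_sum {d : ℕ} (h1 : Acyc (FR X M) d) (h2 : Acyc (FR Y M) d) : Acyc (FR (X ⊕ Y) M) d := by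
  intro n hn x
  apply hsum_ext
  · rw [h1 n hn (hmap _ n x), map_zero]
  · rw [h2 n hn (hmap _ n x), map_zero]

end SumLemmas

end General2
end SLC

namespace SLC
open CategoryTheory
section Circ

/-- Cyclic-order data on a `G`-set: `h a b` says that the angle from `a` to `b` is in `[0, π)`. -/
structure Circ (G S : Type) [Group G] [MulAction G S] where
  h : S → S → Prop
  inv : ∀ (g : G) a b, h (g • a) (g • b) ↔ h a b
  p : S → ℝ
  c : ℝ
  cpos : 0 < c
  bd : ∀ a b, p a < p b + 2 * c
  iff : ∀ a b, h a b ↔ (p a ≤ p b ∧ p b < p a + c) ∨ p b < p a - c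

variable {G S : Type} [Group G] [MulAction G S] (Ω : Circ G S)

/-- The order on `S` by angle from `a`. -/
def Circ.le (a b c : S) : Prop := (Ω.h a b ∧ ¬ Ω.h a c) ∨ ((Ω.h a b ↔ Ω.h a c) ∧ Ω.h b c)

open Classical in
/-- The orientation cocycle. -/
noncomputable def Circ.ω (k : Type) [CommRing k] (a b c : S) : k := if Ω.le a b c then 0 else 1

variable {k : Type} [CommRing k]

lemma Circ.ω_inv (g : G) (a b c : S) : Ω.ω k (g • a) (g • b) (g • c) = Ω.ω k a b c := by
  have : Ω.le (g • a) (g • b) (g • c) ↔ Ω.le a b c := by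
    unfold Circ.le
    rw [Ω.inv g a b, Ω.inv g a c, Ω.inv g b c]
  unfold Circ.ω
  by_cases h : Ω.le a b c
  · rw [if_pos h, if_pos (this.2 h)]
  · rw [if_neg h, if_neg (fun h' => h (this.1 h'))]

lemma Circ.coc (a b c d : S) :
    Ω.ω k a b c + Ω.ω k a c d = Ω.ω k b c d + Ω.ω k a b d := by
  have hc := Ω.cpos
  have h1 := Ω.bd a b
  have h2 := Ω.bd a c
  have h3 := Ω.bd a d
  have h4 := Ω.bd b c
  have h5 := Ω.bd b d
  have h6 := Ω.bd c d
  have h1' := Ω.bd b a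
  have h2' := Ω.bd c a
  have h3' := Ω.bd d a
  have h4' := Ω.bd c b
  have h5' := Ω.bd d b
  have h6' := Ω.bd d c
  unfold Circ.ω Circ.le
  simp only [Ω.iff]
  generalize Ω.p a = x at *
  generalize Ω.p b = y at *
  generalize Ω.p c = z at *
  generalize Ω.p d = w at *
  generalize Ω.c = c at *
  have key : ∀ u v : ℝ, u < v + 2 * c → v < u + 2 * c →
      (((u ≤ v ∧ v < u + c) ∨ v < u - c) ∧ ((u ≤ v ∧ v < u + c) ∨ (v < u - c))) ∨
      (¬ ((u ≤ v ∧ v < u + c) ∨ v < u - c) ∧ ((v < u ∧ u ≤ v + c) ∨ (u + c ≤ v))) := by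
    intro u v _ _
    by_cases hh : ((u ≤ v ∧ v < u + c) ∨ v < u - c)
    · exact Or.inl ⟨hh, hh⟩
    · refine Or.inr ⟨hh, ?_⟩
      push Not at hh
      rcases lt_or_ge v u with h | h
      · left; exact ⟨h, by linarith⟩
      · right; exact hh.1 h
  have q1 := key x y h1 h1'
  have q2 := key x z h2 h2'
  have q3 := key x w h3 h3'
  have q4 := key y z h4 h4'
  have q5 := key y w h5 h5'
  have q6 := key z w h6 h6'
  clear key
  rcases q1 with ⟨e1, q1⟩ | ⟨e1, q1⟩ <;> rcases q2 with ⟨e2, q2⟩ | ⟨e2, q2⟩ <;>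
  rcases q3 with ⟨e3, q3⟩ | ⟨e3, q3⟩ <;> rcases q4 with ⟨e4, q4⟩ | ⟨e4, q4⟩ <;>
  rcases q5 with ⟨e5, q5⟩ | ⟨e5, q5⟩ <;> rcases q6 with ⟨e6, q6⟩ | ⟨e6, q6⟩ <;>
  simp only [e1, e2, e3, e4, e5, e6, true_and, and_true, not_true, not_false_iff, false_and, and_false,
    or_false, false_or, true_or, or_true, if_true, if_false, iff_self, iff_true, true_iff, iff_false, false_iff, add_zero, zero_add] <;>
  (exfalso; clear e1 e2 e3 e4 e5 e6; rcases q1 with q1 | q1 <;> rcases q2 with q2 | q2 <;> first | linarith | skip <;> rcases q4 with q4 | q4 <;> first | linarith | skip <;>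
   rcases q3 with q3 | q3 <;> first | linarith | skip <;> rcases q5 with q5 | q5 <;> first | linarith | skip <;> rcases q6 with q6 | q6 <;> linarith )

lemma Circ.h_self (a : S) : Ω.h a a := by
  rw [Ω.iff]
  left
  exact ⟨le_rfl, by linarith [Ω.cpos]⟩

lemma Circ.ω_zero {a b c : S} (h : Ω.le a b c) : Ω.ω k a b c = 0 := if_pos h
lemma Circ.ω_one {a b c : S} (h : ¬ Ω.le a b c) : Ω.ω k a b c = 1 := if_neg h

/-- Trivial coefficients. -/
noncomputable abbrev TT (k : Type) [CommRing k] (G : Type) [Group G] : Rep.{0} k G :=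
  Rep.trivial k G k

/-- Additive pair functions. -/
def Wsub (k S : Type) [CommRing k] : Submodule k (S → S → k) where
  carrier := {F | ∀ a b c, F a b + F b c = F a c}
  add_mem' := fun {x y} hx hy a b c => by
    have h1 := hx a b c
    have h2 := hy a b c
    simp only [Pi.add_apply]
    linear_combination h1 + h2
  zero_mem' := fun a b c => by simp
  smul_mem' := fun t x hx a b c => by
    have h1 := hx a b c
    simp only [Pi.smul_apply, smul_eq_mul]
    linear_combination t * h1

/-- Pair functions that are additive up to a multiple of the orientation cocycle. -/
def Qsub (k : Type) [CommRing k] : Submodule k ((S → S → k) × k) where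
  carrier := {q | ∀ a b c, q.1 a b + q.1 b c = q.1 a c + q.2 * Ω.ω k a b c}
  add_mem' := fun {x y} hx hy a b c => by
    have h1 := hx a b c
    have h2 := hy a b c
    simp only [Prod.fst_add, Prod.snd_add, Pi.add_apply]
    linear_combination h1 + h2
  zero_mem' := fun a b c => by simp
  smul_mem' := fun t x hx a b c => by
    have h1 := hx a b c
    simp only [Prod.smul_fst, Prod.smul_snd, Pi.smul_apply, smul_eq_mul]
    linear_combination t * h1

/-- The representation on `Wsub`. -/
noncomputable def Wrho (k G S : Type) [CommRing k] [Group G] [MulAction G S] :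
    Representation k G (Wsub k S) where
  toFun g :=
    { toFun := fun F => ⟨fun a b => F.1 (g⁻¹ • a) (g⁻¹ • b), fun a b c => F.2 _ _ _⟩
      map_add' := fun a b => rfl
      map_smul' := fun a b => rfl }
  map_one' := by
    ext1 F
    apply Subtype.ext
    funext a b
    simp
  map_mul' x y := by
    ext1 F
    apply Subtype.ext
    funext a b
    simp [mul_smul]

/-- The representation on `Qsub`. -/
noncomputable def Qrho (k : Type) [CommRing k] : Representation k G (Qsub Ω k) where
  toFun g :=
    { toFun := fun F => ⟨(fun a b => F.1.1 (g⁻¹ • a) (g⁻¹ • b), F.1.2), fun a b c => by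
        have := F.2 (g⁻¹ • a) (g⁻¹ • b) (g⁻¹ • c)
        rwa [Ω.ω_inv] at this⟩
      map_add' := fun a b => rfl
      map_smul' := fun a b => rfl }
  map_one' := by
    ext1 F
    apply Subtype.ext
    refine Prod.ext ?_ rfl
    funext a b
    simp
  map_mul' x y := by
    ext1 F
    apply Subtype.ext
    refine Prod.ext ?_ rfl
    funext a b
    simp [mul_smul]

/-- `W` as a representation. -/
noncomputable abbrev WW (k G S : Type) [CommRing k] [Group G] [MulAction G S] : Rep.{0} k G :=
  Rep.of (Wrho k G S)
/-- `Q` as a representation. -/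
noncomputable abbrev QQ (k : Type) [CommRing k] : Rep.{0} k G := Rep.of (Qrho Ω k)

variable (k G S) in
/-- Constants. -/
noncomputable def cst : TT k G ⟶ FR S (TT k G) :=
  mkH (A := TT k G) (B := FR S (TT k G))
    { toFun := fun t _ => t
      map_add' := fun a b => rfl
      map_smul' := fun a b => rfl } (fun g a => rfl)

variable (k G S) in
/-- Coboundary. -/
noncomputable def cob : FR S (TT k G) ⟶ WW k G S :=
  mkH (A := FR S (TT k G)) (B := WW k G S)
    { toFun := fun (u : S → k) => (⟨fun a b => u b - u a, fun a b c => by ring⟩ : Wsub k S)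
      map_add' := fun (u v : S → k) => Subtype.ext (funext fun a => funext fun b => by
        change (u b + v b) - (u a + v a) = (u b - u a) + (v b - v a)
        ring)
      map_smul' := fun t (u : S → k) => Subtype.ext (funext fun a => funext fun b => by
        change t * u b - t * u a = t * (u b - u a)
        ring) } (fun g a => rfl)

/-- Inclusion. -/
noncomputable def jWQ (k : Type) [CommRing k] : WW k G S ⟶ QQ Ω k :=
  mkH (A := WW k G S) (B := QQ Ω k)
    { toFun := fun (F : Wsub k S) => (⟨(F.1, 0), fun a b c => by
          have := F.2 a b c
          simpa using this⟩ : Qsub Ω k)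
      map_add' := fun (u v : Wsub k S) => Subtype.ext (Prod.ext rfl (add_zero _).symm)
      map_smul' := fun t (u : Wsub k S) => Subtype.ext (Prod.ext rfl (mul_zero _).symm) }
    (fun g a => rfl)

/-- The multiple. -/
noncomputable def nQ (k : Type) [CommRing k] : QQ Ω k ⟶ TT k G :=
  mkH (A := QQ Ω k) (B := TT k G)
    { toFun := fun (F : Qsub Ω k) => F.1.2
      map_add' := fun _ _ => rfl
      map_smul' := fun _ _ => rfl }
    (fun g a => rfl)

lemma ses1 (s0 : S) : SES (cst G S k) (cob G S k) where
  inj := fun a b h => congrFun h s0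
  surj := fun (F : Wsub k S) => ⟨(fun s => F.1 s0 s : S → k), Subtype.ext (funext fun a => funext fun b => by
    have := F.2 s0 a b
    change F.1 s0 b - F.1 s0 a = F.1 a b
    linear_combination -this)⟩
  zero := fun a => Subtype.ext (funext fun _ => funext fun _ => sub_self _)
  ex := fun (u : S → k) hu => ⟨u s0, funext fun s => by
    have := congrFun (congrFun (congrArg Subtype.val hu) s) s0
    change u s0 - u s = 0 at this
    exact sub_eq_zero.1 this⟩

lemma ses2 (s0 : S) : SES (jWQ Ω k) (nQ Ω k) where
  inj := fun (a b : Wsub k S) h => Subtype.ext (congrArg (fun q : Qsub Ω k => q.1.1) h)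
  surj := fun (n : k) => ⟨(⟨(fun a b => n * Ω.ω k s0 a b, n), fun a b c => by
    have := Ω.coc (k := k) s0 a b c
    simp only
    linear_combination n * this⟩ : Qsub Ω k), rfl⟩
  zero := fun a => rfl
  ex := fun (q : Qsub Ω k) hq => by
    have hq' : q.1.2 = 0 := hq
    refine ⟨(⟨q.1.1, fun a b c => ?_⟩ : Wsub k S), Subtype.ext (Prod.ext rfl hq'.symm)⟩
    have := q.2 a b c
    rw [hq'] at this
    simpa using this

end Circ
end SLC

namespace SLC
open CategoryTheory
section Rot

variable {G S : Type} [Group G] [MulAction G S] (Ω : Circ G S) {k : Type} [CommRing k]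

/-- `κ` acts as a positive rotation by `2π/(2r)`. -/
structure Rot (κ : G) (r : ℕ) : Prop where
  pos : 0 < r
  ord : orderOf κ = 2 * r
  hh : ∀ (s : S) (i : ℕ), i < 2 * r → (Ω.h s (κ ^ i • s) ↔ i < r)
  free : ∀ g ∈ Subgroup.zpowers κ, ∀ s : S, g • s = s → g = 1

variable {Ω} {κ : G} {r : ℕ} (R : Rot Ω κ r)

lemma Rot.pow (R : Rot Ω κ r) : κ ^ (2 * r) = 1 := by rw [← R.ord]; exact pow_orderOf_eq_one κ

lemma Rot.le1 (R : Rot Ω κ r) (s : S) (j : ℕ) (hj : j + 1 < 2 * r) :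
    Ω.le s (κ ^ j • s) (κ ^ (j + 1) • s) := by
  have e : κ ^ (j + 1) • s = κ ^ j • (κ ^ 1 • s) := by rw [pow_add, mul_smul]
  unfold Circ.le
  rw [R.hh s j (by omega), R.hh s (j + 1) hj, e]
  have h1 : Ω.h (κ ^ j • s) (κ ^ j • κ ^ 1 • s) ↔ 1 < r := by
    rw [Ω.inv, R.hh s 1 (by omega)]
  rw [h1]
  omega

lemma Rot.le2 (R : Rot Ω κ r) (s : S) :
    ¬ Ω.le s (κ ^ (2 * r - 1) • s) s := by
  have := R.pos
  unfold Circ.le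
  rw [R.hh s _ (by omega)]
  have := Ω.h_self s
  have h2 : ¬ (2 * r - 1 < r) := by omega
  tauto

lemma Q_self (q : Qsub Ω k) (s : S) : q.1.1 s s = 0 := by
  have := q.2 s s s
  have h : Ω.ω k s s s = 0 := Ω.ω_zero (Or.inr ⟨Iff.rfl, Ω.h_self s⟩)
  rw [h] at this
  simpa using this

lemma Rot.partial (R : Rot Ω κ r) (q : Qsub Ω k) (s : S) (j : ℕ) (hj : j < 2 * r) :
    ∑ i ∈ Finset.range j, q.1.1 (κ ^ i • s) (κ ^ (i + 1) • s) = q.1.1 s (κ ^ j • s) := by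
  induction j with
  | zero => simp [Q_self]
  | succ j ih =>
    rw [Finset.sum_range_succ, ih (by omega), q.2, Ω.ω_zero (R.le1 s j hj)]
    simp

lemma Rot.total (R : Rot Ω κ r) (q : Qsub Ω k) (s : S) :
    ∑ i ∈ Finset.range (2 * r), q.1.1 (κ ^ i • s) (κ ^ (i + 1) • s) = q.1.2 := by
  have hp := R.pos
  obtain ⟨m, hm⟩ : ∃ m, 2 * r = m + 1 := ⟨2 * r - 1, by omega⟩
  have h2 := R.le2 s
  rw [hm, Finset.sum_range_succ, R.partial q s m (by omega), ← hm, R.pow, one_smul, q.2,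
    show m = 2 * r - 1 by omega, Ω.ω_one h2, Q_self]
  simp

/-- Value of a `Q`-valued function on the rotated base pair. -/
noncomputable def DD (κ : G) (s0 : S) (k : Type) [CommRing k] :
    FR (G ⧸ Subgroup.zpowers κ) (QQ Ω k) ⟶ FR G (TT k G) :=
  mkH (A := FR (G ⧸ Subgroup.zpowers κ) (QQ Ω k)) (B := FR G (TT k G))
    { toFun := fun (F : G ⧸ Subgroup.zpowers κ → Qsub Ω k) (g : G) =>
        (F (QuotientGroup.mk g)).1.1 (g • s0) ((g * κ) • s0)
      map_add' := fun _ _ => rfl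
      map_smul' := fun _ _ => rfl }
    (fun g (F : G ⧸ Subgroup.zpowers κ → Qsub Ω k) => funext fun (x : G) => by
      change (F (g⁻¹ • (QuotientGroup.mk x))).1.1 (g⁻¹ • x • s0) (g⁻¹ • (x * κ) • s0) =
        (F (QuotientGroup.mk (g⁻¹ * x))).1.1 ((g⁻¹ * x) • s0) ((g⁻¹ * x * κ) • s0)
      simp only [mul_smul]
      rfl)

lemma mk_kpow (g : G) (i : ℕ) :
    (QuotientGroup.mk (g * κ ^ i) : G ⧸ Subgroup.zpowers κ) = QuotientGroup.mk g := by
  rw [QuotientGroup.mk_mul_of_mem]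
  exact Subgroup.npow_mem_zpowers κ i

lemma Rot.nsum (R : Rot Ω κ r) (s0 : S) (F : G ⧸ Subgroup.zpowers κ → Qsub Ω k) (g : G) :
    (F (QuotientGroup.mk g)).1.2 =
      ∑ i ∈ Finset.range (2 * r), ((DD (Ω := Ω) κ s0 k).hom F : G → k) (g * κ ^ i) := by
  refine (R.total (Qrho Ω k g⁻¹ (F (QuotientGroup.mk g))) s0).symm.trans ?_
  refine Finset.sum_congr rfl fun i _ => ?_
  change (F (QuotientGroup.mk g)).1.1 (g⁻¹⁻¹ • κ ^ i • s0) (g⁻¹⁻¹ • κ ^ (i + 1) • s0) =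
    (F (QuotientGroup.mk (g * κ ^ i))).1.1 ((g * κ ^ i) • s0) ((g * κ ^ i * κ) • s0)
  rw [mk_kpow]
  simp [mul_smul, pow_succ]

lemma Rot.psum (R : Rot Ω κ r) (s0 : S) (F : G ⧸ Subgroup.zpowers κ → Qsub Ω k) (g : G) (j : ℕ)
    (hj : j < 2 * r) :
    (F (QuotientGroup.mk g)).1.1 (g • s0) ((g * κ ^ j) • s0) =
      ∑ i ∈ Finset.range j, ((DD (Ω := Ω) κ s0 k).hom F : G → k) (g * κ ^ i) := by
  have := R.partial (Qrho Ω k g⁻¹ (F (QuotientGroup.mk g))) s0 j hj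
  change _ = (F (QuotientGroup.mk g)).1.1 (g⁻¹⁻¹ • s0) (g⁻¹⁻¹ • κ ^ j • s0) at this
  rw [mul_smul]
  rw [inv_inv] at this
  rw [← this]
  refine Finset.sum_congr rfl fun i _ => ?_
  change (F (QuotientGroup.mk g)).1.1 (g⁻¹⁻¹ • κ ^ i • s0) (g⁻¹⁻¹ • κ ^ (i + 1) • s0) =
    (F (QuotientGroup.mk (g * κ ^ i))).1.1 ((g * κ ^ i) • s0) ((g * κ ^ i * κ) • s0)
  rw [mk_kpow]
  simp [mul_smul, pow_succ]

/-- The complement of the base orbit in `G/K × S`. -/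
def Zset (κ : G) (s0 : S) : Type :=
  {z : (G ⧸ Subgroup.zpowers κ) × S // ¬ ∃ g : G, z = (QuotientGroup.mk g, g • s0)}

instance (κ : G) (s0 : S) : MulAction G (Zset κ s0) where
  smul g z := ⟨g • z.1, fun ⟨γ, hγ⟩ => z.2 ⟨g⁻¹ * γ, by
    have : z.1 = g⁻¹ • (QuotientGroup.mk γ, γ • s0) := by rw [← hγ, inv_smul_smul]
    rw [this, mul_smul]
    rfl⟩⟩
  one_smul z := Subtype.ext (one_smul G z.1)
  mul_smul g h z := Subtype.ext (mul_smul g h z.1)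

lemma Zset_smul (s0 : S) (g : G) (z : Zset κ s0) : (g • z).1 = g • z.1 := rfl

lemma Rot.free_prod (R : Rot Ω κ r) (g : G) (z : (G ⧸ Subgroup.zpowers κ) × S) (h : g • z = z) :
    g = 1 := by
  obtain ⟨x, s⟩ := z
  obtain ⟨γ, rfl⟩ := QuotientGroup.mk_surjective x
  have h1 : (QuotientGroup.mk (g * γ) : G ⧸ Subgroup.zpowers κ) = QuotientGroup.mk γ :=
    congrArg Prod.fst h
  have h2 : g • s = s := congrArg Prod.snd h
  rw [eq_comm, QuotientGroup.eq] at h1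
  have := R.free _ h1 (γ⁻¹ • s) (by rw [mul_smul, mul_smul, smul_inv_smul, h2])
  have h3 : g = γ * (γ⁻¹ * (g * γ)) * γ⁻¹ := by group
  rw [h3, this]
  group

lemma Rot.acyc_Z (R : Rot Ω κ r) (s0 : S) : Acyc (FR (Zset κ s0) (TT k G)) 1 :=
  acyc_free (Z := Zset κ s0) (fun g z h => R.free_prod g z.1 (congrArg Subtype.val h)) _

lemma Rot.acyc_S (R : Rot Ω κ r) :
    Acyc (FR (G ⧸ Subgroup.zpowers κ) (FR S (TT k G))) 1 := by
  have h := acyc_free (k := k) R.free_prod (TT k G)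
  refine h.retract (B := FR ((G ⧸ Subgroup.zpowers κ) × S) (TT k G))
    (mkH (A := FR (G ⧸ Subgroup.zpowers κ) (FR S (TT k G)))
      (B := FR ((G ⧸ Subgroup.zpowers κ) × S) (TT k G))
      { toFun := fun u z => u z.1 z.2
        map_add' := fun _ _ => rfl
        map_smul' := fun _ _ => rfl } (fun g u => rfl))
    (mkH (A := FR ((G ⧸ Subgroup.zpowers κ) × S) (TT k G))
      (B := FR (G ⧸ Subgroup.zpowers κ) (FR S (TT k G)))
      { toFun := fun u x s => u (x, s)
        map_add' := fun _ _ => rfl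
        map_smul' := fun _ _ => rfl } (fun g u => rfl)) (hom_ext' fun _ => rfl)

open Classical in
/-- Extension by zero of a function on the complement of the base orbit. -/
noncomputable def tl (s0 : S) (u : Zset κ s0 → k) (x : G ⧸ Subgroup.zpowers κ) (s : S) : k :=
  if h : ¬ ∃ g : G, (x, s) = (QuotientGroup.mk g, g • s0) then u ⟨(x, s), h⟩ else 0

lemma tl_base (s0 : S) (u : Zset κ s0 → k) (g : G) : tl s0 u (QuotientGroup.mk g) (g • s0) = 0 := by
  unfold tl
  rw [dif_neg]
  exact not_not.2 ⟨g, rfl⟩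

lemma tl_of (s0 : S) (u : Zset κ s0 → k) (z : Zset κ s0) : tl s0 u z.1.1 z.1.2 = u z := by
  unfold tl
  rw [dif_pos z.2]
  rfl

lemma tl_smul (s0 : S) (u : Zset κ s0 → k) (g : G) (x) (s) :
    tl s0 (fun z => u (g⁻¹ • z)) x s = tl s0 u (g⁻¹ • x) (g⁻¹ • s) := by
  by_cases h : ∃ γ : G, (x, s) = (QuotientGroup.mk γ, γ • s0)
  · obtain ⟨γ, hγ⟩ := h
    obtain ⟨rfl, rfl⟩ := Prod.ext_iff.1 hγ
    rw [tl_base]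
    have := tl_base s0 u (g⁻¹ * γ)
    rw [mul_smul] at this
    exact this.symm
  · have h1 := tl_of s0 (fun z => u (g⁻¹ • z)) ⟨(x, s), h⟩
    have h2 := tl_of s0 u (g⁻¹ • ⟨(x, s), h⟩)
    exact h1.trans h2.symm

/-- The kernel of `DD`. -/
noncomputable def eZ (κ : G) (s0 : S) (k : Type) [CommRing k] :
    FR (Zset κ s0) (TT k G) ⟶ FR (G ⧸ Subgroup.zpowers κ) (QQ Ω k) :=
  mkH (A := FR (Zset κ s0) (TT k G)) (B := FR (G ⧸ Subgroup.zpowers κ) (QQ Ω k))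
    { toFun := fun (u : Zset κ s0 → k) x => (⟨(fun a b => tl s0 u x b - tl s0 u x a, 0),
        fun a b c => by simp⟩ : Qsub Ω k)
      map_add' := fun (u v : Zset κ s0 → k) => funext fun x => Subtype.ext (Prod.ext (by
        funext a b
        change tl s0 (u + v) x b - tl s0 (u + v) x a = (tl s0 u x b - tl s0 u x a) + (tl s0 v x b - tl s0 v x a)
        have : ∀ s, tl s0 (u + v) x s = tl s0 u x s + tl s0 v x s := by
          intro s
          unfold tl
          split_ifs with h
          · exact (add_zero (0 : k)).symm
          · rfl
        rw [this, this]
        ring) (add_zero (0 : k)).symm)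
      map_smul' := fun t (u : Zset κ s0 → k) => funext fun x => Subtype.ext (Prod.ext (by
        funext a b
        change tl s0 (t • u) x b - tl s0 (t • u) x a = t * (tl s0 u x b - tl s0 u x a)
        have : ∀ s, tl s0 (t • u) x s = t * tl s0 u x s := by
          intro s
          unfold tl
          split_ifs with h
          · exact (mul_zero t).symm
          · rfl
        rw [this, this]
        ring) (mul_zero t).symm) }
    (fun g (u : Zset κ s0 → k) => funext fun x => Subtype.ext (Prod.ext (by
        funext a b
        change tl s0 (fun z => u (g⁻¹ • z)) x b - tl s0 (fun z => u (g⁻¹ • z)) x a =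
          tl s0 u (g⁻¹ • x) (g⁻¹ • b) - tl s0 u (g⁻¹ • x) (g⁻¹ • a)
        rw [tl_smul, tl_smul]) rfl))

open Classical in
lemma Rot.exists_pow (R : Rot Ω κ r) {g g' : G}
    (h : (QuotientGroup.mk g : G ⧸ Subgroup.zpowers κ) = QuotientGroup.mk g') :
    ∃ i < 2 * r, g' = g * κ ^ i := by
  rw [QuotientGroup.eq] at h
  have hf : IsOfFinOrder κ := orderOf_pos_iff.1 (by rw [R.ord]; have := R.pos; omega)
  obtain ⟨i, hi, h2⟩ := (hf.mem_zpowers_iff_mem_range_orderOf (y := g⁻¹ * g')).1 h |> Finset.mem_image.1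
  refine ⟨i, by simpa [R.ord] using hi, ?_⟩
  rw [h2]
  group

open Classical in
lemma Rot.surj (R : Rot Ω κ r) (s0 : S) (v : G → k) :
    ∃ F : G ⧸ Subgroup.zpowers κ → Qsub Ω k, ∀ g,
      (F (QuotientGroup.mk g)).1.1 (g • s0) ((g * κ) • s0) = v g := by
  have hpos := R.pos
  -- pointwise construction
  have key : ∀ γ : G, ∃ q : Qsub Ω k, ∀ i < 2 * r,
      q.1.1 ((γ * κ ^ i) • s0) ((γ * κ ^ (i + 1)) • s0) = v (γ * κ ^ i) := by
    intro γ
    have hinj : ∀ i < 2 * r, ∀ j < 2 * r, (γ * κ ^ i) • s0 = (γ * κ ^ j) • s0 → i = j := by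
      intro i hi j hj h
      rw [mul_smul, mul_smul, smul_left_cancel_iff] at h
      have h2 : ((κ ^ j)⁻¹ * κ ^ i) • s0 = s0 := by rw [mul_smul, h, inv_smul_smul]
      have h3 := R.free _ (Subgroup.mul_mem _ (Subgroup.inv_mem _ (Subgroup.npow_mem_zpowers κ j))
        (Subgroup.npow_mem_zpowers κ i)) s0 h2
      rw [inv_mul_eq_one] at h3
      exact (pow_injOn_Iio_orderOf (x := κ) (by simpa [R.ord] using hj) (by simpa [R.ord] using hi) h3).symm
    let u : S → k := fun s => if h : ∃ i < 2 * r, s = (γ * κ ^ i) • s0 then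
      ∑ j ∈ Finset.range h.choose, v (γ * κ ^ j) else 0
    have hu : ∀ i < 2 * r, u ((γ * κ ^ i) • s0) = ∑ j ∈ Finset.range i, v (γ * κ ^ j) := by
      intro i hi
      have h : ∃ i' < 2 * r, (γ * κ ^ i) • s0 = (γ * κ ^ i') • s0 := ⟨i, hi, rfl⟩
      simp only [u]
      rw [dif_pos h]
      have := hinj i hi h.choose h.choose_spec.1 h.choose_spec.2
      rw [← this]
    let n : k := ∑ j ∈ Finset.range (2 * r), v (γ * κ ^ j)
    let q : Qsub Ω k := ⟨(fun a b => n * Ω.ω k (γ • s0) a b + (u b - u a), n), fun a b c => by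
      have := Ω.coc (k := k) (γ • s0) a b c
      simp only
      linear_combination n * this⟩
    have hq : ∀ a b, q.1.1 a b = n * Ω.ω k (γ • s0) a b + (u b - u a) := fun a b => rfl
    refine ⟨q, fun i hi => ?_⟩
    rw [hq, hu i hi]
    have hω : ∀ j, Ω.ω k (γ • s0) ((γ * κ ^ i) • s0) ((γ * κ ^ j) • s0) = Ω.ω k s0 (κ ^ i • s0) (κ ^ j • s0) := by
      intro j
      rw [mul_smul, mul_smul, Ω.ω_inv]
    rw [hω]
    by_cases h2 : i + 1 < 2 * r
    · rw [hu (i + 1) h2, Ω.ω_zero (R.le1 s0 i h2), Finset.sum_range_succ]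
      ring
    · have e : i = 2 * r - 1 := by omega
      have e2 : i + 1 = 2 * r := by omega
      have := R.le2 s0
      rw [← e] at this
      have hu0 := hu 0 (by omega)
      rw [e2, R.pow, one_smul, Ω.ω_one this]
      simp only [pow_zero, Finset.range_zero, Finset.sum_empty] at hu0
      rw [hu0]
      simp only [n]
      rw [← e2, Finset.sum_range_succ]
      ring
  choose q hq using key
  refine ⟨fun x => q (Quotient.out x), fun g => ?_⟩
  have h1 : (QuotientGroup.mk (Quotient.out (QuotientGroup.mk g : G ⧸ Subgroup.zpowers κ)) : G ⧸ Subgroup.zpowers κ) = QuotientGroup.mk g :=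
    Quotient.out_eq _
  obtain ⟨i, hi, h2⟩ := R.exists_pow h1
  have := hq (Quotient.out (QuotientGroup.mk g : G ⧸ Subgroup.zpowers κ)) i hi
  rw [pow_succ, ← mul_assoc, ← h2] at this
  exact this

lemma Rot.ses (R : Rot Ω κ r) (s0 : S) : SES (eZ (Ω := Ω) κ s0 k) (DD κ s0 k) where
  inj := by
    intro (u : Zset κ s0 → k) (v : Zset κ s0 → k) h
    funext z
    obtain ⟨g, hg⟩ := QuotientGroup.mk_surjective z.1.1
    have h1 := congrFun (congrFun (congrArg (fun q : Qsub Ω k => q.1.1) (congrFun h z.1.1)) (g • s0)) z.1.2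
    change tl s0 u z.1.1 z.1.2 - tl s0 u z.1.1 (g • s0) = tl s0 v z.1.1 z.1.2 - tl s0 v z.1.1 (g • s0) at h1
    rw [tl_of, tl_of, ← hg, tl_base, tl_base] at h1
    simpa using h1
  surj := by
    intro (v : G → k)
    obtain ⟨F, hF⟩ := R.surj s0 v
    exact ⟨F, funext hF⟩
  zero := by
    intro (u : Zset κ s0 → k)
    funext g
    change tl s0 u (QuotientGroup.mk g) ((g * κ) • s0) - tl s0 u (QuotientGroup.mk g) (g • s0) = 0
    have h := tl_base s0 u (g * κ)
    have e := mk_kpow (κ := κ) g 1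
    rw [pow_one] at e
    rw [e] at h
    rw [h, tl_base, sub_zero]
  ex := by
    intro (F : G ⧸ Subgroup.zpowers κ → Qsub Ω k) hF
    have hF' : ∀ g, ((DD (Ω := Ω) κ s0 k).hom F : G → k) g = 0 := fun g => congrFun hF g
    have hn : ∀ g : G, (F (QuotientGroup.mk g)).1.2 = 0 := by
      intro g
      rw [R.nsum s0]
      exact Finset.sum_eq_zero fun i _ => hF' _
    have h0 : ∀ g (i : ℕ), i < 2 * r → (F (QuotientGroup.mk g)).1.1 (g • s0) ((g * κ ^ i) • s0) = 0 := by
      intro g i hi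
      rw [R.psum s0 F g i hi]
      exact Finset.sum_eq_zero fun i _ => hF' _
    let u : Zset κ s0 → k := fun z => (F z.1.1).1.1 (Quotient.out z.1.1 • s0) z.1.2
    have hu : ∀ x s, tl s0 u x s = (F x).1.1 (Quotient.out x • s0) s := by
      intro x s
      by_cases h : ∃ γ : G, (x, s) = (QuotientGroup.mk γ, γ • s0)
      · obtain ⟨γ, hγ⟩ := h
        obtain ⟨rfl, rfl⟩ := Prod.ext_iff.1 hγ
        simp only
        rw [tl_base]
        have h1 : (QuotientGroup.mk (Quotient.out (QuotientGroup.mk γ : G ⧸ Subgroup.zpowers κ)) : G ⧸ Subgroup.zpowers κ) = QuotientGroup.mk γ :=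
          Quotient.out_eq _
        obtain ⟨i, hi, h2⟩ := R.exists_pow h1
        have h3 := h0 (Quotient.out (QuotientGroup.mk γ : G ⧸ Subgroup.zpowers κ)) i hi
        rw [← h2, h1] at h3
        exact h3.symm
      · exact tl_of s0 u ⟨(x, s), h⟩
    refine ⟨u, funext fun x => Subtype.ext (Prod.ext ?_ ?_)⟩
    · funext a b
      change tl s0 u x b - tl s0 u x a = (F x).1.1 a b
      rw [hu, hu]
      have := (F x).2 (Quotient.out x • s0) a b
      obtain ⟨g, rfl⟩ := QuotientGroup.mk_surjective x
      rw [hn, zero_mul, add_zero] at this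
      linear_combination -this
    · obtain ⟨g, rfl⟩ := QuotientGroup.mk_surjective x
      exact (hn g).symm

lemma Rot.acyc_Q (R : Rot Ω κ r) (s0 : S) :
    Acyc (FR (G ⧸ Subgroup.zpowers κ) (QQ Ω k)) 1 :=
  Acyc.mid (R.ses s0) (R.acyc_Z s0) (acyc_G _)

end Rot
end SLC

namespace SLC
open CategoryTheory
section Per

variable {G S : Type} [Group G] [MulAction G S] (Ω : Circ G S) (s0 : S) {k : Type} [CommRing k]

/-- The periodicity map. -/
noncomputable def Phi (k : Type) [CommRing k] (X : Type) [MulAction G X] (n : ℕ) :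
    Hc (FR X (TT k G)) n →+ Hc (FR X (TT k G)) (n + 2) :=
  (((ses1 (k := k) (G := G) s0).FR X).δ (n + 1)).comp (((ses2 (k := k) Ω s0).FR X).δ n)

lemma Phi_nat {X Y : Type} [MulAction G X] [MulAction G Y] (p : X → Y)
    (hp : ∀ (g : G) x, p (g • x) = g • p x) (n : ℕ) (x : Hc (FR Y (TT k G)) n) :
    hmap (pull p hp (TT k G)) (n + 2) (Phi Ω s0 k Y n x) =
      Phi Ω s0 k X n (hmap (pull p hp (TT k G)) n x) := by
  unfold Phi
  simp only [AddMonoidHom.comp_apply]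
  rw [SES.δ_nat ((ses2 (k := k) Ω s0).FR Y) ((ses2 (k := k) Ω s0).FR X) (pull p hp _) (pull p hp _)
    (pull p hp _) (hom_ext' fun _ => rfl) (hom_ext' fun _ => rfl),
    SES.δ_nat ((ses1 (k := k) s0).FR Y) ((ses1 (k := k) s0).FR X) (pull p hp _) (pull p hp _)
    (pull p hp _) (hom_ext' fun _ => rfl) (hom_ext' fun _ => rfl)]

lemma Phi_surj {X : Type} [MulAction G X] {d : ℕ} (h1 : Acyc (FR X (FR S (TT k G))) d)
    (h2 : Acyc (FR X (QQ Ω k)) d) (n : ℕ) (hn : d ≤ n + 1) (y) : ∃ x, Phi Ω s0 k X n x = y := by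
  obtain ⟨z, rfl⟩ := ((ses1 (k := k) (G := G) s0).FR X).ex_A (n + 1) y (h1 _ (by omega) _)
  obtain ⟨w, rfl⟩ := ((ses2 (k := k) Ω s0).FR X).ex_A n z (h2 _ (by omega) _)
  exact ⟨w, rfl⟩

lemma Phi_ker {X : Type} [MulAction G X] {d : ℕ} (h1 : Acyc (FR X (FR S (TT k G))) d)
    (n : ℕ) (hn : d ≤ n + 1) (x) (hx : Phi Ω s0 k X n x = 0) :
    ∃ y, hmap (FRmap X (nQ Ω k)) n y = x := by
  obtain ⟨z, hz⟩ := ((ses1 (k := k) (G := G) s0).FR X).ex_C (n + 1) _ hx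
  rw [h1 (n + 1) hn z, map_zero] at hz
  exact ((ses2 (k := k) Ω s0).FR X).ex_C n x hz.symm

lemma Phi_zero {X : Type} [MulAction G X] (n : ℕ) (y) :
    Phi Ω s0 k X n (hmap (FRmap X (nQ Ω k)) n y) = 0 := by
  unfold Phi
  rw [AddMonoidHom.comp_apply, ((ses2 (k := k) Ω s0).FR X).zero_C, map_zero]

lemma Phi_inj {X : Type} [MulAction G X] {d : ℕ} (h1 : Acyc (FR X (FR S (TT k G))) d)
    (h2 : Acyc (FR X (QQ Ω k)) d) (n : ℕ) (hn : d ≤ n) (x) (hx : Phi Ω s0 k X n x = 0) : x = 0 := by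
  obtain ⟨y, rfl⟩ := Phi_ker Ω s0 h1 n (by omega) x hx
  rw [h2 n hn y, map_zero]

/-- The unit class. -/
noncomputable def one (k : Type) [CommRing k] (G : Type) [Group G] (X : Type) [MulAction G X] :
    Hc (FR X (TT k G)) 0 :=
  h0 (A := FR X (TT k G)) (fun _ => (1 : k)) (fun _ => rfl)

/-- The periodicity classes. -/
noncomputable def xi (k : Type) [CommRing k] (X : Type) [MulAction G X] :
    (j : ℕ) → Hc (FR X (TT k G)) (2 * j)
  | 0 => one k G X
  | j + 1 => Phi Ω s0 k X (2 * j) (xi k X j)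

lemma xi_nat {X Y : Type} [MulAction G X] [MulAction G Y] (p : X → Y)
    (hp : ∀ (g : G) x, p (g • x) = g • p x) (j : ℕ) :
    hmap (pull p hp (TT k G)) (2 * j) (xi Ω s0 k Y j) = xi Ω s0 k X j := by
  induction j with
  | zero => exact hmap_h0 _ _ _
  | succ j ih =>
    change hmap (pull p hp (TT k G)) (2 * j + 2) (Phi Ω s0 k Y (2 * j) (xi Ω s0 k Y j)) = _
    rw [Phi_nat, ih]
    rfl

/-- `N` is cyclic, generated by `x` of order `m`. -/
def IsCyc {N : Type} [AddCommGroup N] (x : N) (m : ℕ) : Prop :=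
  (∀ y, ∃ c : ℤ, y = c • x) ∧ ∀ c : ℤ, c • x = 0 ↔ (m : ℤ) ∣ c

lemma h0_zsmul {A : Rep.{0} k G} (a : A.V) (ha) (c : ℤ) :
    c • h0 (A := A) a ha = h0 (c • a) (fun g => by rw [map_zsmul, ha]) := by
  unfold h0
  exact (map_zsmul (groupCohomology.H0Iso A).inv.hom.toAddMonoidHom c ⟨a, ha⟩).symm

lemma one_zsmul {X : Type} [MulAction G X] (c : ℤ) :
    c • one ℤ G X = h0 (A := FR X (TT ℤ G)) (fun _ => (c : ℤ)) (fun _ => rfl) := by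
  refine Eq.trans (h0_zsmul (A := FR X (TT ℤ G)) (fun _ => (1 : ℤ)) (fun _ => rfl) c) ?_
  congr 1
  funext x
  change c • (1 : ℤ) = c
  simp

lemma one_cyc {X : Type} [MulAction G X] [MulAction.IsPretransitive G X] (x0 : X) :
    IsCyc (one ℤ G X) 0 := by
  constructor
  · intro y
    obtain ⟨f, hf, rfl⟩ := h0_surj y
    refine ⟨(f x0 : ℤ), ?_⟩
    rw [one_zsmul]
    congr 1
    funext x
    obtain ⟨g, rfl⟩ := MulAction.exists_smul_eq G x0 x
    have := congrFun (hf g) (g • x0)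
    change f (g⁻¹ • g • x0) = f (g • x0) at this
    rw [inv_smul_smul] at this
    exact this.symm
  · intro c
    rw [one_zsmul]
    constructor
    · intro h
      rw [← h0_zero (A := FR X (TT ℤ G)) (fun g => map_zero _)] at h
      have := congrFun (h0_inj _ _ _ _ h) x0
      have h2 : c = 0 := this
      rw [h2]
      simp
    · intro h
      have h2 : c = 0 := by simpa using h
      subst h2
      exact h0_zero _

variable {Ω} {κ : G} {r : ℕ}

lemma DD_const (F : G ⧸ Subgroup.zpowers κ → Qsub Ω k)
    (hF : ∀ g, (FR (G ⧸ Subgroup.zpowers κ) (QQ Ω k)).ρ g F = F) (g : G) :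
    ((DD (Ω := Ω) κ s0 k).hom F : G → k) g = ((DD (Ω := Ω) κ s0 k).hom F : G → k) 1 := by
  have h := hom_rho (DD (Ω := Ω) κ s0 k) g F
  rw [hF g] at h
  have h2 := congrFun h g
  refine h2.trans ?_
  change ((DD (Ω := Ω) κ s0 k).hom F : G → k) (g⁻¹ * g) = _
  rw [inv_mul_cancel]

lemma Rot.n_inv (R : Rot Ω κ r) (F : G ⧸ Subgroup.zpowers κ → Qsub Ω k)
    (hF : ∀ g, (FR (G ⧸ Subgroup.zpowers κ) (QQ Ω k)).ρ g F = F) (g : G) :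
    (F (QuotientGroup.mk g)).1.2 = (2 * r : ℕ) * ((DD (Ω := Ω) κ s0 k).hom F : G → k) 1 := by
  rw [R.nsum s0]
  rw [Finset.sum_congr rfl fun i _ => DD_const s0 F hF _]
  simp

lemma Rot.H1 (s0 : S) (R : Rot Ω κ r) (x : Hc (FR (G ⧸ Subgroup.zpowers κ) (TT ℤ G)) 1) : x = 0 := by
  obtain ⟨y, rfl⟩ := ((ses1 (k := ℤ) (G := G) s0).FR (G ⧸ Subgroup.zpowers κ)).ex_A 0 x
    (R.acyc_S _ le_rfl _)
  obtain ⟨F, hF, rfl⟩ := h0_surj y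
  have hinv : ∀ (g : G) x a b, (F (g • x)).1 (g • a) (g • b) = (F x).1 a b := by
    intro g x a b
    have := congrArg (fun w : Wsub ℤ S => w.1 (g • a) (g • b)) (congrFun (hF g) (g • x))
    change (F (g⁻¹ • g • x)).1 (g⁻¹ • g • a) (g⁻¹ • g • b) = _ at this
    simp only [inv_smul_smul] at this
    exact this.symm
  let F' : G ⧸ Subgroup.zpowers κ → Qsub Ω ℤ := (FRmap (G ⧸ Subgroup.zpowers κ) (jWQ Ω ℤ)).hom F
  have hF' : ∀ g, (FR (G ⧸ Subgroup.zpowers κ) (QQ Ω ℤ)).ρ g F' = F' := by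
    intro g
    have := hom_rho (FRmap (G ⧸ Subgroup.zpowers κ) (jWQ Ω ℤ)) g F
    rw [hF g] at this
    exact this.symm
  have hz : ((DD (Ω := Ω) κ s0 ℤ).hom F' : G → ℤ) 1 = 0 := by
    have := R.n_inv s0 F' hF' 1
    have h2 : (F' (QuotientGroup.mk 1)).1.2 = 0 := rfl
    rw [h2] at this
    have hp := R.pos
    rcases mul_eq_zero.1 this.symm with h | h
    · norm_cast at h; omega
    · exact h
  have hz' : ∀ g, ((DD (Ω := Ω) κ s0 ℤ).hom F' : G → ℤ) g = 0 := fun g => by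
    rw [DD_const s0 F' hF', hz]
  have h0' : ∀ g g' : G, (QuotientGroup.mk g : G ⧸ Subgroup.zpowers κ) = QuotientGroup.mk g' →
      (F (QuotientGroup.mk g)).1 (g • s0) (g' • s0) = 0 := by
    intro g g' h
    obtain ⟨i, hi, rfl⟩ := R.exists_pow h
    have := R.psum s0 F' g i hi
    rw [Finset.sum_eq_zero fun i _ => hz' _] at this
    exact this
  let u : G ⧸ Subgroup.zpowers κ → S → ℤ := fun x s => (F x).1 (Quotient.out x • s0) s
  have hu : ∀ (g : G) s, u (QuotientGroup.mk g) s = (F (QuotientGroup.mk g)).1 (g • s0) s := by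
    intro g s
    have h1 : (QuotientGroup.mk (Quotient.out (QuotientGroup.mk g : G ⧸ Subgroup.zpowers κ)) : G ⧸ Subgroup.zpowers κ) = QuotientGroup.mk g :=
      Quotient.out_eq _
    have h2 := h0' _ _ h1
    rw [h1] at h2
    have h3 := (F (QuotientGroup.mk g)).2 (Quotient.out (QuotientGroup.mk g : G ⧸ Subgroup.zpowers κ) • s0) (g • s0) s
    rw [h2, zero_add] at h3
    exact h3.symm
  have huinv : ∀ g, (FR (G ⧸ Subgroup.zpowers κ) (FR S (TT ℤ G))).ρ g u = u := by
    intro g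
    funext x s
    obtain ⟨γ, rfl⟩ := QuotientGroup.mk_surjective x
    change u (QuotientGroup.mk (g⁻¹ * γ)) (g⁻¹ • s) = u (QuotientGroup.mk γ) s
    rw [hu, hu, ← hinv g⁻¹ (QuotientGroup.mk γ) (γ • s0) s, mul_smul]
    rfl
  have : h0 F hF = hmap (FRmap (G ⧸ Subgroup.zpowers κ) (cob G S ℤ)) 0 (h0 u huinv) := by
    rw [hmap_h0]
    congr 1
    funext x
    apply Subtype.ext
    funext a b
    change (F x).1 a b = (F x).1 (Quotient.out x • s0) b - (F x).1 (Quotient.out x • s0) a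
    have := (F x).2 (Quotient.out x • s0) a b
    linear_combination this
  rw [this]
  exact ((ses1 (k := ℤ) (G := G) s0).FR (G ⧸ Subgroup.zpowers κ)).zero_C 0 _

lemma Rot.Hodd (s0 : S) (R : Rot Ω κ r) (j : ℕ) (x : Hc (FR (G ⧸ Subgroup.zpowers κ) (TT ℤ G)) (2 * j + 1)) :
    x = 0 := by
  induction j with
  | zero => exact R.H1 s0 x
  | succ j ih =>
    obtain ⟨y, rfl⟩ := Phi_surj Ω s0 R.acyc_S (R.acyc_Q s0) (2 * j + 1) (by omega) x
    rw [ih y, map_zero]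

lemma Rot.xi_cyc (R : Rot Ω κ r) (j : ℕ) :
    IsCyc (xi Ω s0 ℤ (G ⧸ Subgroup.zpowers κ) (j + 1)) (2 * r) := by
  have hgen0 : ∀ j (y : Hc (FR (G ⧸ Subgroup.zpowers κ) (TT ℤ G)) (2 * j)), ∃ c : ℤ,
      y = c • xi Ω s0 ℤ (G ⧸ Subgroup.zpowers κ) j := by
    intro j
    induction j with
    | zero => exact (one_cyc (X := G ⧸ Subgroup.zpowers κ) (QuotientGroup.mk 1)).1
    | succ j ih =>
      intro y
      obtain ⟨z, rfl⟩ := Phi_surj Ω s0 R.acyc_S (R.acyc_Q s0) (2 * j) (by omega) y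
      obtain ⟨c, rfl⟩ := ih z
      exact ⟨c, map_zsmul _ _ _⟩
  refine ⟨hgen0 (j + 1), ?_⟩
  induction j with
  | zero =>
    intro c
    have e : c • xi Ω s0 ℤ (G ⧸ Subgroup.zpowers κ) 1 = Phi Ω s0 ℤ (G ⧸ Subgroup.zpowers κ) 0 (c • one ℤ G _) :=
      (map_zsmul _ _ _).symm
    constructor
    · intro h
      rw [e] at h
      obtain ⟨y, hy⟩ := Phi_ker Ω s0 R.acyc_S 0 (by omega) _ h
      obtain ⟨F, hF, rfl⟩ := h0_surj y
      rw [hmap_h0, one_zsmul] at hy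
      have h2 := congrFun (h0_inj _ _ _ _ hy) (QuotientGroup.mk 1)
      have h3 : (F (QuotientGroup.mk 1)).1.2 = c := h2
      rw [← h3, R.n_inv s0 F hF 1]
      exact Dvd.intro _ rfl
    · rintro ⟨t, rfl⟩
      obtain ⟨y, hy⟩ := (R.ses (k := ℤ) s0).ex_C 0
        (h0 (A := FR G (TT ℤ G)) (fun _ => (1 : ℤ)) (fun _ => rfl)) (R.acyc_Z s0 _ le_rfl _)
      obtain ⟨F, hF, rfl⟩ := h0_surj y
      rw [hmap_h0] at hy
      have h2 : ((DD (Ω := Ω) κ s0 ℤ).hom F : G → ℤ) 1 = 1 := congrFun (h0_inj _ _ _ _ hy) 1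
      have h3 : hmap (FRmap (G ⧸ Subgroup.zpowers κ) (nQ Ω ℤ)) 0 (h0 F hF) =
          ((2 * r : ℕ) : ℤ) • one ℤ G (G ⧸ Subgroup.zpowers κ) := by
        rw [one_zsmul, hmap_h0]
        congr 1
        funext x
        obtain ⟨g, rfl⟩ := QuotientGroup.mk_surjective x
        have := R.n_inv s0 F hF g
        rw [h2, mul_one] at this
        exact this
      have h4 := Phi_zero Ω s0 0 (h0 F hF)
      rw [h3, map_zsmul] at h4
      have h5 : ∀ {N : Type} [AddCommGroup N] (m t : ℤ) (x : N), m • x = 0 → (m * t) • x = 0 := by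
        intro N _ m t x hx
        rw [mul_comm, mul_smul, hx, smul_zero]
      exact h5 _ t _ h4
  | succ j ih =>
    intro c
    rw [← ih c]
    have e : c • xi Ω s0 ℤ (G ⧸ Subgroup.zpowers κ) (j + 1 + 1) =
      Phi Ω s0 ℤ (G ⧸ Subgroup.zpowers κ) (2 * (j + 1)) (c • xi Ω s0 ℤ _ (j + 1)) :=
      (map_zsmul _ _ _).symm
    rw [e]
    constructor
    · intro h
      exact Phi_inj Ω s0 R.acyc_S (R.acyc_Q s0) _ (by omega) _ h
    · intro h
      rw [h, map_zero]

end Per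
end SLC

namespace SLC
open CategoryTheory

/-- The ring `ℤ[1/2]`. -/
abbrev ZH : Type := Localization.Away (2 : ℤ)

/-- The group `SL₂(ℤ[1/2])`. -/
abbrev GG : Type := Matrix.SpecialLinearGroup (Fin 2) ZH

/-- The group `SL₂(ℤ)`. -/
abbrev SZ : Type := Matrix.SpecialLinearGroup (Fin 2) ℤ

/-- The element one half. -/
noncomputable def hf : ZH := IsLocalization.Away.invSelf (2 : ℤ)

lemma two_hf : (2 : ZH) * hf = 1 := by
  have := IsLocalization.Away.mul_invSelf (S := ZH) (2 : ℤ)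
  simpa [hf] using this

/-- The real embedding. -/
noncomputable def psi : ZH →+* ℝ :=
  IsLocalization.Away.lift (2 : ℤ) (g := Int.castRingHom ℝ) (by simp)

lemma psi_hf : psi hf = 1 / 2 := by
  have := congrArg psi two_hf
  rw [map_mul, map_one, map_ofNat] at this
  linarith

lemma psi_two : psi 2 = 2 := map_ofNat psi 2

/-- Nonzero real vectors. -/
def SS : Type := {v : Fin 2 → ℝ // v ≠ 0}

noncomputable instance : MulAction GG SS where
  smul g v := ⟨(Matrix.SpecialLinearGroup.map psi g : Matrix (Fin 2) (Fin 2) ℝ).mulVec v.1, by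
    intro h
    apply v.2
    have h2 := congrArg ((Matrix.SpecialLinearGroup.map psi g⁻¹ : Matrix (Fin 2) (Fin 2) ℝ).mulVec) h
    rw [Matrix.mulVec_mulVec, Matrix.mulVec_zero] at h2
    rw [← Matrix.SpecialLinearGroup.coe_mul, ← map_mul, inv_mul_cancel, map_one] at h2
    simpa using h2⟩
  one_smul v := Subtype.ext (by
    change (Matrix.SpecialLinearGroup.map psi (1 : GG) : Matrix (Fin 2) (Fin 2) ℝ).mulVec v.1 = v.1
    rw [map_one]; simp)
  mul_smul g h v := Subtype.ext (by
    change (Matrix.SpecialLinearGroup.map psi (g * h) : Matrix (Fin 2) (Fin 2) ℝ).mulVec v.1 =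
      (Matrix.SpecialLinearGroup.map psi g : Matrix (Fin 2) (Fin 2) ℝ).mulVec
      ((Matrix.SpecialLinearGroup.map psi h : Matrix (Fin 2) (Fin 2) ℝ).mulVec v.1)
    rw [Matrix.mulVec_mulVec, map_mul]; rfl)

section Ent
variable {R : Type} [CommRing R]
lemma m00 (g h : Matrix.SpecialLinearGroup (Fin 2) R) :
    (g * h) 0 0 = g 0 0 * h 0 0 + g 0 1 * h 1 0 := by
  rw [Matrix.SpecialLinearGroup.coe_mul, Matrix.mul_apply, Fin.sum_univ_two]
lemma m01 (g h : Matrix.SpecialLinearGroup (Fin 2) R) :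
    (g * h) 0 1 = g 0 0 * h 0 1 + g 0 1 * h 1 1 := by
  rw [Matrix.SpecialLinearGroup.coe_mul, Matrix.mul_apply, Fin.sum_univ_two]
lemma m10 (g h : Matrix.SpecialLinearGroup (Fin 2) R) :
    (g * h) 1 0 = g 1 0 * h 0 0 + g 1 1 * h 1 0 := by
  rw [Matrix.SpecialLinearGroup.coe_mul, Matrix.mul_apply, Fin.sum_univ_two]
lemma m11 (g h : Matrix.SpecialLinearGroup (Fin 2) R) :
    (g * h) 1 1 = g 1 0 * h 0 1 + g 1 1 * h 1 1 := by
  rw [Matrix.SpecialLinearGroup.coe_mul, Matrix.mul_apply, Fin.sum_univ_two]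
lemma sl_det (g : Matrix.SpecialLinearGroup (Fin 2) R) : g 0 0 * g 1 1 - g 0 1 * g 1 0 = 1 :=
  Matrix.det_fin_two g.1 ▸ g.2
lemma sl_ext {g h : Matrix.SpecialLinearGroup (Fin 2) R} (h1 : g 0 0 = h 0 0) (h2 : g 0 1 = h 0 1)
    (h3 : g 1 0 = h 1 0) (h4 : g 1 1 = h 1 1) : g = h := by
  apply Subtype.ext
  ext i j
  fin_cases i <;> fin_cases j
  · exact h1
  · exact h2
  · exact h3
  · exact h4
lemma n00 (g : Matrix.SpecialLinearGroup (Fin 2) R) : (-g) 0 0 = - g 0 0 := by simp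
lemma n01 (g : Matrix.SpecialLinearGroup (Fin 2) R) : (-g) 0 1 = - g 0 1 := by simp
lemma n10 (g : Matrix.SpecialLinearGroup (Fin 2) R) : (-g) 1 0 = - g 1 0 := by simp
lemma n11 (g : Matrix.SpecialLinearGroup (Fin 2) R) : (-g) 1 1 = - g 1 1 := by simp
lemma o00 : (1 : Matrix.SpecialLinearGroup (Fin 2) R) 0 0 = 1 := by simp
lemma o01 : (1 : Matrix.SpecialLinearGroup (Fin 2) R) 0 1 = 0 := by simp
lemma o10 : (1 : Matrix.SpecialLinearGroup (Fin 2) R) 1 0 = 0 := by simp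
lemma o11 : (1 : Matrix.SpecialLinearGroup (Fin 2) R) 1 1 = 1 := by simp
end Ent

lemma smul0 (g : GG) (v : SS) : (g • v).1 0 = psi (g 0 0) * v.1 0 + psi (g 0 1) * v.1 1 := by
  change (Matrix.SpecialLinearGroup.map psi g : Matrix (Fin 2) (Fin 2) ℝ).mulVec v.1 0 = _
  simp [Matrix.mulVec, dotProduct, Fin.sum_univ_two]

lemma smul1 (g : GG) (v : SS) : (g • v).1 1 = psi (g 1 0) * v.1 0 + psi (g 1 1) * v.1 1 := by
  change (Matrix.SpecialLinearGroup.map psi g : Matrix (Fin 2) (Fin 2) ℝ).mulVec v.1 1 = _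
  simp [Matrix.mulVec, dotProduct, Fin.sum_univ_two]

/-- The determinant pairing. -/
def dt (a b : SS) : ℝ := a.1 0 * b.1 1 - a.1 1 * b.1 0

lemma dt_smul (g : GG) (a b : SS) : dt (g • a) (g • b) = dt a b := by
  have h : psi (g 0 0) * psi (g 1 1) - psi (g 0 1) * psi (g 1 0) = 1 := by
    have := congrArg psi (Matrix.det_fin_two g.1 ▸ g.2)
    simpa using this
  unfold dt
  rw [smul0, smul0, smul1, smul1]
  linear_combination (a.1 0 * b.1 1 - a.1 1 * b.1 0) * h

/-- The associated complex number. -/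
noncomputable def cpx (a : SS) : ℂ := ⟨a.1 0, a.1 1⟩

lemma cpx_ne (a : SS) : cpx a ≠ 0 := by
  intro h
  apply a.2
  funext i
  fin_cases i
  · exact congrArg Complex.re h
  · exact congrArg Complex.im h

lemma polar (a : SS) : ∃ r : ℝ, 0 < r ∧ a.1 0 = r * Real.cos (cpx a).arg ∧
    a.1 1 = r * Real.sin (cpx a).arg :=
  ⟨‖cpx a‖, norm_pos_iff.2 (cpx_ne a), (Complex.norm_mul_cos_arg (cpx a)).symm,
    (Complex.norm_mul_sin_arg (cpx a)).symm⟩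

/-- The concrete circle data. -/
noncomputable def Om : Circ GG SS where
  h a b := 0 < dt a b ∨ ∃ l : ℝ, 0 < l ∧ b.1 = l • a.1
  inv g a b := by
    rw [dt_smul]
    refine or_congr Iff.rfl (exists_congr fun l => and_congr Iff.rfl ?_)
    have key : ∀ (g : GG) (a b : SS), b.1 = l • a.1 → (g • b).1 = l • (g • a).1 := by
      intro g a b h
      funext i
      fin_cases i
      · change (g • b).1 0 = l * (g • a).1 0
        rw [smul0, smul0, h]; simp; ring
      · change (g • b).1 1 = l * (g • a).1 1
        rw [smul1, smul1, h]; simp; ring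
    refine ⟨fun h => ?_, key g a b⟩
    have := key g⁻¹ _ _ h
    rwa [inv_smul_smul, inv_smul_smul] at this
  p a := (cpx a).arg
  c := Real.pi
  cpos := Real.pi_pos
  bd a b := by
    have := Complex.arg_le_pi (cpx a)
    have := Complex.neg_pi_lt_arg (cpx b)
    linarith
  iff a b := by
    obtain ⟨r, hr, ha0, ha1⟩ := polar a
    obtain ⟨r', hr', hb0, hb1⟩ := polar b
    have hd : dt a b = r * r' * Real.sin ((cpx b).arg - (cpx a).arg) := by
      unfold dt
      rw [ha0, ha1, hb0, hb1, Real.sin_sub]; ring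
    have hpos : 0 < r * r' := mul_pos hr hr'
    have h1 := Complex.arg_le_pi (cpx a)
    have h2 := Complex.neg_pi_lt_arg (cpx b)
    have h3 := Complex.arg_le_pi (cpx b)
    have h4 := Complex.neg_pi_lt_arg (cpx a)
    constructor
    · rintro (h | ⟨l, hl, h⟩)
      · rw [hd] at h
        have h := pos_of_mul_pos_right h hpos.le
        by_contra hc
        simp only [not_or, not_and, not_lt] at hc
        by_cases hle : (cpx a).arg ≤ (cpx b).arg
        · have h5 := hc.1 hle
          have := Real.sin_nonneg_of_nonneg_of_le_pi
            (x := (cpx b).arg - (cpx a).arg - Real.pi) (by linarith) (by linarith)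
          rw [Real.sin_sub_pi] at this
          linarith
        · have := Real.sin_nonpos_of_nonpos_of_neg_pi_le
            (x := (cpx b).arg - (cpx a).arg) (by linarith) (by linarith)
          linarith
      · left
        have : (cpx b) = (l : ℂ) * cpx a := by
          apply Complex.ext
          · simpa [cpx] using congrFun h 0
          · simpa [cpx] using congrFun h 1
        rw [this, Complex.arg_real_mul _ hl]
        exact ⟨le_rfl, by linarith [Real.pi_pos]⟩
    · rintro (⟨h5, h6⟩ | h)
      · rcases h5.eq_or_lt with h7 | h7
        · right
          refine ⟨r' / r, by positivity, ?_⟩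
          funext i
          fin_cases i
          · change b.1 0 = r' / r * a.1 0
            rw [ha0, hb0, h7]; field_simp
          · change b.1 1 = r' / r * a.1 1
            rw [ha1, hb1, h7]; field_simp
        · left
          rw [hd]
          exact mul_pos hpos (Real.sin_pos_of_pos_of_lt_pi (by linarith) (by linarith))
      · left
        rw [hd, ← Real.sin_add_two_pi]
        exact mul_pos hpos (Real.sin_pos_of_pos_of_lt_pi (by linarith) (by linarith))

lemma dt_self (a : SS) : dt a a = 0 := by unfold dt; ring

/-- A base vector. -/
def s00 : SS := ⟨fun _ => 1, fun h => one_ne_zero (congrFun h 0)⟩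

lemma neg_smul' (s : SS) : ((-1 : GG) • s).1 = -s.1 := by
  funext i
  fin_cases i
  · change ((-1 : GG) • s).1 0 = - s.1 0
    rw [smul0]; simp
  · change ((-1 : GG) • s).1 1 = - s.1 1
    rw [smul1]; simp

lemma Rot.mk' {κ : GG} {r : ℕ} (hr : 0 < r) (hk : κ ^ r = -1)
    (hd : ∀ (s : SS) (i : ℕ), 0 < i → i < r → 0 < dt s (κ ^ i • s)) : Rot Om κ r := by
  have h2 : κ ^ (2 * r) = 1 := by rw [mul_comm, pow_mul, hk]; simp
  have hge : ∀ (s : SS) i, r ≤ i → (κ ^ i • s).1 = - (κ ^ (i - r) • s).1 := by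
    intro s i hi
    have : κ ^ i = -1 * κ ^ (i - r) := by rw [← hk, ← pow_add]; congr 1; omega
    rw [this, mul_smul, neg_smul']
  have hh : ∀ (s : SS) (i : ℕ), i < 2 * r → (Om.h s (κ ^ i • s) ↔ i < r) := by
    intro s i hi
    constructor
    · intro h
      by_contra hc
      push Not at hc
      have e := hge s i hc
      rcases Nat.eq_zero_or_pos (i - r) with h0 | h0
      · rw [h0, pow_zero, one_smul] at e
        rcases h with h | ⟨l, hl, h⟩
        · unfold dt at h
          rw [e] at h
          simp only [Pi.neg_apply] at h
          linarith
        · rw [e] at h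
          apply s.2
          funext j
          have := congrFun h j
          simp only [Pi.neg_apply, Pi.smul_apply, smul_eq_mul] at this
          have h3 : (l + 1) * s.1 j = 0 := by linarith
          rcases mul_eq_zero.1 h3 with h4 | h4
          · linarith
          · exact h4
      · have hd' := hd s (i - r) h0 (by omega)
        have e2 : dt s (κ ^ i • s) = - dt s (κ ^ (i - r) • s) := by
          unfold dt
          rw [e]; simp only [Pi.neg_apply]; ring
        rcases h with h | ⟨l, hl, h⟩
        · linarith
        · have : dt s (κ ^ i • s) = 0 := by
            unfold dt
            rw [h]; simp only [Pi.smul_apply, smul_eq_mul]; ring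
          linarith
    · intro h
      rcases Nat.eq_zero_or_pos i with rfl | h0
      · right
        exact ⟨1, one_pos, by simp⟩
      · exact Or.inl (hd s i h0 h)
  have hfix : ∀ (s : SS) i, i < 2 * r → κ ^ i • s = s → i = 0 := by
    intro s i hi h
    by_contra h0
    have h1 : i < r := (hh s i hi).1 (by rw [h]; exact Or.inr ⟨1, one_pos, by simp⟩)
    have := hd s i (by omega) h1
    rw [h, dt_self] at this
    exact lt_irrefl _ this
  have hord : orderOf κ = 2 * r := by
    rw [orderOf_eq_iff (by omega)]
    refine ⟨h2, fun m hm hm0 h => ?_⟩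
    have := hfix s00 m hm (by rw [h, one_smul])
    omega
  refine ⟨hr, hord, hh, ?_⟩
  intro g hg s hs
  have hfo : IsOfFinOrder κ := isOfFinOrder_iff_pow_eq_one.2 ⟨2 * r, by omega, h2⟩
  have hg' : g ∈ (Submonoid.powers κ : Set GG) := by
    rw [hfo.powers_eq_zpowers]; exact hg
  obtain ⟨i, rfl⟩ := hg'
  change κ ^ i • s = s at hs
  have e : κ ^ i = κ ^ (i % (2 * r)) := by rw [← hord, pow_mod_orderOf]
  rw [e] at hs
  have := hfix s _ (Nat.mod_lt _ (by omega)) hs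
  change κ ^ i = 1
  rw [e, this, pow_zero]

lemma rot1 : Rot Om (-1 : GG) 1 :=
  Rot.mk' one_pos (by simp) (fun s i h1 h2 => by omega)

lemma Rot.mk2 {κ : GG} (hk : κ ^ 2 = -1) (hd : ∀ s : SS, 0 < dt s (κ • s)) : Rot Om κ 2 :=
  Rot.mk' two_pos hk (fun s i h1 h2 => by
    obtain rfl : i = 1 := by omega
    rw [pow_one]; exact hd s)

lemma Rot.mk3 {κ : GG} (hk : κ ^ 3 = -1) (hd : ∀ s : SS, 0 < dt s (κ • s))
    (hd2 : ∀ s : SS, 0 < dt s (κ • κ • s)) : Rot Om κ 3 :=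
  Rot.mk' (by norm_num) hk (fun s i h1 h2 => by
    rcases (by omega : i = 1 ∨ i = 2) with rfl | rfl
    · rw [pow_one]; exact hd s
    · rw [pow_two, mul_smul]; exact hd2 s)

/-- The standard embedding of `SL₂(ℤ)`. -/
noncomputable def phA : SZ →* GG := Matrix.SpecialLinearGroup.map (Int.castRingHom ZH)

lemma phA_apply (g : SZ) (i j) : phA g i j = ((g i j : ℤ) : ZH) := rfl

/-- The twisted embedding on elements. -/
noncomputable def phB' (g : SZ) : GG :=
  ⟨!![((g 1 1 : ℤ) : ZH), - hf * (g 1 0 : ℤ); -2 * (g 0 1 : ℤ), ((g 0 0 : ℤ) : ZH)], by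
    have h' := congrArg (Int.cast : ℤ → ZH) (sl_det g)
    push_cast at h'
    rw [Matrix.det_fin_two_of]
    linear_combination h' - ((g 0 1 : ℤ) : ZH) * (g 1 0 : ℤ) * two_hf⟩

/-- The twisted embedding of `SL₂(ℤ)`. -/
noncomputable def phB : SZ →* GG where
  toFun := phB'
  map_one' := by
    apply sl_ext
    · change (((1 : SZ) 1 1 : ℤ) : ZH) = _
      rw [o11, o00]; simp
    · change - hf * (((1 : SZ) 1 0 : ℤ) : ZH) = _
      rw [o10, o01]; simp
    · change - 2 * (((1 : SZ) 0 1 : ℤ) : ZH) = _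
      rw [o10, o01]; simp
    · change (((1 : SZ) 0 0 : ℤ) : ZH) = _
      rw [o11, o00]; simp
  map_mul' g h := by
    apply sl_ext
    · rw [m00]
      change (((g * h : SZ) 1 1 : ℤ) : ZH) =
        ((g 1 1 : ℤ) : ZH) * ((h 1 1 : ℤ) : ZH) + (- hf * (g 1 0 : ℤ)) * (-2 * (h 0 1 : ℤ))
      rw [m11]; push_cast
      linear_combination - ((g 1 0 : ℤ) : ZH) * (h 0 1 : ℤ) * two_hf
    · rw [m01]
      change - hf * (((g * h : SZ) 1 0 : ℤ) : ZH) =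
        ((g 1 1 : ℤ) : ZH) * (- hf * ((h 1 0 : ℤ) : ZH)) + (- hf * (g 1 0 : ℤ)) * ((h 0 0 : ℤ))
      rw [m10]; push_cast
      ring
    · rw [m10]
      change - 2 * (((g * h : SZ) 0 1 : ℤ) : ZH) =
        -2 * ((g 0 1 : ℤ) : ZH) * (((h 1 1 : ℤ) : ZH)) + (g 0 0 : ℤ) * (-2 * (h 0 1 : ℤ))
      rw [m01]; push_cast
      ring
    · rw [m11]
      change (((g * h : SZ) 0 0 : ℤ) : ZH) =
        -2 * ((g 0 1 : ℤ) : ZH) * (- hf * ((h 1 0 : ℤ) : ZH)) + ((g 0 0 : ℤ)) * ((h 0 0 : ℤ))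
      rw [m00]; push_cast
      linear_combination - ((g 0 1 : ℤ) : ZH) * (h 1 0 : ℤ) * two_hf

lemma pB00 (g : SZ) : phB g 0 0 = ((g 1 1 : ℤ) : ZH) := rfl
lemma pB01 (g : SZ) : phB g 0 1 = - hf * ((g 1 0 : ℤ) : ZH) := rfl
lemma pB10 (g : SZ) : phB g 1 0 = - 2 * ((g 0 1 : ℤ) : ZH) := rfl
lemma pB11 (g : SZ) : phB g 1 1 = ((g 0 0 : ℤ) : ZH) := rfl

/-- The element of order four. -/
def sS : SZ := ⟨!![0, -1; 1, 0], by simp⟩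
/-- The element of order six. -/
def sU : SZ := ⟨!![0, -1; 1, 1], by simp⟩
/-- The element of order four in `Γ₀(2)`. -/
def sP : SZ := ⟨!![-1, -1; 2, 1], by simp⟩
/-- The translation. -/
def sT : SZ := ⟨!![1, 1; 0, 1], by simp⟩

lemma sS00 : sS 0 0 = 0 := rfl
lemma sS01 : sS 0 1 = -1 := rfl
lemma sS10 : sS 1 0 = 1 := rfl
lemma sS11 : sS 1 1 = 0 := rfl
lemma sU00 : sU 0 0 = 0 := rfl
lemma sU01 : sU 0 1 = -1 := rfl
lemma sU10 : sU 1 0 = 1 := rfl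
lemma sU11 : sU 1 1 = 1 := rfl
lemma sP00 : sP 0 0 = -1 := rfl
lemma sP01 : sP 0 1 = -1 := rfl
lemma sP10 : sP 1 0 = 2 := rfl
lemma sP11 : sP 1 1 = 1 := rfl
lemma sT00 : sT 0 0 = 1 := rfl
lemma sT01 : sT 0 1 = 1 := rfl
lemma sT10 : sT 1 0 = 0 := rfl
lemma sT11 : sT 1 1 = 1 := rfl

lemma sS2 : sS ^ 2 = -1 := by decide
lemma sU3 : sU ^ 3 = -1 := by decide
lemma sP2 : sP ^ 2 = -1 := by decide

lemma phA_neg : phA (-1) = -1 := by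
  apply sl_ext <;> simp only [phA_apply, n00, n01, n10, n11, o00, o01, o10, o11] <;> simp
lemma phB_neg : phB (-1) = -1 := by
  apply sl_ext <;> simp only [pB00, pB01, pB10, pB11, n00, n01, n10, n11, o00, o01, o10, o11] <;> simp

lemma ne_or (s : SS) : s.1 0 ≠ 0 ∨ s.1 1 ≠ 0 := by
  by_contra h
  push Not at h
  apply s.2
  funext i
  fin_cases i
  · exact h.1
  · exact h.2

lemma form_pos (s : SS) (c d : ℝ) (hc : 0 < c) (h : d ^ 2 < 4 * c) :
    0 < s.1 0 ^ 2 + d * s.1 0 * s.1 1 + c * s.1 1 ^ 2 := by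
  have h1 : s.1 0 ^ 2 + d * s.1 0 * s.1 1 + c * s.1 1 ^ 2 =
    (s.1 0 + d / 2 * s.1 1) ^ 2 + (4 * c - d ^ 2) / 4 * s.1 1 ^ 2 := by ring
  rw [h1]
  have h2 : 0 < (4 * c - d ^ 2) / 4 := by linarith
  by_cases h0 : s.1 1 = 0
  · have := (ne_or s).resolve_right (by simpa using h0)
    rw [h0]
    have : 0 < s.1 0 ^ 2 := by positivity
    simpa using this
  · have : 0 < (4 * c - d ^ 2) / 4 * s.1 1 ^ 2 := by positivity
    positivity

lemma rotAS : Rot Om (phA sS) 2 := Rot.mk2 (by rw [← map_pow, sS2, phA_neg]) fun s => by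
  unfold dt; rw [smul0, smul1]; simp only [phA_apply, sS00, sS01, sS10, sS11]; simp
  nlinarith [form_pos s 1 0 (by norm_num) (by norm_num)]
lemma rotBS : Rot Om (phB sS) 2 := Rot.mk2 (by rw [← map_pow, sS2, phB_neg]) fun s => by
  unfold dt; rw [smul0, smul1]; simp only [pB00, pB01, pB10, pB11, sS00, sS01, sS10, sS11]; simp [psi_hf, psi_two]
  nlinarith [form_pos s (1/4) 0 (by norm_num) (by norm_num)]
lemma rotP : Rot Om (phA sP) 2 := Rot.mk2 (by rw [← map_pow, sP2, phA_neg]) fun s => by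
  unfold dt; rw [smul0, smul1]; simp only [phA_apply, sP00, sP01, sP10, sP11]; simp [psi_two]
  nlinarith [form_pos s (1/2) 1 (by norm_num) (by norm_num)]
lemma rotAU : Rot Om (phA sU) 3 := Rot.mk3 (by rw [← map_pow, sU3, phA_neg]) (fun s => by
  unfold dt; rw [smul0, smul1]; simp only [phA_apply, sU00, sU01, sU10, sU11]; simp
  nlinarith [form_pos s 1 1 (by norm_num) (by norm_num)]) (fun s => by
  unfold dt; rw [smul0, smul1, smul0, smul1]; simp only [phA_apply, sU00, sU01, sU10, sU11]; simp
  nlinarith [form_pos s 1 1 (by norm_num) (by norm_num)])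
lemma rotBU : Rot Om (phB sU) 3 := Rot.mk3 (by rw [← map_pow, sU3, phB_neg]) (fun s => by
  unfold dt; rw [smul0, smul1]; simp only [pB00, pB01, pB10, pB11, sU00, sU01, sU10, sU11]; simp [psi_hf, psi_two]
  nlinarith [form_pos s (1/4) (-1/2) (by norm_num) (by norm_num)]) (fun s => by
  unfold dt; rw [smul0, smul1, smul0, smul1]; simp only [pB00, pB01, pB10, pB11, sU00, sU01, sU10, sU11]; simp [psi_hf, psi_two]
  nlinarith [form_pos s (1/4) (-1/2) (by norm_num) (by norm_num)])

end SLC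

namespace SLC
open CategoryTheory
section Tree
variable {k : Type} [CommRing k] {G : Type} [Group G] {V E Y : Type} [MulAction G V] [MulAction G E]
  [MulAction G Y]

/-- The difference map of a graph. -/
noncomputable def dif (s t : E → V) (hs : ∀ (g : G) x, s (g • x) = g • s x)
    (ht : ∀ (g : G) x, t (g • x) = g • t x) (M : Rep.{0} k G) : FR V M ⟶ FR E M :=
  pull t ht M - pull s hs M

lemma dif_apply (s t : E → V) (hs : ∀ (g : G) x, s (g • x) = g • s x)
    (ht : ∀ (g : G) x, t (g • x) = g • t x) (M : Rep.{0} k G) (F : V → M.V) (e : E) :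
    ((dif s t hs ht M).hom F : E → M.V) e = F (t e) - F (s e) := rfl

/-- Combinatorial tree data. -/
structure TreeD (s t : E → V) (p : V → Y) (ρ : V → ℤ) : Prop where
  pos : ∀ v, 0 ≤ ρ v
  ne : ∀ e, ρ (s e) ≠ ρ (t e)
  ss : ∀ e e', s e = s e' → ρ (t e) < ρ (s e) → ρ (t e') < ρ (s e') → e = e'
  tt : ∀ e e', t e = t e' → ρ (s e) < ρ (t e) → ρ (s e') < ρ (t e') → e = e'
  st : ∀ e e', s e = t e' → ρ (t e) < ρ (s e) → ρ (s e') < ρ (t e') → e = e'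
  surj : Function.Surjective p
  comm : ∀ e, p (s e) = p (t e)
  conn : ∀ (T : Type) (F : V → T), (∀ e, F (s e) = F (t e)) → ∀ v w, p v = p w → F v = F w

lemma tree_solve {s t : E → V} {p : V → Y} {ρ : V → ℤ} (h : TreeD s t p ρ) {N : Type}
    [AddCommGroup N] (f : E → N) : ∃ F : V → N, ∀ e, F (t e) - F (s e) = f e := by
  classical
  let hi : E → V := fun e => if ρ (s e) < ρ (t e) then t e else s e
  let lo : E → V := fun e => if ρ (s e) < ρ (t e) then s e else t e
  let sg : E → N := fun e => if ρ (s e) < ρ (t e) then f e else - f e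
  have hlt : ∀ e, ρ (lo e) < ρ (hi e) := by
    intro e
    have := h.ne e
    by_cases h1 : ρ (s e) < ρ (t e)
    · simp [hi, lo, h1]
    · simp only [hi, lo, if_neg h1]; omega
  have hinj : ∀ e e', hi e = hi e' → e = e' := by
    intro e e' he
    have n1 := h.ne e
    have n2 := h.ne e'
    by_cases h1 : ρ (s e) < ρ (t e) <;> by_cases h2 : ρ (s e') < ρ (t e') <;>
      simp only [hi, h1, h2, if_true, if_false] at he
    · exact h.tt _ _ he h1 h2
    · exact (h.st e' e he.symm (by omega) h1).symm
    · exact h.st e e' he (by omega) h2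
    · exact h.ss _ _ he (by omega) (by omega)
  let μ : V → ℕ := fun v => (ρ v).toNat
  have hμ : ∀ e, μ (lo e) < μ (hi e) := fun e => by
    have h1 := hlt e
    have h2 := h.pos (lo e)
    simp only [μ]; omega
  let F : V → N := (measure μ).wf.fix fun v rec =>
    if hv : ∃ e, hi e = v then rec (lo hv.choose) (by
      change μ _ < μ _
      conv_rhs => rw [← hv.choose_spec]
      exact hμ _) + sg hv.choose else 0
  have hF : ∀ e, F (hi e) = F (lo e) + sg e := by
    intro e
    have hv : ∃ e', hi e' = hi e := ⟨e, rfl⟩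
    have he : hv.choose = e := hinj _ _ hv.choose_spec
    have := (measure μ).wf.fix_eq (fun v rec =>
      if hv : ∃ e, hi e = v then rec (lo hv.choose) (by
        change μ _ < μ _
        conv_rhs => rw [← hv.choose_spec]
        exact hμ _) + sg hv.choose else (0 : N)) (hi e)
    refine this.trans ?_
    rw [dif_pos hv]
    change F (lo hv.choose) + sg hv.choose = _
    rw [he]
  refine ⟨F, fun e => ?_⟩
  have := hF e
  by_cases h1 : ρ (s e) < ρ (t e)
  · simp only [hi, lo, sg, if_pos h1] at this
    rw [this]; abel
  · simp only [hi, lo, sg, if_neg h1] at this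
    rw [this]; abel

lemma tree_ses {s t : E → V} {p : V → Y} {ρ : V → ℤ} (h : TreeD s t p ρ)
    (hs : ∀ (g : G) x, s (g • x) = g • s x) (ht : ∀ (g : G) x, t (g • x) = g • t x)
    (hp : ∀ (g : G) x, p (g • x) = g • p x) (M : Rep.{0} k G) :
    SES (pull p hp M) (dif s t hs ht M) where
  inj a b hab := by
    funext y
    obtain ⟨v, rfl⟩ := h.surj y
    exact congrFun hab v
  surj f := by
    obtain ⟨F, hF⟩ := tree_solve h f
    exact ⟨F, funext hF⟩
  zero a := by
    funext e
    change a (p (t e)) - a (p (s e)) = 0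
    rw [h.comm, sub_self]
  ex F hF := by
    have h1 : ∀ e, F (s e) = F (t e) := fun e => by
      have := congrFun hF e
      change F (t e) - F (s e) = 0 at this
      exact (sub_eq_zero.1 this).symm
    refine ⟨fun y => F (h.surj y).choose, funext fun v => ?_⟩
    exact h.conn _ F h1 _ _ (h.surj (p v)).choose_spec

/-- The class of an element modulo the cyclic group of `κ`. -/
def cl (κ : G) (g : G) : G ⧸ Subgroup.zpowers κ := QuotientGroup.mk g

lemma inv_zp {κ : G} {T : Type} (f : G → T) (hf : ∀ g, f (g * κ) = f g) (g h : G)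
    (hh : h ∈ Subgroup.zpowers κ) : f (g * h) = f g := by
  have h2 : ∀ g, f (g * κ⁻¹) = f g := fun g => by
    rw [← hf (g * κ⁻¹), inv_mul_cancel_right]
  rw [Subgroup.mem_zpowers_iff] at hh
  obtain ⟨n, rfl⟩ := hh
  induction n with
  | zero => simp
  | succ n ih => rw [zpow_add_one, ← mul_assoc, hf, ih]
  | pred n ih => rw [zpow_sub_one, ← mul_assoc, h2, ih]

/-- Descend a function to a quotient by a subgroup. -/
def lq (H : Subgroup G) {T : Type} (f : G → T) (hf : ∀ g, ∀ h ∈ H, f (g * h) = f g) : G ⧸ H → T :=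
  Quotient.lift f (fun a b hab => by
    have := QuotientGroup.leftRel_apply.1 hab
    rw [← hf a _ this]; congr 1; group)

lemma lq_mk (H : Subgroup G) {T : Type} (f : G → T) (hf) (g : G) :
    lq H f hf (QuotientGroup.mk g) = f g := rfl

lemma lq_smul (H : Subgroup G) {X : Type} [MulAction G X] (f : G → X) (hf)
    (he : ∀ a b, f (a * b) = a • f b) (g : G) (x : G ⧸ H) : lq H f hf (g • x) = g • lq H f hf x := by
  obtain ⟨y, rfl⟩ := QuotientGroup.mk_surjective x
  exact he g y

/-- Projection between coset spaces. -/
def pr (K H : Subgroup G) (h : K ≤ H) : G ⧸ K → G ⧸ H :=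
  lq K (fun g => QuotientGroup.mk g) (fun g x hx => by
    rw [QuotientGroup.eq]
    have := H.inv_mem (h hx)
    simpa [mul_assoc] using this)

lemma pr_mk (K H : Subgroup G) (h : K ≤ H) (g : G) :
    pr K H h (QuotientGroup.mk g) = QuotientGroup.mk g := rfl

lemma pr_smul (K H : Subgroup G) (h : K ≤ H) (g : G) (x : G ⧸ K) :
    pr K H h (g • x) = g • pr K H h x := lq_smul K _ _ (fun a b => rfl) g x

/-- A coordinate along the cosets of an embedded subgroup. -/
lemma coord {H : Type} [Group H] (φ : H →* G) (hφ : Function.Injective φ) :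
    ∃ α : G → H, ∀ g h, α (g * φ h) = α g * h := by
  have h1 : ∀ g : G, ∃ h : H, φ h = (Quotient.out (QuotientGroup.mk g : G ⧸ φ.range))⁻¹ * g := by
    intro g
    have : (QuotientGroup.mk (Quotient.out (QuotientGroup.mk g : G ⧸ φ.range)) : G ⧸ φ.range) =
      QuotientGroup.mk g := Quotient.out_eq _
    rw [QuotientGroup.eq] at this
    exact this
  choose α hα using h1
  refine ⟨α, fun g h => hφ ?_⟩
  rw [map_mul, hα, hα]
  have : (QuotientGroup.mk (g * φ h) : G ⧸ φ.range) = QuotientGroup.mk g := by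
    rw [QuotientGroup.eq]
    exact ⟨h⁻¹, by simp⟩
  rw [this, mul_assoc]

end Tree
end SLC

namespace SLC
open CategoryTheory

lemma cast_inj (a b : ℤ) (h : (a : ZH) = b) : a = b := by
  have h1 := congrArg psi h
  rw [map_intCast, map_intCast] at h1
  exact_mod_cast h1

lemma phA_inj : Function.Injective phA := by
  intro g h hgh
  apply sl_ext <;> apply cast_inj <;> rw [← phA_apply, ← phA_apply, hgh]

lemma phB_inj : Function.Injective phB := by
  intro g h hgh
  apply sl_ext <;> apply cast_inj
  · rw [← pB11, ← pB11, hgh]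
  · have h1 : phB g 1 0 = phB h 1 0 := by rw [hgh]
    rw [pB10, pB10] at h1
    linear_combination (- hf) * h1 - (((g 0 1 : ℤ) : ZH) - (h 0 1 : ℤ)) * two_hf
  · have h1 : phB g 0 1 = phB h 0 1 := by rw [hgh]
    rw [pB01, pB01] at h1
    linear_combination (- 2) * h1 - (((g 1 0 : ℤ) : ZH) - (h 1 0 : ℤ)) * two_hf
  · rw [← pB00, ← pB00, hgh]

/-- The hexagonal form. -/
def qq (x y : ℤ) : ℤ := x ^ 2 - x * y + y ^ 2
/-- Value on the first column. -/
def qa (m : SZ) : ℤ := qq (m 0 0) (m 1 0)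
/-- Value on the second column. -/
def qb (m : SZ) : ℤ := qq (m 0 1) (m 1 1)
/-- Value on the difference of the columns. -/
def qc (m : SZ) : ℤ := qq (m 0 1 - m 0 0) (m 1 1 - m 1 0)

lemma qq_nonneg (x y : ℤ) : 0 ≤ qq x y := by
  unfold qq; nlinarith [sq_nonneg (x - y), sq_nonneg x, sq_nonneg y]
lemma qa_nn (m : SZ) : 0 ≤ qa m := qq_nonneg _ _
lemma qb_nn (m : SZ) : 0 ≤ qb m := qq_nonneg _ _
lemma qc_nn (m : SZ) : 0 ≤ qc m := qq_nonneg _ _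
lemma qodd (m : SZ) : ∃ t : ℤ, qa m + qb m - qc m = 2 * t + 1 := by
  have h := sl_det m
  refine ⟨m 0 0 * m 0 1 + m 1 0 * m 1 1 - m 0 0 * m 1 1, ?_⟩
  unfold qa qb qc qq
  linear_combination h

lemma qaS (m : SZ) : qa (m * sS) = qb m := by
  simp only [qa, qb, m00, m10, m01, m11, sS00, sS01, sS10, sS11, qq]; ring
lemma qbS (m : SZ) : qb (m * sS) = qa m := by
  simp only [qa, qb, m00, m10, m01, m11, sS00, sS01, sS10, sS11, qq]; ring
lemma qcS (m : SZ) : qc (m * sS) = 2 * (qa m + qb m) - qc m := by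
  simp only [qa, qb, qc, m00, m10, m01, m11, sS00, sS01, sS10, sS11, qq]; ring
lemma qaU (m : SZ) : qa (m * sU) = qb m := by
  simp only [qa, qb, qc, m00, m10, m01, m11, sU00, sU01, sU10, sU11, qq]; ring
lemma qbU (m : SZ) : qb (m * sU) = qc m := by
  simp only [qa, qb, qc, m00, m10, m01, m11, sU00, sU01, sU10, sU11, qq]; ring
lemma qcU (m : SZ) : qc (m * sU) = qa m := by
  simp only [qa, qb, qc, m00, m10, m01, m11, sU00, sU01, sU10, sU11, qq]; ring
lemma qaP (m : SZ) : qa (m * sP) = 2 * (qb m + qc m) - qa m := by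
  simp only [qa, qb, qc, m00, m10, m01, m11, sP00, sP01, sP10, sP11, qq]; ring
lemma qbP (m : SZ) : qb (m * sP) = qc m := by
  simp only [qa, qb, qc, m00, m10, m01, m11, sP00, sP01, sP10, sP11, qq]; ring
lemma qcP (m : SZ) : qc (m * sP) = qb m := by
  simp only [qa, qb, qc, m00, m10, m01, m11, sP00, sP01, sP10, sP11, qq]; ring
lemma qaT (m : SZ) : qa (m * sT) = qa m := by
  simp only [qa, qb, qc, m00, m10, m01, m11, sT00, sT01, sT10, sT11, qq]; ring
lemma qbT (m : SZ) : qb (m * sT) = 2 * (qa m + qb m) - qc m := by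
  simp only [qa, qb, qc, m00, m10, m01, m11, sT00, sT01, sT10, sT11, qq]; ring
lemma qcT (m : SZ) : qc (m * sT) = qb m := by
  simp only [qa, qb, qc, m00, m10, m01, m11, sT00, sT01, sT10, sT11, qq]; ring
lemma qaN (m : SZ) : qa (m * -1) = qa m := by
  simp only [qa, qb, qc, m00, m10, m01, m11, n00, n01, n10, n11, o00, o01, o10, o11, qq]; ring
lemma qbN (m : SZ) : qb (m * -1) = qb m := by
  simp only [qa, qb, qc, m00, m10, m01, m11, n00, n01, n10, n11, o00, o01, o10, o11, qq]; ring
lemma qcN (m : SZ) : qc (m * -1) = qc m := by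
  simp only [qa, qb, qc, m00, m10, m01, m11, n00, n01, n10, n11, o00, o01, o10, o11, qq]; ring

lemma cl_neg (g : GG) : cl (-1 : GG) (g * -1) = cl (-1 : GG) g := by
  unfold cl
  rw [QuotientGroup.eq]
  refine ⟨1, ?_⟩
  simp

/-- Cosets of the centre. -/
abbrev Zc : Subgroup GG := Subgroup.zpowers (-1 : GG)

lemma zp_le {κ : GG} {r : ℕ} (h : κ ^ r = -1) : Zc ≤ Subgroup.zpowers κ := by
  rw [Subgroup.zpowers_le]
  exact ⟨r, by simpa using h⟩

lemma zp_range {φ : SZ →* GG} (x : SZ) : Subgroup.zpowers (φ x) ≤ φ.range := by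
  rw [Subgroup.zpowers_le]
  exact ⟨x, rfl⟩

lemma sT_SU : sT = sS⁻¹ * sU := by
  rw [eq_inv_mul_iff_mul_eq]
  decide
lemma sT_eq : ModularGroup.T = sT := by decide
lemma sS_eq : ModularGroup.S = sS := by decide

lemma SZ_ind (D : Subgroup SZ) (hS : sS ∈ D) (hT : sT ∈ D) (x : SZ) : x ∈ D := by
  have h : Subgroup.closure {ModularGroup.S, ModularGroup.T} ≤ D := by
    rw [Subgroup.closure_le]
    rintro y (rfl | rfl)
    · rw [sS_eq]; exact hS
    · change ModularGroup.T ∈ D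
      rw [sT_eq]; exact hT
  rw [SpecialLinearGroup.SL2Z_generators] at h
  exact h trivial

/-- The stabilizing subgroup of a function along an embedding. -/
def stab {T : Type} (φ : SZ →* GG) (f : GG → T) : Subgroup SZ where
  carrier := {h | ∀ g, f (g * φ h) = f g}
  one_mem' := by simp
  mul_mem' := by
    intro a b ha hb g
    rw [map_mul, ← mul_assoc, hb, ha]
  inv_mem' := by
    intro a ha g
    have := ha (g * φ a⁻¹)
    rw [mul_assoc, ← map_mul, inv_mul_cancel, map_one, mul_one] at this
    exact this.symm

section ATree
variable (φ : SZ →* GG)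

/-- The vertices of the tree of `SL₂(ℤ)`. -/
abbrev VA : Type := (GG ⧸ Subgroup.zpowers (φ sS)) ⊕ (GG ⧸ Subgroup.zpowers (φ sU))

variable (hS : φ sS ^ 2 = -1) (hU : φ sU ^ 3 = -1)

/-- The first end map. -/
def sA : GG ⧸ Zc → VA φ := fun e => Sum.inl (pr _ _ (zp_le hS) e)
/-- The second end map. -/
def tA : GG ⧸ Zc → VA φ := fun e => Sum.inr (pr _ _ (zp_le hU) e)
/-- The projection of the vertices. -/
def pA : VA φ → GG ⧸ φ.range := Sum.elim (pr _ _ (zp_range _)) (pr _ _ (zp_range _))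

lemma sA_smul (g : GG) (x) : sA φ hS (g • x) = g • sA φ hS x :=
  congrArg Sum.inl (pr_smul _ _ _ g x)
lemma tA_smul (g : GG) (x) : tA φ hU (g • x) = g • tA φ hU x :=
  congrArg Sum.inr (pr_smul _ _ _ g x)
lemma pA_smul (g : GG) (x : VA φ) : pA φ (g • x) = g • pA φ x := by
  rcases x with x | x
  · exact pr_smul _ _ (zp_range _) g x
  · exact pr_smul _ _ (zp_range _) g x

lemma mk_neg {g g' : GG} (h : g' = g * -1) :
    (QuotientGroup.mk g : GG ⧸ Zc) = QuotientGroup.mk g' := by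
  subst h
  exact (cl_neg g).symm

lemma treeA (hφ : Function.Injective φ) (hn : φ (-1) = -1) (RS : Rot Om (φ sS) 2)
    (RU : Rot Om (φ sU) 3) : ∃ ρ, TreeD (sA φ hS) (tA φ hU) (pA φ) ρ := by
  obtain ⟨α, hα⟩ := coord φ hφ
  have hαn : ∀ g, α (g * -1) = α g * -1 := fun g => by rw [← hn, hα]
  let ρ1 : GG ⧸ Subgroup.zpowers (φ sS) → ℤ := lq _ (fun g => 2 * (qa (α g) + qb (α g)))
    (inv_zp (κ := φ sS) (fun g => 2 * (qa (α g) + qb (α g))) fun g => by simp only [hα, qaS, qbS]; ring)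
  let ρ2 : GG ⧸ Subgroup.zpowers (φ sU) → ℤ := lq _ (fun g => qa (α g) + qb (α g) + qc (α g))
    (inv_zp (κ := φ sU) (fun g => qa (α g) + qb (α g) + qc (α g)) fun g => by
      simp only [hα, qaU, qbU, qcU]; ring)
  have h1 : ∀ g, Sum.elim ρ1 ρ2 (sA φ hS (QuotientGroup.mk g)) = 2 * (qa (α g) + qb (α g)) :=
    fun _ => rfl
  have h2 : ∀ g, Sum.elim ρ1 ρ2 (tA φ hU (QuotientGroup.mk g)) = qa (α g) + qb (α g) + qc (α g) :=
    fun _ => rfl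
  refine ⟨Sum.elim ρ1 ρ2, ?_, ?_, ?_, ?_, ?_, ?_, ?_, ?_⟩
  · rintro (v | v)
    · obtain ⟨g, rfl⟩ := QuotientGroup.mk_surjective v
      have := qa_nn (α g); have := qb_nn (α g)
      change 0 ≤ 2 * (qa (α g) + qb (α g)); omega
    · obtain ⟨g, rfl⟩ := QuotientGroup.mk_surjective v
      have := qa_nn (α g); have := qb_nn (α g); have := qc_nn (α g)
      change 0 ≤ qa (α g) + qb (α g) + qc (α g); omega
  · intro e
    obtain ⟨g, rfl⟩ := QuotientGroup.mk_surjective e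
    rw [h1, h2]
    obtain ⟨t, ht⟩ := qodd (α g)
    omega
  · intro e e' h l1 l2
    obtain ⟨g, rfl⟩ := QuotientGroup.mk_surjective e
    obtain ⟨g', rfl⟩ := QuotientGroup.mk_surjective e'
    rw [h1, h2] at l1 l2
    obtain ⟨i, hi, hg⟩ := RS.exists_pow (Sum.inl_injective h)
    have p3 : φ sS ^ 3 = -1 * φ sS := by rw [pow_succ, hS]
    interval_cases i
    · rw [pow_zero, mul_one] at hg; rw [hg]
    · rw [hg, pow_one, hα, qaS, qbS, qcS] at l2; omega
    · rw [hS] at hg; exact mk_neg hg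
    · rw [hg, p3, ← mul_assoc, hα, qaS, qbS, qcS, hαn, qaN, qbN, qcN] at l2; omega
  · intro e e' h l1 l2
    obtain ⟨g, rfl⟩ := QuotientGroup.mk_surjective e
    obtain ⟨g', rfl⟩ := QuotientGroup.mk_surjective e'
    rw [h1, h2] at l1 l2
    obtain ⟨i, hi, hg⟩ := RU.exists_pow (Sum.inr_injective h)
    have p4 : φ sU ^ 4 = -1 * φ sU := by rw [pow_succ, hU]
    have p5 : φ sU ^ 5 = -1 * φ sU * φ sU := by rw [pow_succ, pow_succ, hU]
    have := qa_nn (α g); have := qb_nn (α g); have := qc_nn (α g)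
    interval_cases i
    · rw [pow_zero, mul_one] at hg; rw [hg]
    · rw [hg, pow_one, hα, qaU, qbU, qcU] at l2; omega
    · rw [hg, pow_two, ← mul_assoc, hα, hα, qaU, qbU, qcU, qaU, qbU, qcU] at l2; omega
    · rw [hU] at hg; exact mk_neg hg
    · rw [hg, p4, ← mul_assoc, hα, qaU, qbU, qcU, hαn, qaN, qbN, qcN] at l2; omega
    · rw [hg, p5, ← mul_assoc, ← mul_assoc, hα, hα, qaU, qbU, qcU, qaU, qbU, qcU, hαn, qaN, qbN, qcN] at l2; omega
  · intro e e' h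
    exact absurd h (by simp [sA, tA])
  · intro y
    obtain ⟨g, rfl⟩ := QuotientGroup.mk_surjective y
    exact ⟨Sum.inl (QuotientGroup.mk g), rfl⟩
  · intro e
    obtain ⟨g, rfl⟩ := QuotientGroup.mk_surjective e
    have a1 : pA φ (sA φ hS (QuotientGroup.mk g)) = (QuotientGroup.mk g : GG ⧸ φ.range) := rfl
    have a2 : pA φ (tA φ hU (QuotientGroup.mk g)) = (QuotientGroup.mk g : GG ⧸ φ.range) := rfl
    rw [a1, a2]
  · intro T F hF
    let f : GG → T := fun g => F (Sum.inl (QuotientGroup.mk g))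
    have hf' : ∀ g, F (Sum.inr (QuotientGroup.mk g)) = f g := fun g => (hF (QuotientGroup.mk g)).symm
    have e1 : sS ∈ stab φ f := fun g => by
      change F _ = F _
      congr 2
      rw [QuotientGroup.eq]
      exact ⟨-1, by simp⟩
    have e2 : sU ∈ stab φ f := fun g => by
      rw [← hf', ← hf']
      congr 2
      rw [QuotientGroup.eq]
      exact ⟨-1, by simp⟩
    have e3 : sT ∈ stab φ f := by
      rw [sT_SU]
      exact mul_mem (inv_mem e1) e2
    have hall := SZ_ind _ e1 e3
    have key : ∀ g g' : GG, (QuotientGroup.mk g : GG ⧸ φ.range) = QuotientGroup.mk g' → f g = f g' := by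
      intro g g' h
      rw [QuotientGroup.eq] at h
      obtain ⟨x, hx⟩ := h
      have := hall x g
      rw [hx, mul_inv_cancel_left] at this
      exact this.symm
    rintro (v | v) (w | w) h <;>
    · obtain ⟨g, rfl⟩ := QuotientGroup.mk_surjective v
      obtain ⟨g', rfl⟩ := QuotientGroup.mk_surjective w
      try simp only [hf']
      exact key g g' h

end ATree
end SLC

namespace SLC
open CategoryTheory

lemma sl_inv10 (g : SZ) : g⁻¹ 1 0 = - g 1 0 := by
  rw [Matrix.SpecialLinearGroup.coe_inv, Matrix.adjugate_fin_two]; rfl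

/-- The group `Γ₀(2)`. -/
def G02 : Subgroup SZ where
  carrier := {g | (2 : ℤ) ∣ g 1 0}
  one_mem' := by
    change (2 : ℤ) ∣ (1 : SZ) 1 0
    rw [o10]; exact dvd_zero _
  mul_mem' := by
    intro a b ha hb
    change (2 : ℤ) ∣ (a * b) 1 0
    rw [m10]
    exact dvd_add (Dvd.dvd.mul_right ha _) (Dvd.dvd.mul_left hb _)
  inv_mem' := by
    intro a ha
    change (2 : ℤ) ∣ a⁻¹ 1 0
    rw [sl_inv10]
    exact (dvd_neg).2 ha

lemma mem_G02 (g : SZ) : g ∈ G02 ↔ (2 : ℤ) ∣ g 1 0 := Iff.rfl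

lemma w1 : sS * sS = sP * sP := by decide
lemma w2 : sS * sT * sT = sP * sP * sP * sT⁻¹ * sS := by
  have : sS * sT * sT * (sS⁻¹ * sT) = sP * sP * sP := by
    have e : sS⁻¹ = sS * (sS * sS) := by
      rw [inv_eq_iff_mul_eq_one]; decide
    rw [e]; decide
  rw [← this]; group
lemma w3 : sS * sT * sS = sT⁻¹ * sS * sT⁻¹ := by
  have : sT * (sS * sT * sS) * sT = sS := by decide
  conv_rhs => rw [← this]
  group

lemma sP_mem : sP ∈ G02 := by rw [mem_G02, sP10]
lemma sT_mem : sT ∈ G02 := by rw [mem_G02, sT10]; exact dvd_zero _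

lemma G02_le (D : Subgroup SZ) (hP : sP ∈ D) (hT : sT ∈ D) : G02 ≤ D := by
  let D' : Subgroup SZ := D ⊓ G02
  have hP' : sP ∈ D' := ⟨hP, sP_mem⟩
  have hT' : sT ∈ D' := ⟨hT, sT_mem⟩
  let d : SZ := sP * sP * sP * sT⁻¹
  have hd : d ∈ D' := mul_mem (mul_mem (mul_mem hP' hP') hP') (inv_mem hT')
  have w2' : sS * sT * sT = d * sS := w2
  have w4 : sS * sT⁻¹ = d⁻¹ * (sS * sT) := by
    rw [eq_inv_mul_iff_mul_eq, ← mul_assoc, ← w2']; group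
  let X : Set SZ := {h | ∃ e ∈ D', h = e ∨ h = e * sS ∨ h = e * (sS * sT)}
  have hc : ∀ x ∈ Subgroup.closure {sS, sT}, x ∈ X := by
    intro x hx
    induction hx using Subgroup.closure_induction_right with
    | one => exact ⟨1, one_mem _, Or.inl rfl⟩
    | mul_right x y hx hy ih =>
      obtain ⟨e, he, h⟩ := ih
      rcases hy with rfl | rfl
      · rcases h with rfl | rfl | rfl
        · exact ⟨x, he, Or.inr (Or.inl rfl)⟩
        · exact ⟨e * (sP * sP), mul_mem he (mul_mem hP' hP'), Or.inl (by rw [mul_assoc, w1])⟩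
        · refine ⟨e * sT⁻¹ * d⁻¹, mul_mem (mul_mem he (inv_mem hT')) (inv_mem hd), Or.inr (Or.inr ?_)⟩
          rw [mul_assoc, w3, mul_assoc (sT⁻¹), w4]; group
      · rcases h with rfl | rfl | rfl
        · exact ⟨x * sT, mul_mem he hT', Or.inl rfl⟩
        · exact ⟨e, he, Or.inr (Or.inr (by rw [mul_assoc]))⟩
        · exact ⟨e * d, mul_mem he hd, Or.inr (Or.inl (by rw [mul_assoc, w2', ← mul_assoc]))⟩
    | mul_inv_cancel x y hx hy ih =>
      obtain ⟨e, he, h⟩ := ih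
      have hs : sS⁻¹ = (sP * sP)⁻¹ * sS := by rw [← w1]; group
      have hs2 : sS * sS⁻¹ = 1 := mul_inv_cancel _
      rcases hy with rfl | rfl
      · rcases h with rfl | rfl | rfl
        · exact ⟨x * (sP * sP)⁻¹, mul_mem he (inv_mem (mul_mem hP' hP')), Or.inr (Or.inl (by rw [hs, mul_assoc]))⟩
        · exact ⟨e, he, Or.inl (by group)⟩
        · refine ⟨e * (sP * sP)⁻¹ * sT⁻¹ * d⁻¹, mul_mem (mul_mem (mul_mem he (inv_mem (mul_mem hP' hP'))) (inv_mem hT')) (inv_mem hd), Or.inr (Or.inr ?_)⟩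
          have hz : sS * sT * (sP * sP)⁻¹ = (sP * sP)⁻¹ * (sS * sT) := by
            rw [mul_inv_eq_iff_eq_mul, mul_assoc, eq_inv_mul_iff_mul_eq]; decide
          rw [mul_assoc e, hs, ← mul_assoc (sS * sT), hz, mul_assoc _ (sS * sT), w3, mul_assoc (sT⁻¹), w4]
          group
      · rcases h with rfl | rfl | rfl
        · exact ⟨x * sT⁻¹, mul_mem he (inv_mem hT'), Or.inl rfl⟩
        · exact ⟨e * d⁻¹, mul_mem he (inv_mem hd), Or.inr (Or.inr (by rw [mul_assoc, w4, mul_assoc]))⟩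
        · exact ⟨e, he, Or.inr (Or.inl (by group))⟩
  intro x hx
  obtain ⟨e, he, h⟩ := hc x (SZ_ind _ (Subgroup.subset_closure (by simp)) (Subgroup.subset_closure (by simp)) x)
  have hy : e⁻¹ * x ∈ G02 := mul_mem (inv_mem he.2) hx
  rcases h with rfl | rfl | rfl
  · exact he.1
  · rw [inv_mul_cancel_left, mem_G02, sS10] at hy
    norm_num at hy
  · rw [inv_mul_cancel_left, mem_G02, m10, sS10, sS11, sT00] at hy
    norm_num at hy

/-- The common edge subgroup. -/
noncomputable abbrev Cg : Subgroup GG := G02.map phA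


lemma zp_C {x : SZ} (h : x ∈ G02) : Subgroup.zpowers (phA x) ≤ Cg := by
  rw [Subgroup.zpowers_le]
  exact ⟨x, h, rfl⟩

lemma neg_C : Zc ≤ Cg := by
  rw [Subgroup.zpowers_le]
  exact ⟨-1, by
    change (2 : ℤ) ∣ (-1 : SZ) 1 0
    rw [n10, o10]; simp, phA_neg⟩

section CTree

lemma hP2 : phA sP ^ 2 = -1 := by rw [← map_pow, sP2, phA_neg]

/-- The vertices. -/
abbrev VC : Type := (GG ⧸ Subgroup.zpowers (phA sP)) ⊕ (GG ⧸ Zc)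
/-- The edges. -/
abbrev EC : Type := (GG ⧸ Zc) ⊕ (GG ⧸ Zc)

/-- Right translation by `T`. -/
noncomputable def rT : GG ⧸ Zc → GG ⧸ Zc :=
  lq Zc (fun g => (QuotientGroup.mk (g * phA sT) : GG ⧸ Zc))
    (inv_zp (κ := (-1 : GG)) (fun g => (QuotientGroup.mk (g * phA sT) : GG ⧸ Zc)) fun g => by
      exact (mk_neg (by simp)).symm)

lemma rT_mk (g : GG) : rT (QuotientGroup.mk g) = QuotientGroup.mk (g * phA sT) := rfl

lemma rT_smul (g : GG) (x) : rT (g • x) = g • rT x :=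
  lq_smul Zc _ _ (fun a b => by
    change QuotientGroup.mk (a * b * phA sT) = QuotientGroup.mk (a * (b * phA sT))
    rw [mul_assoc]) g x

/-- The projection to the vertices of order four. -/
noncomputable def prP : GG ⧸ Zc → GG ⧸ Subgroup.zpowers (phA sP) := pr _ _ (zp_le hP2)

/-- The first end map. -/
noncomputable def sC : EC → VC := Sum.elim (fun e => Sum.inl (prP e)) (fun e => Sum.inr e)
/-- The second end map. -/
noncomputable def tC : EC → VC := Sum.elim (fun e => Sum.inr e) (fun e => Sum.inr (rT e))
/-- The projection of the vertices. -/
noncomputable def pC : VC → GG ⧸ Cg := Sum.elim (pr _ _ (zp_C sP_mem)) (pr _ _ neg_C)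

lemma sC_smul (g : GG) (x) : sC (g • x) = g • sC x := by
  rcases x with x | x
  · exact congrArg Sum.inl (pr_smul _ _ _ g x)
  · rfl
lemma tC_smul (g : GG) (x) : tC (g • x) = g • tC x := by
  rcases x with x | x
  · rfl
  · exact congrArg Sum.inr (rT_smul g x)
lemma pC_smul (g : GG) (x : VC) : pC (g • x) = g • pC x := by
  rcases x with x | x
  · exact pr_smul _ _ (zp_C sP_mem) g x
  · exact pr_smul _ _ neg_C g x

lemma mk_C {g : GG} {x : SZ} (hx : x ∈ G02) :
    (QuotientGroup.mk (g * phA x) : GG ⧸ Cg) = QuotientGroup.mk g := by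
  rw [QuotientGroup.eq]
  exact ⟨x⁻¹, inv_mem hx, by simp⟩

lemma treeC : ∃ ρ, TreeD sC tC pC ρ := by
  obtain ⟨α, hα⟩ := coord phA phA_inj
  have hαn : ∀ g, α (g * -1) = α g * -1 := fun g => by rw [← phA_neg, hα]
  let ρ1 : GG ⧸ Subgroup.zpowers (phA sP) → ℤ := lq _ (fun g => 2 * (qb (α g) + qc (α g)))
    (inv_zp (κ := phA sP) (fun g => 2 * (qb (α g) + qc (α g))) fun g => by
      simp only [hα, qbP, qcP]; ring)
  let ρ2 : GG ⧸ Zc → ℤ := lq _ (fun g => qa (α g) + qb (α g) + qc (α g))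
    (inv_zp (κ := (-1 : GG)) (fun g => qa (α g) + qb (α g) + qc (α g)) fun g => by
      simp only [hαn, qaN, qbN, qcN])
  have v1 : ∀ g, Sum.elim ρ1 ρ2 (sC (Sum.inl (QuotientGroup.mk g))) = 2 * (qb (α g) + qc (α g)) :=
    fun _ => rfl
  have v2 : ∀ g, Sum.elim ρ1 ρ2 (tC (Sum.inl (QuotientGroup.mk g))) = qa (α g) + qb (α g) + qc (α g) :=
    fun _ => rfl
  have v3 : ∀ g, Sum.elim ρ1 ρ2 (sC (Sum.inr (QuotientGroup.mk g))) = qa (α g) + qb (α g) + qc (α g) :=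
    fun _ => rfl
  have v4 : ∀ g, Sum.elim ρ1 ρ2 (tC (Sum.inr (QuotientGroup.mk g))) =
      3 * (qa (α g) + qb (α g)) - qc (α g) := by
    intro g
    have : Sum.elim ρ1 ρ2 (tC (Sum.inr (QuotientGroup.mk g))) =
      qa (α (g * phA sT)) + qb (α (g * phA sT)) + qc (α (g * phA sT)) := rfl
    rw [this, hα, qaT, qbT, qcT]; ring
  have ac : ∀ {g g' : GG}, (QuotientGroup.mk g : GG ⧸ Zc) = QuotientGroup.mk g' →
      qa (α g) = qa (α g') ∧ qb (α g) = qb (α g') ∧ qc (α g) = qc (α g') := by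
    intro g g' h
    obtain ⟨i, hi, hg⟩ := rot1.exists_pow h
    interval_cases i
    · rw [pow_zero, mul_one] at hg; rw [hg]; simp
    · rw [pow_one] at hg; rw [hg, hαn, qaN, qbN, qcN]; simp
  have tinj : ∀ {g g' : GG}, (QuotientGroup.mk (g * phA sT) : GG ⧸ Zc) = QuotientGroup.mk (g' * phA sT) →
      (QuotientGroup.mk g : GG ⧸ Zc) = QuotientGroup.mk g' := by
    intro g g' h
    obtain ⟨i, hi, hg⟩ := rot1.exists_pow h
    interval_cases i
    · rw [pow_zero, mul_one] at hg; rw [mul_right_cancel hg]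
    · apply mk_neg
      apply mul_right_cancel (b := phA sT)
      rw [hg]; simp
  refine ⟨Sum.elim ρ1 ρ2, ?_, ?_, ?_, ?_, ?_, ?_, ?_, ?_⟩
  · rintro (v | v)
    · obtain ⟨g, rfl⟩ := QuotientGroup.mk_surjective v
      have := qc_nn (α g); have := qb_nn (α g)
      change 0 ≤ 2 * (qb (α g) + qc (α g)); omega
    · obtain ⟨g, rfl⟩ := QuotientGroup.mk_surjective v
      have := qa_nn (α g); have := qb_nn (α g); have := qc_nn (α g)
      change 0 ≤ qa (α g) + qb (α g) + qc (α g); omega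
  · rintro (e | e) <;> obtain ⟨g, rfl⟩ := QuotientGroup.mk_surjective e
    · rw [v1, v2]
      obtain ⟨t, ht⟩ := qodd (α g)
      omega
    · rw [v3, v4]
      obtain ⟨t, ht⟩ := qodd (α g)
      omega
  · rintro (e | e) (e' | e') h l1 l2 <;> obtain ⟨g, rfl⟩ := QuotientGroup.mk_surjective e <;>
      obtain ⟨g', rfl⟩ := QuotientGroup.mk_surjective e'
    · rw [v1, v2] at l1 l2
      obtain ⟨i, hi, hg⟩ := rotP.exists_pow (Sum.inl_injective h)
      have p3 : phA sP ^ 3 = -1 * phA sP := by rw [pow_succ, hP2]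
      interval_cases i
      · rw [pow_zero, mul_one] at hg; rw [hg]
      · rw [hg, pow_one, hα, qaP, qbP, qcP] at l2; omega
      · rw [hP2] at hg; exact congrArg Sum.inl (mk_neg hg)
      · rw [hg, p3, ← mul_assoc, hα, qaP, qbP, qcP, hαn, qaN, qbN, qcN] at l2; omega
    · exact absurd h (by simp [sC])
    · exact absurd h (by simp [sC])
    · exact congrArg Sum.inr (Sum.inr_injective h)
  · rintro (e | e) (e' | e') h l1 l2 <;> obtain ⟨g, rfl⟩ := QuotientGroup.mk_surjective e <;>
      obtain ⟨g', rfl⟩ := QuotientGroup.mk_surjective e'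
    · exact congrArg Sum.inl (Sum.inr_injective h)
    · rw [v1, v2] at l1
      rw [v3, v4] at l2
      have h2 := ac (Sum.inr_injective h)
      rw [hα, qaT, qbT, qcT] at h2
      have := qa_nn (α g'); have := qb_nn (α g'); have := qc_nn (α g')
      omega
    · rw [v1, v2] at l2
      rw [v3, v4] at l1
      have h2 := ac (Sum.inr_injective h)
      rw [hα, qaT, qbT, qcT] at h2
      have := qa_nn (α g); have := qb_nn (α g); have := qc_nn (α g)
      omega
    · exact congrArg Sum.inr (tinj (Sum.inr_injective h))
  · rintro (e | e) (e' | e') h l1 l2 <;> obtain ⟨g, rfl⟩ := QuotientGroup.mk_surjective e <;>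
      obtain ⟨g', rfl⟩ := QuotientGroup.mk_surjective e'
    · exact absurd h (by simp [sC, tC])
    · exact absurd h (by simp [sC, tC])
    · rw [v1, v2] at l2
      rw [v3, v4] at l1
      have h2 := ac (Sum.inr_injective h)
      have := qa_nn (α g); have := qb_nn (α g); have := qc_nn (α g)
      omega
    · rw [v3, v4] at l1 l2
      have h2 := ac (Sum.inr_injective h)
      rw [hα, qaT, qbT, qcT] at h2
      have := qa_nn (α g'); have := qb_nn (α g'); have := qc_nn (α g')
      omega
  · intro y
    obtain ⟨g, rfl⟩ := QuotientGroup.mk_surjective y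
    exact ⟨Sum.inl (QuotientGroup.mk g), rfl⟩
  · rintro (e | e) <;> obtain ⟨g, rfl⟩ := QuotientGroup.mk_surjective e
    · have a1 : pC (sC (Sum.inl (QuotientGroup.mk g))) = (QuotientGroup.mk g : GG ⧸ Cg) := rfl
      have a2 : pC (tC (Sum.inl (QuotientGroup.mk g))) = (QuotientGroup.mk g : GG ⧸ Cg) := rfl
      rw [a1, a2]
    · have a1 : pC (sC (Sum.inr (QuotientGroup.mk g))) = (QuotientGroup.mk g : GG ⧸ Cg) := rfl
      have a2 : pC (tC (Sum.inr (QuotientGroup.mk g))) = (QuotientGroup.mk (g * phA sT) : GG ⧸ Cg) := rfl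
      rw [a1, a2, mk_C sT_mem]
  · intro T F hF
    let f : GG → T := fun g => F (Sum.inr (QuotientGroup.mk g))
    have hf' : ∀ g, F (Sum.inl (QuotientGroup.mk g)) = f g := fun g =>
      hF (Sum.inl (QuotientGroup.mk g))
    have e1 : sP ∈ stab phA f := fun g => by
      rw [← hf', ← hf']
      congr 2
      rw [QuotientGroup.eq]
      exact ⟨-1, by simp⟩
    have e2 : sT ∈ stab phA f := fun g => (hF (Sum.inr (QuotientGroup.mk g))).symm
    have hall := G02_le _ e1 e2
    have key : ∀ g g' : GG, (QuotientGroup.mk g : GG ⧸ Cg) = QuotientGroup.mk g' → f g = f g' := by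
      intro g g' h
      rw [QuotientGroup.eq] at h
      obtain ⟨x, hx, hx2⟩ := h
      have := hall hx g
      rw [hx2, mul_inv_cancel_left] at this
      exact this.symm
    rintro (v | v) (w | w) h <;>
    · obtain ⟨g, rfl⟩ := QuotientGroup.mk_surjective v
      obtain ⟨g', rfl⟩ := QuotientGroup.mk_surjective w
      try simp only [hf']
      exact key g g' h

end CTree
end SLC

namespace SLC
open CategoryTheory

lemma two_cancel {x y : ZH} (h : 2 * x = 2 * y) : x = y := by
  have := congrArg (fun z => hf * z) h
  simp only [← mul_assoc, mul_comm hf 2, two_hf, one_mul] at this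
  exact this

lemma zh_int (x : ZH) : ∃ (n : ℕ) (a : ℤ), 2 ^ n * x = a := by
  obtain ⟨n, a, h⟩ := IsLocalization.Away.surj (2 : ℤ) x
  exact ⟨n, a, by rw [mul_comm]; simpa using h⟩

/-- Integrality of level `n` for the first lattice. -/
def IA (n : ℕ) (g : GG) : Prop := ∃ a b c d : ℤ, 2 ^ n * g 0 0 = a ∧ 2 ^ n * g 0 1 = b ∧
  2 ^ n * g 1 0 = c ∧ 2 ^ n * g 1 1 = d

/-- Integrality of level `n` for the second lattice. -/
def IB (n : ℕ) (g : GG) : Prop := ∃ a b c d : ℤ, 2 ^ n * g 0 0 = a ∧ 2 ^ n * 2 * g 0 1 = b ∧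
  2 ^ n * g 1 0 = c ∧ 2 ^ n * 2 * g 1 1 = d

lemma IA_IB {n : ℕ} {g : GG} (h : IA n g) : IB n g := by
  obtain ⟨a, b, c, d, h1, h2, h3, h4⟩ := h
  refine ⟨a, 2 * b, c, 2 * d, h1, ?_, h3, ?_⟩
  · push_cast; linear_combination 2 * h2
  · push_cast; linear_combination 2 * h4

lemma IB_IA {n : ℕ} {g : GG} (h : IB n g) : IA (n + 1) g := by
  obtain ⟨a, b, c, d, h1, h2, h3, h4⟩ := h
  refine ⟨2 * a, b, 2 * c, d, ?_, ?_, ?_, ?_⟩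
  · push_cast; linear_combination 2 * h1
  · linear_combination h2
  · push_cast; linear_combination 2 * h3
  · linear_combination h4

lemma IA_mul {n : ℕ} {g : GG} (h : IA n g) (x : SZ) : IA n (g * phA x) := by
  obtain ⟨a, b, c, d, h1, h2, h3, h4⟩ := h
  refine ⟨a * x 0 0 + b * x 1 0, a * x 0 1 + b * x 1 1, c * x 0 0 + d * x 1 0, c * x 0 1 + d * x 1 1,
    ?_, ?_, ?_, ?_⟩ <;> simp only [m00, m01, m10, m11, phA_apply] <;> push_cast
  · linear_combination (x 0 0 : ZH) * h1 + (x 1 0 : ZH) * h2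
  · linear_combination (x 0 1 : ZH) * h1 + (x 1 1 : ZH) * h2
  · linear_combination (x 0 0 : ZH) * h3 + (x 1 0 : ZH) * h4
  · linear_combination (x 0 1 : ZH) * h3 + (x 1 1 : ZH) * h4

lemma IB_mul {n : ℕ} {g : GG} (h : IB n g) (x : SZ) : IB n (g * phB x) := by
  obtain ⟨a, b, c, d, h1, h2, h3, h4⟩ := h
  have := two_hf
  refine ⟨a * x 1 1 - b * x 0 1, - a * x 1 0 + b * x 0 0, c * x 1 1 - d * x 0 1,
    - c * x 1 0 + d * x 0 0, ?_, ?_, ?_, ?_⟩ <;>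
    simp only [m00, m01, m10, m11, pB00, pB01, pB10, pB11] <;> push_cast
  · linear_combination (x 1 1 : ZH) * h1 - (x 0 1 : ZH) * h2
  · linear_combination -(x 1 0 : ZH) * h1 + (x 0 0 : ZH) * h2 - (x 1 0 : ZH) * 2 ^ n * g 0 0 * two_hf
  · linear_combination (x 1 1 : ZH) * h3 - (x 0 1 : ZH) * h4
  · linear_combination -(x 1 0 : ZH) * h3 + (x 0 0 : ZH) * h4 - (x 1 0 : ZH) * 2 ^ n * g 1 0 * two_hf

lemma IA_iff {n : ℕ} {g : GG} (x : SZ) : IA n (g * phA x) ↔ IA n g :=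
  ⟨fun h => by simpa [mul_assoc, ← map_mul] using IA_mul h x⁻¹, fun h => IA_mul h x⟩
lemma IB_iff {n : ℕ} {g : GG} (x : SZ) : IB n (g * phB x) ↔ IB n g :=
  ⟨fun h => by simpa [mul_assoc, ← map_mul] using IB_mul h x⁻¹, fun h => IB_mul h x⟩

lemma ex_IA (g : GG) : ∃ n, IA n g := by
  obtain ⟨n1, a, h1⟩ := zh_int (g 0 0)
  obtain ⟨n2, b, h2⟩ := zh_int (g 0 1)
  obtain ⟨n3, c, h3⟩ := zh_int (g 1 0)
  obtain ⟨n4, d, h4⟩ := zh_int (g 1 1)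
  refine ⟨n1 + n2 + n3 + n4, 2 ^ (n2 + n3 + n4) * a, 2 ^ (n1 + n3 + n4) * b, 2 ^ (n1 + n2 + n4) * c,
    2 ^ (n1 + n2 + n3) * d, ?_, ?_, ?_, ?_⟩ <;> push_cast
  · rw [← h1]; ring
  · rw [← h2]; ring
  · rw [← h3]; ring
  · rw [← h4]; ring

lemma ex_IB (g : GG) : ∃ n, IB n g := (ex_IA g).imp fun _ => IA_IB

open Classical in
/-- The first level. -/
noncomputable def nA (g : GG) : ℕ := Nat.find (ex_IA g)
open Classical in
/-- The second level. -/
noncomputable def nB (g : GG) : ℕ := Nat.find (ex_IB g)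

lemma nA_spec (g : GG) : IA (nA g) g := by classical exact Nat.find_spec (ex_IA g)
lemma nB_spec (g : GG) : IB (nB g) g := by classical exact Nat.find_spec (ex_IB g)
lemma nA_min {g : GG} {n : ℕ} (h : IA n g) : nA g ≤ n := by classical exact Nat.find_min' _ h
lemma nB_min {g : GG} {n : ℕ} (h : IB n g) : nB g ≤ n := by classical exact Nat.find_min' _ h

lemma nA_mul (g : GG) (x : SZ) : nA (g * phA x) = nA g :=
  le_antisymm (nA_min (IA_mul (nA_spec g) x)) (nA_min ((IA_iff x).1 (nA_spec _)))
lemma nB_mul (g : GG) (x : SZ) : nB (g * phB x) = nB g :=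
  le_antisymm (nB_min (IB_mul (nB_spec g) x)) (nB_min ((IB_iff x).1 (nB_spec _)))

lemma nB_le (g : GG) : nB g ≤ nA g := nB_min (IA_IB (nA_spec g))
lemma nA_le (g : GG) : nA g ≤ nB g + 1 := nA_min (IB_IA (nB_spec g))

lemma even_col {a b a' x y : ℤ} (h : 2 * a' = 2 * (a * x) + b * y) (hy : ¬ (2 : ℤ) ∣ y) : ∃ b0, b = 2 * b0 := by
  have : (2 : ℤ) ∣ b * y := ⟨a' - a * x, by linarith⟩
  rcases Int.prime_two.dvd_or_dvd this with h | h
  · exact h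
  · exact absurd h hy

lemma edgeA {g : GG} {x : SZ} (h1 : nB g < nA g) (h2 : nB (g * phA x) < nA g) : x ∈ G02 := by
  by_contra hx
  rw [mem_G02] at hx
  obtain ⟨k, hk⟩ : ∃ k, nA g = k + 1 := ⟨nA g - 1, by omega⟩
  have e1 : nB g = k := by have := nA_le g; omega
  have e2 : nB (g * phA x) = k := by
    have := nA_le (g * phA x); rw [nA_mul] at this; omega
  have s1 := nB_spec g
  have s2 := nB_spec (g * phA x)
  rw [e1] at s1; rw [e2] at s2
  obtain ⟨a, b, c, d, p1, p2, p3, p4⟩ := s1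
  obtain ⟨a', b', c', d', q1, q2, q3, q4⟩ := s2
  rw [m00, phA_apply, phA_apply] at q1
  rw [m10, phA_apply, phA_apply] at q3
  obtain ⟨b0, rfl⟩ : ∃ b0, b = 2 * b0 := by
    refine even_col (a := a) (a' := a') (x := x 0 0) (y := x 1 0) (cast_inj _ _ ?_) hx
    push_cast
    linear_combination -2 * q1 + (2 * x 0 0 : ZH) * p1 + (x 1 0 : ZH) * p2
  obtain ⟨d0, rfl⟩ : ∃ b0, d = 2 * b0 := by
    refine even_col (a := c) (a' := c') (x := x 0 0) (y := x 1 0) (cast_inj _ _ ?_) hx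
    push_cast
    linear_combination -2 * q3 + (2 * x 0 0 : ZH) * p3 + (x 1 0 : ZH) * p4
  have : IA k g := by
    refine ⟨a, b0, c, d0, p1, two_cancel ?_, p3, two_cancel ?_⟩
    · push_cast at p2; linear_combination p2
    · push_cast at p4; linear_combination p4
  have := nA_min this
  omega

lemma edgeB {g : GG} {x : SZ} (h1 : nA g ≤ nB g) (h2 : nA (g * phB x) ≤ nB g) : x ∈ G02 := by
  by_contra hx
  rw [mem_G02] at hx
  have e1 : nA g = nB g := by have := nB_le g; omega
  have e2 : nA (g * phB x) = nB g := by
    have := nB_le (g * phB x); rw [nB_mul] at this; omega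
  have s1 := nA_spec g
  have s2 := nA_spec (g * phB x)
  rw [e1] at s1; rw [e2] at s2
  obtain ⟨a, b, c, d, p1, p2, p3, p4⟩ := s1
  obtain ⟨a', b', c', d', q1, q2, q3, q4⟩ := s2
  rw [m01, pB01, pB11] at q2
  rw [m11, pB01, pB11] at q4
  have t := two_hf
  obtain ⟨a0, rfl⟩ : ∃ b0, a = 2 * b0 := by
    refine even_col (a := b) (a' := b') (x := x 0 0) (y := - x 1 0) (cast_inj _ _ ?_) (by rwa [dvd_neg])
    push_cast
    linear_combination -2 * q2 + (2 * x 0 0 : ZH) * p2 - (x 1 0 : ZH) * p1 - 2 ^ (nB g) * g 0 0 * (x 1 0 : ZH) * t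
  obtain ⟨c0, rfl⟩ : ∃ b0, c = 2 * b0 := by
    refine even_col (a := d) (a' := d') (x := x 0 0) (y := - x 1 0) (cast_inj _ _ ?_) (by rwa [dvd_neg])
    push_cast
    linear_combination -2 * q4 + (2 * x 0 0 : ZH) * p4 - (x 1 0 : ZH) * p3 - 2 ^ (nB g) * g 1 0 * (x 1 0 : ZH) * t
  rcases hm : nB g with _ | k
  · rw [hm] at p1 p2 p3 p4
    have : (2 * a0) * d - b * (2 * c0) = 1 := by
      apply cast_inj
      have := sl_det g
      push_cast at *
      rw [← p1, ← p2, ← p3, ← p4]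
      linear_combination this
    have : (2 : ℤ) ∣ 1 := ⟨a0 * d - b * c0, by linarith⟩
    norm_num at this
  · rw [hm] at p1 p2 p3 p4
    have : IB k g := by
      push_cast at p1 p3
      refine ⟨a0, b, c0, d, two_cancel ?_, ?_, two_cancel ?_, ?_⟩
      · linear_combination p1
      · linear_combination p2
      · linear_combination p3
      · linear_combination p4
    have := nB_min this
    omega

/-- Lower triangular generator. -/
def sL : SZ := ⟨!![1, 0; 1, 1], by simp⟩

lemma par {a b c d : ℤ} (h : (2 : ℤ) ∣ a * d - b * c) : ∃ x : SZ, (2 : ℤ) ∣ a * x 0 0 + b * x 1 0 ∧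
    (2 : ℤ) ∣ c * x 0 0 + d * x 1 0 := by
  have key : ((2 : ℤ) ∣ a ∧ (2 : ℤ) ∣ c) ∨ ((2 : ℤ) ∣ b ∧ (2 : ℤ) ∣ d) ∨ ((2 : ℤ) ∣ a + b ∧ (2 : ℤ) ∣ c + d) := by
    rcases Int.even_or_odd' a with ⟨a', rfl | rfl⟩ <;> rcases Int.even_or_odd' b with ⟨b', rfl | rfl⟩ <;>
    rcases Int.even_or_odd' c with ⟨c', rfl | rfl⟩ <;> rcases Int.even_or_odd' d with ⟨d', rfl | rfl⟩ <;>
    ring_nf at h <;> omega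
  rcases key with ⟨h1, h2⟩ | ⟨h1, h2⟩ | ⟨h1, h2⟩
  · exact ⟨1, by rw [o00, o10]; simpa using h1, by rw [o00, o10]; simpa using h2⟩
  · exact ⟨sS, by rw [sS00, sS10]; simpa using h1, by rw [sS00, sS10]; simpa using h2⟩
  · have u1 : sL 0 0 = 1 := rfl
    have u2 : sL 1 0 = 1 := rfl
    exact ⟨sL, by rw [u1, u2]; simpa using h1, by rw [u1, u2]; simpa using h2⟩

lemma downA {n : ℕ} {g : GG} (h : IA (n + 1) g) : ∃ x : SZ, IB n (g * phA x) := by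
  obtain ⟨a, b, c, d, h1, h2, h3, h4⟩ := h
  have hd : a * d - b * c = 2 * (2 ^ n * 2 ^ (n + 1)) := by
    apply cast_inj
    push_cast
    rw [← h1, ← h2, ← h3, ← h4]
    linear_combination 2 * (2 ^ n * 2 ^ (n + 1)) * sl_det g
  obtain ⟨x, ⟨a', ha⟩, ⟨c', hc⟩⟩ := par ⟨_, hd⟩
  refine ⟨x, a', a * x 0 1 + b * x 1 1, c', c * x 0 1 + d * x 1 1, two_cancel ?_, ?_, two_cancel ?_, ?_⟩ <;>
    simp only [m00, m01, m10, m11, phA_apply] 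
  · have := congrArg (Int.cast (R := ZH)) ha
    push_cast at this
    linear_combination this + (x 0 0 : ZH) * h1 + (x 1 0 : ZH) * h2
  · push_cast
    linear_combination (x 0 1 : ZH) * h1 + (x 1 1 : ZH) * h2
  · have := congrArg (Int.cast (R := ZH)) hc
    push_cast at this
    linear_combination this + (x 0 0 : ZH) * h3 + (x 1 0 : ZH) * h4
  · push_cast
    linear_combination (x 0 1 : ZH) * h3 + (x 1 1 : ZH) * h4

lemma downB {n : ℕ} {g : GG} (h : IB n g) : ∃ x : SZ, IA n (g * phB x) := by
  obtain ⟨a, b, c, d, h1, h2, h3, h4⟩ := h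
  have hd : b * -c - (-a) * d = 2 * (2 ^ n * 2 ^ n) := by
    apply cast_inj
    push_cast
    rw [← h1, ← h2, ← h3, ← h4]
    linear_combination 2 * (2 ^ n * 2 ^ n) * sl_det g
  obtain ⟨x, ⟨b', hb⟩, ⟨d', hd⟩⟩ := par ⟨_, hd⟩
  have t := two_hf
  refine ⟨x, a * x 1 1 - b * x 0 1, b', c * x 1 1 - d * x 0 1, d', ?_, two_cancel ?_, ?_, two_cancel ?_⟩ <;>
    simp only [m00, m01, m10, m11, pB00, pB01, pB10, pB11]
  · push_cast
    linear_combination (x 1 1 : ZH) * h1 - (x 0 1 : ZH) * h2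
  · have := congrArg (Int.cast (R := ZH)) hb
    push_cast at this
    linear_combination this -(x 1 0 : ZH) * h1 + (x 0 0 : ZH) * h2 - (x 1 0 : ZH) * 2 ^ n * g 0 0 * two_hf
  · push_cast
    linear_combination (x 1 1 : ZH) * h3 - (x 0 1 : ZH) * h4
  · have := congrArg (Int.cast (R := ZH)) hd
    push_cast at this
    linear_combination this -(x 1 0 : ZH) * h3 + (x 0 0 : ZH) * h4 - (x 1 0 : ZH) * 2 ^ n * g 1 0 * two_hf

lemma IA_zero {g : GG} (h : IA 0 g) : ∃ x : SZ, g = phA x := by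
  obtain ⟨a, b, c, d, h1, h2, h3, h4⟩ := h
  simp only [pow_zero, one_mul] at h1 h2 h3 h4
  have hd : a * d - b * c = 1 := by
    apply cast_inj
    push_cast
    rw [← h1, ← h2, ← h3, ← h4, sl_det g]
  refine ⟨⟨!![a, b; c, d], by rw [Matrix.det_fin_two_of, hd]⟩, sl_ext ?_ ?_ ?_ ?_⟩ <;> assumption

lemma gen_inv {T : Type} (f : GG → T) (hA : ∀ g x, f (g * phA x) = f g) (hB : ∀ g x, f (g * phB x) = f g)
    (g : GG) : f g = f 1 := by
  obtain ⟨n, hn⟩ := ex_IA g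
  induction n generalizing g with
  | zero =>
    obtain ⟨x, rfl⟩ := IA_zero hn
    rw [← one_mul (phA x), hA]
  | succ n ih =>
    obtain ⟨x, hx⟩ := downA hn
    obtain ⟨y, hy⟩ := downB hx
    rw [← hA g x, ← hB _ y, ih _ hy]

lemma CA : Cg ≤ phA.range := by
  rintro _ ⟨x, hx, rfl⟩
  exact ⟨x, rfl⟩

lemma phB_C {x : SZ} (hx : x ∈ G02) : phB x ∈ Cg := by
  obtain ⟨c, hc⟩ := (mem_G02 x).1 hx
  have hd := sl_det x
  refine ⟨⟨!![x 1 1, -c; -2 * x 0 1, x 0 0], by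
    rw [Matrix.det_fin_two_of]; rw [hc] at hd; linarith⟩, ?_, sl_ext ?_ ?_ ?_ ?_⟩
  · change (2 : ℤ) ∣ -2 * x 0 1
    exact ⟨-x 0 1, by ring⟩
  · rfl
  · change ((-c : ℤ) : ZH) = -hf * ((x 1 0 : ℤ) : ZH)
    rw [hc]; push_cast; linear_combination (c : ZH) * two_hf
  · change ((-2 * x 0 1 : ℤ) : ZH) = - 2 * ((x 0 1 : ℤ) : ZH)
    push_cast; ring
  · rfl

lemma CB : Cg ≤ phB.range := by
  rintro _ ⟨x, hx, rfl⟩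
  obtain ⟨c, hc⟩ := (mem_G02 x).1 hx
  have hd := sl_det x
  refine ⟨⟨!![x 1 1, -c; -2 * x 0 1, x 0 0], by
    rw [Matrix.det_fin_two_of]; rw [hc] at hd; linarith⟩, sl_ext ?_ ?_ ?_ ?_⟩
  · rfl
  · change - hf * ((-2 * x 0 1 : ℤ) : ZH) = ((x 0 1 : ℤ) : ZH)
    push_cast; linear_combination (x 0 1 : ZH) * two_hf
  · change - 2 * ((-c : ℤ) : ZH) = ((x 1 0 : ℤ) : ZH)
    rw [hc]; push_cast; ring
  · rfl

/-- The vertices of the big tree. -/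
abbrev VG : Type := (GG ⧸ phA.range) ⊕ (GG ⧸ phB.range)
/-- The base point. -/
abbrev YG : Type := GG ⧸ (⊤ : Subgroup GG)
/-- The first end map. -/
noncomputable def sG : GG ⧸ Cg → VG := fun e => Sum.inl (pr _ _ CA e)
/-- The second end map. -/
noncomputable def tG : GG ⧸ Cg → VG := fun e => Sum.inr (pr _ _ CB e)
/-- The projection. -/
noncomputable def pG : VG → YG := Sum.elim (pr _ _ le_top) (pr _ _ le_top)

lemma sG_smul (g : GG) (x) : sG (g • x) = g • sG x := congrArg Sum.inl (pr_smul _ _ CA g x)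
lemma tG_smul (g : GG) (x) : tG (g • x) = g • tG x := congrArg Sum.inr (pr_smul _ _ CB g x)
lemma pG_smul (g : GG) (x : VG) : pG (g • x) = g • pG x := by
  rcases x with x | x
  · exact pr_smul phA.range ⊤ le_top g x
  · exact pr_smul phB.range ⊤ le_top g x

lemma YG_sub (a b : YG) : a = b := by
  obtain ⟨g, rfl⟩ := QuotientGroup.mk_surjective a
  obtain ⟨h, rfl⟩ := QuotientGroup.mk_surjective b
  rw [QuotientGroup.eq]; trivial

lemma treeG : ∃ ρ, TreeD sG tG pG ρ := by
  let ρ1 : GG ⧸ phA.range → ℤ := lq _ (fun g => 2 * (nA g : ℤ)) (by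
    rintro g _ ⟨x, rfl⟩; simp only [nA_mul])
  let ρ2 : GG ⧸ phB.range → ℤ := lq _ (fun g => 2 * (nB g : ℤ) + 1) (by
    rintro g _ ⟨x, rfl⟩; simp only [nB_mul])
  have v1 : ∀ g : GG, Sum.elim ρ1 ρ2 (sG (QuotientGroup.mk g)) = 2 * (nA g : ℤ) := fun _ => rfl
  have v2 : ∀ g : GG, Sum.elim ρ1 ρ2 (tG (QuotientGroup.mk g)) = 2 * (nB g : ℤ) + 1 := fun _ => rfl
  refine ⟨Sum.elim ρ1 ρ2, ?_, ?_, ?_, ?_, ?_, ?_, ?_, ?_⟩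
  · rintro (v | v)
    · obtain ⟨g, rfl⟩ := QuotientGroup.mk_surjective v
      change 0 ≤ 2 * (nA g : ℤ); omega
    · obtain ⟨g, rfl⟩ := QuotientGroup.mk_surjective v
      change 0 ≤ 2 * (nB g : ℤ) + 1; omega
  · intro e
    obtain ⟨g, rfl⟩ := QuotientGroup.mk_surjective e
    rw [v1, v2]; omega
  · intro e e' h l1 l2
    obtain ⟨g, rfl⟩ := QuotientGroup.mk_surjective e
    obtain ⟨g', rfl⟩ := QuotientGroup.mk_surjective e'
    rw [v1, v2] at l1 l2
    have h2 : (QuotientGroup.mk g : GG ⧸ phA.range) = QuotientGroup.mk g' := Sum.inl_injective h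
    rw [QuotientGroup.eq] at h2
    obtain ⟨x, hx⟩ := h2
    obtain rfl : g' = g * phA x := by rw [hx, mul_inv_cancel_left]
    rw [nA_mul] at l2
    rw [mk_C (edgeA (x := x) (g := g) (by omega) (by omega))]
  · intro e e' h l1 l2
    obtain ⟨g, rfl⟩ := QuotientGroup.mk_surjective e
    obtain ⟨g', rfl⟩ := QuotientGroup.mk_surjective e'
    rw [v1, v2] at l1 l2
    have h2 : (QuotientGroup.mk g : GG ⧸ phB.range) = QuotientGroup.mk g' := Sum.inr_injective h
    rw [QuotientGroup.eq] at h2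
    obtain ⟨x, hx⟩ := h2
    obtain rfl : g' = g * phB x := by rw [hx, mul_inv_cancel_left]
    rw [nB_mul] at l2
    rw [QuotientGroup.eq, inv_mul_cancel_left]
    exact phB_C (edgeB (x := x) (g := g) (by omega) (by omega))
  · intro e e' h
    exact absurd h (by simp [sG, tG])
  · intro y
    exact ⟨Sum.inl (QuotientGroup.mk 1), YG_sub _ _⟩
  · intro e
    exact YG_sub _ _
  · intro T F hF
    let f : GG → T := fun g => F (Sum.inl (QuotientGroup.mk g))
    have hf' : ∀ g, f g = F (Sum.inr (QuotientGroup.mk g)) := fun g => hF (QuotientGroup.mk g)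
    have hA : ∀ g x, f (g * phA x) = f g := fun g x => by
      have : (QuotientGroup.mk (g * phA x) : GG ⧸ phA.range) = QuotientGroup.mk g := by
        rw [QuotientGroup.eq]; exact ⟨x⁻¹, by simp⟩
      simp only [f, this]
    have hB : ∀ g x, f (g * phB x) = f g := fun g x => by
      have : (QuotientGroup.mk (g * phB x) : GG ⧸ phB.range) = QuotientGroup.mk g := by
        rw [QuotientGroup.eq]; exact ⟨x⁻¹, by simp⟩
      rw [hf', hf', this]
    have all : ∀ v, F v = f 1 := by
      rintro (v | v) <;> obtain ⟨g, rfl⟩ := QuotientGroup.mk_surjective v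
      · exact gen_inv f hA hB g
      · rw [← hf']; exact gen_inv f hA hB g
    intro v w _
    rw [all v, all w]

end SLC

namespace SLC
open CategoryTheory

/-- Cohomology of coset spaces. -/
abbrev HX (X : Type) [MulAction GG X] (n : ℕ) : Type := Hc (FR X (TT ℤ GG)) n

/-- Pullback in cohomology. -/
noncomputable abbrev ps {X Y : Type} [MulAction GG X] [MulAction GG Y] (p : X → Y)
    (hp : ∀ (g : GG) x, p (g • x) = g • p x) (n : ℕ) : HX Y n →+ HX X n :=
  hmap (pull p hp (TT ℤ GG)) n

/-- The periodicity classes. -/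
noncomputable abbrev xx (X : Type) [MulAction GG X] (j : ℕ) : HX X (2 * j) := xi Om s00 ℤ X j

lemma zs_sub {N : Type} [AddCommGroup N] (a b : ℤ) (x : N) : (a - b) • x = a • x - b • x := sub_smul a b x

section MVs
variable {X X1 X2 Z Y : Type} [MulAction GG X] [MulAction GG X1] [MulAction GG X2] [MulAction GG Z]
  [MulAction GG Y]

lemma ps_xx (p : X → Y) (hp : ∀ (g : GG) x, p (g • x) = g • p x) (j : ℕ) :
    ps p hp (2 * j) (xx Y j) = xx X j := xi_nat Om s00 p hp j

lemma ps_zxx (p : X → Y) (hp : ∀ (g : GG) x, p (g • x) = g • p x) (j : ℕ) (c : ℤ) :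
    ps p hp (2 * j) (c • xx Y j) = c • xx X j := by rw [map_zsmul, ps_xx]

lemma ps_comp (p : X → Y) (hp : ∀ (g : GG) x, p (g • x) = g • p x) (q : Y → Z)
    (hq : ∀ (g : GG) x, q (g • x) = g • q x) (r : X → Z) (hr : ∀ (g : GG) x, r (g • x) = g • r x)
    (h : ∀ x, r x = q (p x)) (n : ℕ) (y : HX Z n) : ps r hr n y = ps p hp n (ps q hq n y) := by
  obtain rfl : r = q ∘ p := funext h
  exact hmap_comp (pull q hq (TT ℤ GG)) (pull p hp (TT ℤ GG)) n y

lemma hmap_sub {A B : Rep.{0} ℤ GG} (f g : A ⟶ B) (n : ℕ) (x : Hc A n) :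
    hmap (f - g) n x = hmap f n x - hmap g n x := by
  rw [eq_sub_iff_add_eq, ← hmap_add, sub_add_cancel]

/-- Left restriction. -/
noncomputable abbrev rl (X1 X2 : Type) [MulAction GG X1] [MulAction GG X2] (n : ℕ) :
    HX (X1 ⊕ X2) n →+ HX X1 n := ps Sum.inl (fun _ _ => rfl) n
/-- Right restriction. -/
noncomputable abbrev rr (X1 X2 : Type) [MulAction GG X1] [MulAction GG X2] (n : ℕ) :
    HX (X1 ⊕ X2) n →+ HX X2 n := ps Sum.inr (fun _ _ => rfl) n

lemma sum_ext (n : ℕ) (x y : HX (X1 ⊕ X2) n) (h1 : rl X1 X2 n x = rl X1 X2 n y)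
    (h2 : rr X1 X2 n x = rr X1 X2 n y) : x = y := hsum_ext X1 X2 _ n x y h1 h2

lemma sum_surj (n : ℕ) (a : HX X1 n) (b : HX X2 n) :
    ∃ x : HX (X1 ⊕ X2) n, rl X1 X2 n x = a ∧ rr X1 X2 n x = b := hsum_surj X1 X2 _ n a b

/-- The Mayer-Vietoris sequence. -/
structure MV (p1 : Z → X1) (p2 : Z → X2) (q1 : X1 → Y) (q2 : X2 → Y)
    (hp1 : ∀ (g : GG) x, p1 (g • x) = g • p1 x) (hp2 : ∀ (g : GG) x, p2 (g • x) = g • p2 x)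
    (hq1 : ∀ (g : GG) x, q1 (g • x) = g • q1 x) (hq2 : ∀ (g : GG) x, q2 (g • x) = g • q2 x)
    (d : ∀ n, HX Z n →+ HX Y (n + 1)) : Prop where
  eY : ∀ n y, ps q1 hq1 (n + 1) y = 0 → ps q2 hq2 (n + 1) y = 0 → ∃ z, d n z = y
  eX : ∀ n a b, ps p1 hp1 n a = ps p2 hp2 n b → ∃ y, ps q1 hq1 n y = a ∧ ps q2 hq2 n y = b
  eZ : ∀ n z, d n z = 0 → ∃ a b, z = ps p2 hp2 n b - ps p1 hp1 n a
  z1 : ∀ n z, ps q1 hq1 (n + 1) (d n z) = 0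
  z2 : ∀ n z, ps q2 hq2 (n + 1) (d n z) = 0
  zX : ∀ n y, ps p1 hp1 n (ps q1 hq1 n y) = ps p2 hp2 n (ps q2 hq2 n y)
  zZ : ∀ n a, d n (ps p1 hp1 n a) = 0

lemma MV_of_tree {s t : Z → X1 ⊕ X2} {p : X1 ⊕ X2 → Y} {ρ : X1 ⊕ X2 → ℤ} (h : TreeD s t p ρ)
    (hs : ∀ (g : GG) x, s (g • x) = g • s x) (ht : ∀ (g : GG) x, t (g • x) = g • t x)
    (hp : ∀ (g : GG) x, p (g • x) = g • p x)
    (p1 : Z → X1) (p2 : Z → X2) (q1 : X1 → Y) (q2 : X2 → Y)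
    (hp1 : ∀ (g : GG) x, p1 (g • x) = g • p1 x) (hp2 : ∀ (g : GG) x, p2 (g • x) = g • p2 x)
    (hq1 : ∀ (g : GG) x, q1 (g • x) = g • q1 x) (hq2 : ∀ (g : GG) x, q2 (g • x) = g • q2 x)
    (es : ∀ z, s z = Sum.inl (p1 z)) (et : ∀ z, t z = Sum.inr (p2 z))
    (e1 : ∀ x, q1 x = p (Sum.inl x)) (e2 : ∀ x, q2 x = p (Sum.inr x)) :
    ∃ d, MV p1 p2 q1 q2 hp1 hp2 hq1 hq2 d := by
  have S := tree_ses h hs ht hp (TT ℤ GG)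
  have hd : ∀ n (w : HX (X1 ⊕ X2) n), hmap (dif s t hs ht (TT ℤ GG)) n w =
      ps p2 hp2 n (rr X1 X2 n w) - ps p1 hp1 n (rl X1 X2 n w) := by
    intro n w
    rw [← ps_comp p2 hp2 Sum.inr (fun _ _ => rfl) t ht et, ← ps_comp p1 hp1 Sum.inl (fun _ _ => rfl) s hs es]
    exact hmap_sub _ _ n w
  have r1 : ∀ n y, ps q1 hq1 n y = rl X1 X2 n (ps p hp n y) := fun n y =>
    ps_comp _ _ _ _ _ _ e1 n y
  have r2 : ∀ n y, ps q2 hq2 n y = rr X1 X2 n (ps p hp n y) := fun n y =>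
    ps_comp _ _ _ _ _ _ e2 n y
  refine ⟨fun n => S.δ n, ?_, ?_, ?_, ?_, ?_, ?_, ?_⟩
  · intro n y h1 h2
    apply S.ex_A
    apply sum_ext
    · rw [← r1, h1, map_zero]
    · rw [← r2, h2, map_zero]
  · intro n a b hab
    obtain ⟨w, rfl, rfl⟩ := sum_surj n a b
    obtain ⟨y, hy⟩ := S.ex_B n w (by rw [hd, hab, sub_self])
    exact ⟨y, by rw [r1, ← hy], by rw [r2, ← hy]⟩
  · intro n z hz
    obtain ⟨w, hw⟩ := S.ex_C n z hz
    exact ⟨_, _, hw.symm.trans (hd n w)⟩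
  · intro n z
    rw [r1]
    have := S.zero_A n z
    rw [this, map_zero]
  · intro n z
    rw [r2]
    have := S.zero_A n z
    rw [this, map_zero]
  · intro n y
    have := S.zero_B n y
    rw [hd] at this
    rw [r1, r2]
    exact (sub_eq_zero.1 this).symm
  · intro n a
    obtain ⟨w, h1, h2⟩ := sum_surj (X1 := X1) (X2 := X2) n (-a) 0
    have := S.zero_C n w
    rw [hd, h1, h2, map_zero, map_neg, zero_sub, neg_neg] at this
    exact this

/-- All even classes are multiples of the periodicity class. -/
def Gen (X : Type) [MulAction GG X] : Prop := ∀ j (y : HX X (2 * j)), ∃ c : ℤ, y = c • xx X j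

/-- Order of the periodicity class in positive degree. -/
def Ord (X : Type) [MulAction GG X] (m : ℕ) : Prop := ∀ j (c : ℤ), c • xx X (j + 1) = 0 ↔ (m : ℤ) ∣ c

/-- Odd vanishing. -/
def Odd0 (X : Type) [MulAction GG X] : Prop := ∀ j (y : HX X (2 * j + 1)), y = 0

lemma gen_zero {H : Subgroup GG} (y : HX (GG ⧸ H) (2 * 0)) : ∃ c : ℤ, y = c • xx (GG ⧸ H) 0 :=
  (one_cyc (G := GG) (X := GG ⧸ H) (QuotientGroup.mk 1)).1 y

lemma ord_zero {H : Subgroup GG} (c : ℤ) : c • xx (GG ⧸ H) 0 = 0 ↔ c = 0 := by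
  refine ((one_cyc (G := GG) (X := GG ⧸ H) (QuotientGroup.mk 1)).2 c).trans ?_
  simp

lemma Gen_of {H : Subgroup GG} (h : ∀ j (y : HX (GG ⧸ H) (2 * (j + 1))), ∃ c : ℤ, y = c • xx (GG ⧸ H) (j + 1)) :
    Gen (GG ⧸ H) := by
  intro j
  cases j with
  | zero => exact gen_zero
  | succ j => exact h j

lemma rot_gen {κ : GG} {r : ℕ} (R : Rot Om κ r) : Gen (GG ⧸ Subgroup.zpowers κ) :=
  Gen_of fun j => (R.xi_cyc s00 j).1
lemma rot_ord {κ : GG} {r : ℕ} (R : Rot Om κ r) : Ord (GG ⧸ Subgroup.zpowers κ) (2 * r) :=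
  fun j => (R.xi_cyc s00 j).2
lemma rot_odd {κ : GG} {r : ℕ} (R : Rot Om κ r) : Odd0 (GG ⧸ Subgroup.zpowers κ) :=
  fun j y => R.Hodd s00 j y

section
variable {p1 : Z → X1} {p2 : Z → X2} {q1 : X1 → Y} {q2 : X2 → Y}
    {hp1 : ∀ (g : GG) x, p1 (g • x) = g • p1 x} {hp2 : ∀ (g : GG) x, p2 (g • x) = g • p2 x}
    {hq1 : ∀ (g : GG) x, q1 (g • x) = g • q1 x} {hq2 : ∀ (g : GG) x, q2 (g • x) = g • q2 x}
    {d : ∀ n, HX Z n →+ HX Y (n + 1)} (M : MV p1 p2 q1 q2 hp1 hp2 hq1 hq2 d)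
include M

lemma MV.odd (gZ : Gen Z) (o1 : Odd0 X1) (o2 : Odd0 X2) : Odd0 Y := by
  intro j y
  obtain ⟨z, rfl⟩ := M.eY (2 * j) y (o1 j _) (o2 j _)
  obtain ⟨c, rfl⟩ := gZ j z
  rw [← ps_zxx p1 hp1, M.zZ]

lemma MV.cong {m : ℕ} (oZ : Ord Z m) (j : ℕ) (y : HX Y (2 * (j + 1))) (a b : ℤ)
    (ha : ps q1 hq1 _ y = a • xx X1 (j + 1)) (hb : ps q2 hq2 _ y = b • xx X2 (j + 1)) :
    (m : ℤ) ∣ a - b := by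
  have := M.zX (2 * (j + 1)) y
  rw [ha, hb, ps_zxx, ps_zxx] at this
  rw [← oZ j, zs_sub, this, sub_self]

end
end MVs

section AB
variable {φ : SZ →* GG} (hS : φ sS ^ 2 = -1) (hU : φ sU ^ 3 = -1) (hφ : Function.Injective φ)
  (hn : φ (-1) = -1) (RS : Rot Om (φ sS) 2) (RU : Rot Om (φ sU) 3)
include hS hU hφ hn RS RU

lemma AB : Odd0 (GG ⧸ φ.range) ∧ Gen (GG ⧸ φ.range) ∧ Ord (GG ⧸ φ.range) 12 := by
  obtain ⟨ρ, hρ⟩ := treeA φ hS hU hφ hn RS RU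
  obtain ⟨d, M⟩ := MV_of_tree hρ (sA_smul φ hS) (tA_smul φ hU) (pA_smul φ)
    (pr _ _ (zp_le hS)) (pr _ _ (zp_le hU)) (pr _ _ (zp_range _)) (pr _ _ (zp_range _))
    (pr_smul _ _ _) (pr_smul _ _ _) (pr_smul _ _ _) (pr_smul _ _ _)
    (fun _ => rfl) (fun _ => rfl) (fun _ => rfl) (fun _ => rfl)
  have inj : ∀ j (y : HX (GG ⧸ φ.range) (2 * (j + 1))), ps (pr _ _ (zp_range (φ := φ) sS)) (pr_smul _ _ _) _ y = 0 →
      ps (pr _ _ (zp_range (φ := φ) sU)) (pr_smul _ _ _) _ y = 0 → y = 0 := by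
    intro j y h1 h2
    obtain ⟨z, rfl⟩ := M.eY (2 * j + 1) y h1 h2
    rw [rot_odd rot1 j z, map_zero]
  refine ⟨M.odd (rot_gen rot1) (rot_odd RS) (rot_odd RU), Gen_of ?_, ?_⟩
  · intro j y
    obtain ⟨a, ha⟩ := rot_gen RS (j + 1) (ps _ (pr_smul _ _ (zp_range _)) _ y)
    obtain ⟨b, hb⟩ := rot_gen RU (j + 1) (ps _ (pr_smul _ _ (zp_range _)) _ y)
    have := M.cong (rot_ord rot1) j y a b ha hb
    obtain ⟨t, ht⟩ := this
    push_cast at ht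
    refine ⟨3 * a - 2 * b, ?_⟩
    rw [← sub_eq_zero]
    apply inj
    · rw [map_sub, ps_zxx, ha, ← zs_sub, rot_ord RS]
      exact ⟨- t, by push_cast; linarith⟩
    · rw [map_sub, ps_zxx, hb, ← zs_sub, rot_ord RU]
      exact ⟨- t, by push_cast; linarith⟩
  · intro j c
    constructor
    · intro h
      have h1 : ps _ (pr_smul _ _ (zp_range (φ := φ) sS)) _ (c • xx (GG ⧸ φ.range) (j + 1)) = 0 := by rw [h, map_zero]
      have h2 : ps _ (pr_smul _ _ (zp_range (φ := φ) sU)) _ (c • xx (GG ⧸ φ.range) (j + 1)) = 0 := by rw [h, map_zero]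
      rw [ps_zxx, rot_ord RS] at h1
      rw [ps_zxx, rot_ord RU] at h2
      push_cast at h1 h2 ⊢
      omega
    · intro h
      push_cast at h
      apply inj
      · rw [ps_zxx, rot_ord RS]; push_cast; omega
      · rw [ps_zxx, rot_ord RU]; push_cast; omega
end AB

lemma cohA : Odd0 (GG ⧸ phA.range) ∧ Gen (GG ⧸ phA.range) ∧ Ord (GG ⧸ phA.range) 12 :=
  AB (by rw [← map_pow, sS2, phA_neg]) (by rw [← map_pow, sU3, phA_neg]) phA_inj phA_neg rotAS rotAU
lemma cohB : Odd0 (GG ⧸ phB.range) ∧ Gen (GG ⧸ phB.range) ∧ Ord (GG ⧸ phB.range) 12 :=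
  AB (by rw [← map_pow, sS2, phB_neg]) (by rw [← map_pow, sU3, phB_neg]) phB_inj phB_neg rotBS rotBU

end SLC

namespace SLC
open CategoryTheory

lemma prP_smul (g : GG) (x) : prP (g • x) = g • prP x := pr_smul _ _ (zp_le hP2) g x

lemma zs_zero {N : Type} [AddCommGroup N] (a : ℤ) : a • (0 : N) = 0 := smul_zero a
lemma zs_mul {N : Type} [AddCommGroup N] (a b : ℤ) (x : N) : a • b • x = (a * b) • x := smul_smul a b x
lemma zs_add {N : Type} [AddCommGroup N] (a b : ℤ) (x : N) : a • x + b • x = (a + b) • x := (add_smul a b x).symm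

/-- First projection. -/
noncomputable def qP : GG ⧸ Subgroup.zpowers (phA sP) → GG ⧸ Cg := pr _ _ (zp_C sP_mem)
/-- Second projection. -/
noncomputable def qZ : GG ⧸ Zc → GG ⧸ Cg := pr _ _ neg_C
lemma qP_smul (g : GG) (x) : qP (g • x) = g • qP x := pr_smul _ _ (zp_C sP_mem) g x
lemma qZ_smul (g : GG) (x) : qZ (g • x) = g • qZ x := pr_smul _ _ neg_C g x

lemma dC_apply (n : ℕ) (w : HX VC n) : hmap (dif sC tC sC_smul tC_smul (TT ℤ GG)) n w =
    ps tC tC_smul n w - ps sC sC_smul n w := hmap_sub _ _ n w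

lemma dC1 (n : ℕ) (w : HX VC n) : rl _ _ n (hmap (dif sC tC sC_smul tC_smul (TT ℤ GG)) n w) =
    rr _ _ n w - ps prP prP_smul n (rl _ _ n w) := by
  rw [dC_apply, map_sub]
  have a1 := ps_comp Sum.inl (fun _ _ => rfl) tC tC_smul (Sum.inr : GG ⧸ Zc → VC) (fun _ _ => rfl) (fun _ => rfl) n w
  have hh : ∀ (g : GG) (x : GG ⧸ Zc), (Sum.inl (prP (g • x)) : VC) = g • (Sum.inl (prP x) : VC) :=
    fun g x => congrArg Sum.inl (prP_smul g x)
  have a2 := ps_comp Sum.inl (fun _ _ => rfl) sC sC_smul (fun x => Sum.inl (prP x)) hh (fun _ => rfl) n w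
  have a3 := ps_comp prP prP_smul (Sum.inl : _ → VC) (fun _ _ => rfl) (fun x => Sum.inl (prP x)) hh (fun _ => rfl) n w
  exact congrArg₂ (fun a b => a - b) a1.symm (a2.symm.trans a3)

lemma dC2 (n : ℕ) (w : HX VC n) : rr _ _ n (hmap (dif sC tC sC_smul tC_smul (TT ℤ GG)) n w) =
    ps rT rT_smul n (rr _ _ n w) - rr _ _ n w := by
  rw [dC_apply, map_sub]
  have a1 := ps_comp Sum.inr (fun _ _ => rfl) sC sC_smul (Sum.inr : GG ⧸ Zc → VC) (fun _ _ => rfl) (fun _ => rfl) n w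
  have hh : ∀ (g : GG) (x : GG ⧸ Zc), (Sum.inr (rT (g • x)) : VC) = g • (Sum.inr (rT x) : VC) :=
    fun g x => congrArg Sum.inr (rT_smul g x)
  have a2 := ps_comp Sum.inr (fun _ _ => rfl) tC tC_smul (fun x => Sum.inr (rT x)) hh (fun _ => rfl) n w
  have a3 := ps_comp rT rT_smul (Sum.inr : _ → VC) (fun _ _ => rfl) (fun x => Sum.inr (rT x)) hh (fun _ => rfl) n w
  exact congrArg₂ (fun a b => a - b) (a2.symm.trans a3) a1.symm

lemma seqC : ∃ (δ : ∀ n, HX EC n →+ HX (GG ⧸ Cg) (n + 1)) (D : ∀ n, HX VC n →+ HX EC n),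
    (∀ n w, rl _ _ n (D n w) = rr _ _ n w - ps prP prP_smul n (rl _ _ n w)) ∧
    (∀ n w, rr _ _ n (D n w) = ps rT rT_smul n (rr _ _ n w) - rr _ _ n w) ∧
    (∀ n (y : HX (GG ⧸ Cg) (n + 1)), ps qP qP_smul _ y = 0 → ps qZ qZ_smul _ y = 0 → ∃ z, δ n z = y) ∧
    (∀ n y, ps qZ qZ_smul n y = ps prP prP_smul n (ps qP qP_smul n y)) ∧
    (∀ n w, δ n (D n w) = 0) ∧ (∀ n z, δ n z = 0 → ∃ w, D n w = z) := by
  obtain ⟨ρ, hρ⟩ := treeC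
  have S := tree_ses hρ sC_smul tC_smul pC_smul (TT ℤ GG)
  have r1 : ∀ n y, ps qP qP_smul n y = rl _ _ n (ps pC pC_smul n y) := fun n y =>
    ps_comp Sum.inl (fun _ _ => rfl) pC pC_smul qP qP_smul (fun _ => rfl) n y
  have r2 : ∀ n y, ps qZ qZ_smul n y = rr _ _ n (ps pC pC_smul n y) := fun n y =>
    ps_comp Sum.inr (fun _ _ => rfl) pC pC_smul qZ qZ_smul (fun _ => rfl) n y
  refine ⟨fun n => S.δ n, fun n => hmap (dif sC tC sC_smul tC_smul (TT ℤ GG)) n, dC1, dC2, ?_, ?_,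
    S.zero_C, S.ex_C⟩
  · intro n y h1 h2
    apply S.ex_A
    apply sum_ext
    · rw [← r1, h1, map_zero]
    · rw [← r2, h2, map_zero]
  · intro n y
    have key := dC1 n (ps pC pC_smul n y)
    have hz := S.zero_B n y
    rw [hz, map_zero, ← r1, ← r2] at key
    exact sub_eq_zero.1 key.symm

lemma cohC : Gen (GG ⧸ Cg) ∧ Ord (GG ⧸ Cg) 4 ∧ ∀ j, ∃ ζ : HX (GG ⧸ Cg) (2 * j + 1),
    (∀ y, ∃ c : ℤ, y = c • ζ) ∧ ∀ c : ℤ, c • ζ = 0 ↔ c • xx (GG ⧸ Zc) j = 0 := by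
  obtain ⟨δ, D, hd1, hd2, ex, hz, δD, exC⟩ := seqC
  have rTid : ∀ j (y : HX (GG ⧸ Zc) (2 * j)), ps rT rT_smul _ y = y := by
    intro j y
    obtain ⟨c, rfl⟩ := rot_gen rot1 j y
    exact ps_zxx _ _ _ _
  have inj : ∀ j (y : HX (GG ⧸ Cg) (2 * (j + 1))), ps qP qP_smul _ y = 0 → ps qZ qZ_smul _ y = 0 → y = 0 := by
    intro j y h1 h2
    obtain ⟨z, rfl⟩ := ex (2 * j + 1) y h1 h2
    have : z = 0 := by
      apply sum_ext
      · rw [rot_odd rot1 j (rl _ _ _ z), map_zero]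
      · rw [rot_odd rot1 j (rr _ _ _ z), map_zero]
    rw [this, map_zero]
  have o4 := rot_ord rotP
  have o2 := rot_ord rot1
  refine ⟨Gen_of ?_, ?_, ?_⟩
  · intro j y
    obtain ⟨a, ha⟩ := rot_gen rotP (j + 1) (ps qP qP_smul _ y)
    have key := hz _ y
    rw [ha, ps_zxx] at key
    refine ⟨a, ?_⟩
    rw [← sub_eq_zero]
    apply inj
    · rw [map_sub, ps_zxx, ha, sub_self]
    · rw [map_sub, ps_zxx, key, sub_self]
  · intro j c
    constructor
    · intro h
      have h1 : ps qP qP_smul _ (c • xx (GG ⧸ Cg) (j + 1)) = 0 := by rw [h, map_zero]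
      rw [ps_zxx, o4] at h1
      exact h1
    · intro h
      apply inj
      · rw [ps_zxx, o4]; exact h
      · rw [ps_zxx, o2]; push_cast at h ⊢; omega
  · intro j
    obtain ⟨e0, h1, h2⟩ := sum_surj (X1 := GG ⧸ Zc) (X2 := GG ⧸ Zc) (2 * j) 0 (xx (GG ⧸ Zc) j)
    refine ⟨δ (2 * j) e0, ?_, ?_⟩
    · intro y
      obtain ⟨z, rfl⟩ := ex (2 * j) y (rot_odd rotP j _) (rot_odd rot1 j _)
      obtain ⟨c, hc⟩ := rot_gen rot1 j (rr _ _ _ z)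
      obtain ⟨w, w1, w2⟩ := sum_surj (X1 := GG ⧸ Subgroup.zpowers (phA sP)) (X2 := GG ⧸ Zc) (2 * j) 0 (rl _ _ _ z)
      refine ⟨c, ?_⟩
      have : z = D _ w + c • e0 := by
        apply sum_ext
        · rw [map_add, hd1, w1, w2, map_zsmul, h1, map_zero, sub_zero, zs_zero, add_zero]
        · rw [map_add, hd2, w2, rTid, sub_self, map_zsmul, h2, zero_add]; exact hc
      rw [this, map_add, map_zsmul, δD, zero_add]
    · intro c
      constructor
      · intro h
        rw [← map_zsmul] at h
        obtain ⟨w, hw⟩ := exC _ _ h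
        rw [← h2, ← map_zsmul, ← hw, hd2, rTid, sub_self]
      · intro h
        have : c • e0 = 0 := by
          apply sum_ext
          · rw [map_zsmul, h1, map_zero, zs_zero]
          · rw [map_zsmul, h2, map_zero]; exact h
        rw [← map_zsmul, this, map_zero]

/-- Two consecutive vanishing ranges. -/
lemma acycAB {φ : SZ →* GG} (hS : φ sS ^ 2 = -1) (hU : φ sU ^ 3 = -1) (hφ : Function.Injective φ)
    (hn : φ (-1) = -1) (RS : Rot Om (φ sS) 2) (RU : Rot Om (φ sU) 3) (N : Rep.{0} ℤ GG)
    (h : ∀ (κ : GG) (r : ℕ), Rot Om κ r → Acyc (FR (GG ⧸ Subgroup.zpowers κ) N) 1) :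
    Acyc (FR (GG ⧸ φ.range) N) 2 := by
  obtain ⟨ρ, hρ⟩ := treeA φ hS hU hφ hn RS RU
  have S := tree_ses hρ (sA_smul φ hS) (tA_smul φ hU) (pA_smul φ) N
  exact Acyc.left S ((acyc_sum _ _ _ (h _ _ RS) (h _ _ RU)).mono (by omega)) (h _ _ rot1)

lemma acycG (N : Rep.{0} ℤ GG)
    (h : ∀ (κ : GG) (r : ℕ), Rot Om κ r → Acyc (FR (GG ⧸ Subgroup.zpowers κ) N) 1) :
    Acyc (FR YG N) 3 := by
  have hA := acycAB (by rw [← map_pow, sS2, phA_neg]) (by rw [← map_pow, sU3, phA_neg]) phA_inj phA_neg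
    rotAS rotAU N h
  have hB := acycAB (by rw [← map_pow, sS2, phB_neg]) (by rw [← map_pow, sU3, phB_neg]) phB_inj phB_neg
    rotBS rotBU N h
  have hC : Acyc (FR (GG ⧸ Cg) N) 2 := by
    obtain ⟨ρ, hρ⟩ := treeC
    have S := tree_ses hρ sC_smul tC_smul pC_smul N
    exact Acyc.left S ((acyc_sum _ _ _ (h _ _ rotP) (h _ _ rot1)).mono (by omega))
      (acyc_sum _ _ _ (h _ _ rot1) (h _ _ rot1))
  obtain ⟨ρ, hρ⟩ := treeG
  have S := tree_ses hρ sG_smul tG_smul pG_smul N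
  exact Acyc.left S ((acyc_sum _ _ _ hA hB).mono (by omega)) hC

lemma surjG (j : ℕ) (y : HX YG (2 * (j + 2))) : ∃ x, Phi Om s00 ℤ YG (2 * (j + 1)) x = y :=
  Phi_surj Om s00 (acycG _ fun _ _ R => R.acyc_S) (acycG _ fun _ _ R => R.acyc_Q s00) (2 * (j + 1)) (by omega) y

/-- The shape of the even cohomology of the big group. -/
lemma cohG : Odd0 YG ∧ ∀ j, ∃ ξ θ η : HX YG (2 * (j + 1)),
    (∃ u : ℤ, (12 : ℤ) • ξ = u • η) ∧ (∃ v : ℤ, (3 : ℤ) • θ = v • η) ∧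
    (∀ y, ∃ a b c : ℤ, y = a • ξ + b • θ + c • η) ∧
    (∀ a b c : ℤ, a • ξ + b • θ + c • η = 0 → 12 ∣ a ∧ 3 ∣ b) ∧
    ∀ c : ℤ, c • η = 0 ↔ c • xx (GG ⧸ Zc) j = 0 := by
  obtain ⟨ρ, hρ⟩ := treeG
  have hq1 : ∀ (g : GG) x, pr phA.range ⊤ le_top (g • x) = g • pr phA.range ⊤ le_top x := pr_smul _ _ _
  have hq2 : ∀ (g : GG) x, pr phB.range ⊤ le_top (g • x) = g • pr phB.range ⊤ le_top x := pr_smul _ _ _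
  obtain ⟨d, M⟩ := MV_of_tree hρ sG_smul tG_smul pG_smul
    (pr _ _ CA) (pr _ _ CB) (pr _ _ le_top) (pr _ _ le_top)
    (pr_smul _ _ _) (pr_smul _ _ _) hq1 hq2
    (fun _ => rfl) (fun _ => rfl) (fun _ => rfl) (fun _ => rfl)
  obtain ⟨oA, gA, wA⟩ := cohA
  obtain ⟨oB, gB, wB⟩ := cohB
  obtain ⟨gC, wC, zC⟩ := cohC
  refine ⟨M.odd gC oA oB, fun j => ?_⟩
  obtain ⟨ζ, z1, z2⟩ := zC j
  obtain ⟨η, hη⟩ : ∃ η : HX YG (2 * (j + 1)), η = d (2 * j + 1) ζ := ⟨_, rfl⟩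
  have e1 : ps (pr phA.range ⊤ le_top) hq1 (2 * (j + 1)) η = 0 := by rw [hη]; exact M.z1 _ _
  have e2 : ps (pr phB.range ⊤ le_top) hq2 (2 * (j + 1)) η = 0 := by rw [hη]; exact M.z2 _ _
  have hcη : ∀ c : ℤ, d (2 * j + 1) (c • ζ) = c • η := by
    intro c; rw [hη]; exact map_zsmul _ _ _
  obtain ⟨θ, t1, t2⟩ := M.eX (2 * (j + 1)) 0 ((4 : ℤ) • xx (GG ⧸ phB.range) (j + 1)) (by
    rw [map_zero, ps_zxx]; exact ((wC j 4).2 (by norm_num)).symm)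
  have ker : ∀ y : HX YG (2 * (j + 1)), ps _ hq1 _ y = 0 → ps _ hq2 _ y = 0 → ∃ c : ℤ, y = c • η := by
    intro y h1 h2
    obtain ⟨z, rfl⟩ := M.eY (2 * j + 1) y h1 h2
    obtain ⟨c, rfl⟩ := z1 z
    exact ⟨c, hcη c⟩
  have hθ1 : ∀ b : ℤ, ps _ hq1 _ (b • θ) = 0 := fun b => by rw [map_zsmul, t1, zs_zero]
  have hθ2 : ∀ b : ℤ, ps _ hq2 _ (b • θ) = (b * 4) • xx (GG ⧸ phB.range) (j + 1) := fun b => by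
    rw [map_zsmul, t2, zs_mul]
  have hη1 : ∀ b : ℤ, ps _ hq1 _ (b • η) = 0 := fun b => by rw [map_zsmul, e1, zs_zero]
  have hη2 : ∀ b : ℤ, ps _ hq2 _ (b • η) = 0 := fun b => by rw [map_zsmul, e2, zs_zero]
  refine ⟨xx YG (j + 1), θ, η, ?_, ?_, ?_, ?_, ?_⟩
  · apply ker
    · rw [ps_zxx, wA]; norm_num
    · rw [ps_zxx, wB]; norm_num
  · apply ker
    · exact hθ1 3
    · rw [hθ2, wB]; norm_num
  · intro y
    obtain ⟨a, ha⟩ := gA (j + 1) (ps _ hq1 _ y)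
    obtain ⟨b, hb⟩ := gB (j + 1) (ps _ hq2 _ y)
    obtain ⟨t, ht⟩ := M.cong wC j y a b ha hb
    push_cast at ht
    obtain ⟨c, hc⟩ := ker (y - a • xx YG (j + 1) - (-t) • θ) (by
      rw [map_sub, map_sub, ps_zxx, hθ1, ha, sub_self, sub_zero]) (by
      rw [map_sub, map_sub, ps_zxx, hθ2, hb, ← zs_sub, ← zs_sub, wB]
      exact ⟨0, by linarith⟩)
    refine ⟨a, -t, c, ?_⟩
    rw [← hc]; abel
  · intro a b c h
    have h1 : ps _ hq1 _ (a • xx YG (j + 1) + b • θ + c • η) = 0 := by rw [h, map_zero]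
    have h2 : ps _ hq2 _ (a • xx YG (j + 1) + b • θ + c • η) = 0 := by rw [h, map_zero]
    rw [map_add, map_add, ps_zxx, hθ1, hη1, add_zero, add_zero, wA] at h1
    rw [map_add, map_add, ps_zxx, hθ2, hη2, add_zero, zs_add, wB] at h2
    push_cast at h1 h2
    omega
  · intro c
    rw [← z2]
    constructor
    · intro h
      rw [← hcη] at h
      obtain ⟨a, b, hab⟩ := M.eZ _ _ h
      rw [oA j a, oB j b, map_zero, map_zero, sub_zero] at hab
      exact hab
    · intro h
      rw [← hcη, h, map_zero]

end SLC

namespace SLC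
open CategoryTheory

section alg
variable {H : Type} [AddCommGroup H]

lemma not_both3 {ξ θ η : H} {u v : ℤ} (hu : (12 : ℤ) • ξ = u • η) (hv : (3 : ℤ) • θ = v • η)
    (hi : ∀ a b c : ℤ, a • ξ + b • θ + c • η = 0 → 12 ∣ a ∧ 3 ∣ b)
    (tor3 : ∀ a b : H, (3 : ℤ) • a = 0 → (3 : ℤ) • b = 0 →
      ∃ c d : ℤ, ¬ (3 ∣ c ∧ 3 ∣ d) ∧ c • a + d • b = 0) : ¬ (3 ∣ u ∧ 3 ∣ v) := by
  rintro ⟨⟨r, rfl⟩, ⟨s, rfl⟩⟩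
  obtain ⟨c, d, hcd, h⟩ := tor3 ((4 : ℤ) • ξ - r • η) (θ - s • η)
    (by rw [smul_sub, smul_smul, smul_smul]; norm_num; rw [sub_eq_zero]; exact hu)
    (by rw [smul_sub, smul_smul, sub_eq_zero]; exact hv)
  have := hi (c * 4) d (-(c * r) - d * s) (by
    rw [← h]; module)
  omega

lemma u_odd {ξ θ η : H} {u : ℤ} (hu : (12 : ℤ) • ξ = u • η)
    (hi : ∀ a b c : ℤ, a • ξ + b • θ + c • η = 0 → 12 ∣ a ∧ 3 ∣ b)
    (no2 : ∀ a : H, (2 : ℤ) • a = 0 → a = 0) : ¬ 2 ∣ u := by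
  rintro ⟨r, rfl⟩
  have h := no2 ((6 : ℤ) • ξ - r • η)
    (by rw [smul_sub, smul_smul, smul_smul]; norm_num; rw [sub_eq_zero]; exact hu)
  have := hi 6 0 (-r) (by rw [← h]; module)
  omega

lemma H2_case1 {ξ θ η : H} {u v : ℤ} (hu : (12 : ℤ) • ξ = u • η) (hv : (3 : ℤ) • θ = v • η)
    (hg : ∀ y : H, ∃ a b c : ℤ, y = a • ξ + b • θ + c • η)
    (hi : ∀ a b c : ℤ, a • ξ + b • θ + c • η = 0 → 12 ∣ a ∧ 3 ∣ b)
    (hz : ∀ c : ℤ, c • η = 0 → c = 0) (x y : ℤ) (hxy : 12 * x + u * y = 1) :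
    ∃ g t : H, (3 : ℤ) • t = 0 ∧ (∀ y : H, ∃ c d : ℤ, y = c • g + d • t) ∧
      ∀ c d : ℤ, c • g + d • t = 0 → c = 0 ∧ 3 ∣ d := by
  obtain ⟨g, hgd⟩ : ∃ g, g = x • η + y • ξ := ⟨_, rfl⟩
  have h12 : (12 : ℤ) • g = η := by
    have : (12 : ℤ) • g = (12 * x) • η + y • ((12 : ℤ) • ξ) := by rw [hgd]; module
    rw [this, hu, smul_smul, ← add_smul, mul_comm y u, hxy, one_smul]
  have hug : u • g = ξ := by
    have : u • g = x • (u • η) + (u * y) • ξ := by rw [hgd]; module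
    rw [this, ← hu, smul_smul, ← add_smul, mul_comm x, hxy, one_smul]
  have h3t : (3 : ℤ) • (θ - (4 * v) • g) = 0 := by
    have : (3 : ℤ) • (θ - (4 * v) • g) = (3 : ℤ) • θ - v • ((12 : ℤ) • g) := by module
    rw [this, hv, h12, sub_self]
  refine ⟨g, θ - (4 * v) • g, h3t, ?_, ?_⟩
  · intro z
    obtain ⟨a, b, c, rfl⟩ := hg z
    refine ⟨a * u + b * (4 * v) + c * 12, b, ?_⟩
    rw [← h12]; nth_rw 1 [← hug]; module
  · intro c d h
    have h1 : c = 0 := by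
      apply hz
      have : (12 : ℤ) • (c • g + d • (θ - (4 * v) • g)) = c • ((12 : ℤ) • g) + (4 * d) • ((3 : ℤ) • (θ - (4 * v) • g)) := by module
      rw [h, h3t, h12, smul_zero, smul_zero, add_zero] at this
      exact this.symm
    subst h1
    refine ⟨rfl, (hi (-(4 * v * d * y)) d (-(4 * v * d * x)) ?_).2⟩
    rw [← h, hgd]; module

lemma H2_case2 {ξ θ η : H} {u v : ℤ} (hu : (12 : ℤ) • ξ = u • η) (hv : (3 : ℤ) • θ = v • η)
    (hg : ∀ y : H, ∃ a b c : ℤ, y = a • ξ + b • θ + c • η)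
    (hi : ∀ a b c : ℤ, a • ξ + b • θ + c • η = 0 → 12 ∣ a ∧ 3 ∣ b)
    (hz : ∀ c : ℤ, c • η = 0 → c = 0) (x y : ℤ) (hxy : 3 * x + v * y = 1)
    (x' y' : ℤ) (hxy' : 4 * x' + u * y' = 1) :
    ∃ g t : H, (3 : ℤ) • t = 0 ∧ (∀ y : H, ∃ c d : ℤ, y = c • g + d • t) ∧
      ∀ c d : ℤ, c • g + d • t = 0 → c = 0 ∧ 3 ∣ d := by
  obtain ⟨g0, hgd⟩ : ∃ g, g = x • η + y • θ := ⟨_, rfl⟩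
  have h3 : (3 : ℤ) • g0 = η := by
    have : (3 : ℤ) • g0 = (3 * x) • η + y • ((3 : ℤ) • θ) := by rw [hgd]; module
    rw [this, hv, smul_smul, ← add_smul, mul_comm y v, hxy, one_smul]
  have hvg : v • g0 = θ := by
    have : v • g0 = x • (v • η) + (v * y) • θ := by rw [hgd]; module
    rw [this, ← hv, smul_smul, ← add_smul, mul_comm x, hxy, one_smul]
  obtain ⟨t, ht⟩ : ∃ t, t = (4 : ℤ) • ξ - u • g0 := ⟨_, rfl⟩
  obtain ⟨g, hgg⟩ : ∃ g, g = x' • g0 + y' • ξ := ⟨_, rfl⟩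
  have h3t : (3 : ℤ) • t = 0 := by
    have : (3 : ℤ) • t = (12 : ℤ) • ξ - u • ((3 : ℤ) • g0) := by rw [ht]; module
    rw [this, hu, h3, sub_self]
  have h4 : (4 : ℤ) • g = g0 + y' • t := by
    have : (4 : ℤ) • g = (4 * x' + u * y') • g0 + y' • t := by rw [hgg, ht]; module
    rw [this, hxy', one_smul]
  have hu' : u • g = ξ - x' • t := by
    have : u • g = (4 * x' + u * y') • ξ - x' • t := by rw [hgg, ht]; module
    rw [this, hxy', one_smul]
  have e1 : ξ = u • g + x' • t := by rw [hu']; abel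
  have e2 : g0 = (4 : ℤ) • g - y' • t := by rw [h4]; abel
  refine ⟨g, t, h3t, ?_, ?_⟩
  · intro z
    obtain ⟨a, b, c, rfl⟩ := hg z
    refine ⟨a * u + (b * v + c * 3) * 4, a * x' - (b * v + c * 3) * y', ?_⟩
    rw [← h3, ← hvg, e2]; nth_rw 1 [e1]; module
  · intro c d h
    have h1 : c = 0 := by
      apply hz
      have : (12 : ℤ) • (c • g + d • t) = (c * 3) • ((4 : ℤ) • g) + (4 * d) • ((3 : ℤ) • t) := by module
      rw [h, h3t, h4, smul_zero, smul_zero, add_zero] at this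
      have e : (c * 3) • (g0 + y' • t) = c • ((3 : ℤ) • g0) + (c * y') • ((3 : ℤ) • t) := by module
      rw [e, h3t, h3, smul_zero, add_zero] at this
      exact this.symm
    subst h1
    have := (hi (d * 4) (-(d * u * y)) (-(d * u * x)) ?_).1
    · exact ⟨rfl, by omega⟩
    · rw [← h, ht, hgd]; module

lemma H2_gen {ξ θ η : H} {u v : ℤ} (hu : (12 : ℤ) • ξ = u • η) (hv : (3 : ℤ) • θ = v • η)
    (hg : ∀ y : H, ∃ a b c : ℤ, y = a • ξ + b • θ + c • η)
    (hi : ∀ a b c : ℤ, a • ξ + b • θ + c • η = 0 → 12 ∣ a ∧ 3 ∣ b)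
    (hz : ∀ c : ℤ, c • η = 0 → c = 0)
    (no2 : ∀ a : H, (2 : ℤ) • a = 0 → a = 0)
    (tor3 : ∀ a b : H, (3 : ℤ) • a = 0 → (3 : ℤ) • b = 0 →
      ∃ c d : ℤ, ¬ (3 ∣ c ∧ 3 ∣ d) ∧ c • a + d • b = 0) :
    ∃ g t : H, (3 : ℤ) • t = 0 ∧ (∀ y : H, ∃ c d : ℤ, y = c • g + d • t) ∧
      ∀ c d : ℤ, c • g + d • t = 0 → c = 0 ∧ 3 ∣ d := by
  have o := u_odd hu hi no2
  have n := not_both3 hu hv hi tor3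
  have c4 : IsCoprime (4 : ℤ) u := by
    have : IsCoprime (2 : ℤ) u := (Int.prime_two.coprime_iff_not_dvd).2 o
    exact (show (4 : ℤ) = 2 ^ 2 by norm_num) ▸ this.pow_left
  by_cases h : (3 : ℤ) ∣ u
  · have hv3 : ¬ (3 : ℤ) ∣ v := fun hh => n ⟨h, hh⟩
    obtain ⟨x, y, hxy⟩ := (Int.prime_three.coprime_iff_not_dvd).2 hv3
    obtain ⟨x', y', hxy'⟩ := c4
    exact H2_case2 hu hv hg hi hz x y (by linarith) x' y' (by linarith)
  · have c3 := (Int.prime_three.coprime_iff_not_dvd).2 h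
    obtain ⟨x, y, hxy⟩ := c4.mul_left c3
    exact H2_case1 hu hv hg hi hz x y (by linarith)

/-- A cyclic map out of `ZMod n`. -/
noncomputable def zl (n : ℕ) (t : H) (h : (n : ℤ) • t = 0) : ZMod n →+ H :=
  ZMod.lift n ⟨(zmultiplesHom H) t, by simpa using h⟩

lemma zl_coe (n : ℕ) (t : H) (h : (n : ℤ) • t = 0) (d : ℤ) : zl n t h (d : ZMod n) = d • t := by
  simp [zl]

lemma H2_equiv {g t : H} (h3 : (3 : ℤ) • t = 0) (hs : ∀ y : H, ∃ c d : ℤ, y = c • g + d • t)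
    (hi : ∀ c d : ℤ, c • g + d • t = 0 → c = 0 ∧ 3 ∣ d) : Nonempty (H ≃+ (ℤ × ZMod 3)) := by
  let f : ℤ × ZMod 3 →+ H := ((zmultiplesHom H) g).coprod (zl 3 t h3)
  have hf : ∀ c d : ℤ, f (c, (d : ZMod 3)) = c • g + d • t := by
    intro c d
    simp [f, zl_coe]
  refine ⟨(AddEquiv.ofBijective f ⟨?_, ?_⟩).symm⟩
  · rw [injective_iff_map_eq_zero]
    rintro ⟨c, d⟩ h
    obtain ⟨d, rfl⟩ := ZMod.intCast_surjective d
    rw [hf] at h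
    obtain ⟨rfl, h'⟩ := hi c d h
    have := (ZMod.intCast_zmod_eq_zero_iff_dvd d 3).2 (by exact_mod_cast h')
    rw [this]; rfl
  · intro y
    obtain ⟨c, d, rfl⟩ := hs y
    exact ⟨(c, d), hf c d⟩

lemma H4_equiv {ξ θ η g t : H} {u v : ℤ} (hu : (12 : ℤ) • ξ = u • η) (hv : (3 : ℤ) • θ = v • η)
    (hg : ∀ y : H, ∃ a b c : ℤ, y = a • ξ + b • θ + c • η)
    (hi : ∀ a b c : ℤ, a • ξ + b • θ + c • η = 0 → 12 ∣ a ∧ 3 ∣ b)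
    (hz : ∀ c : ℤ, c • η = 0 ↔ 2 ∣ c)
    (h3 : (3 : ℤ) • t = 0) (hs : ∀ y : H, ∃ c d : ℤ, y = c • g + d • t) :
    Nonempty (H ≃+ (ZMod 24 × ZMod 3)) := by
  have h2 : (2 : ℤ) • η = 0 := (hz 2).2 (dvd_refl _)
  have h24 : ∀ y : H, (24 : ℤ) • y = 0 := by
    intro y
    obtain ⟨a, b, c, rfl⟩ := hg y
    have : (24 : ℤ) • (a • ξ + b • θ + c • η) = (2 * a) • ((12 : ℤ) • ξ) + (8 * b) • ((3 : ℤ) • θ) + (12 * c) • ((2 : ℤ) • η) := by module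
    rw [this, hu, hv, h2]
    have : (2 * a) • u • η + (8 * b) • v • η + (12 * c) • (0 : H) = (a * u + 4 * b * v) • ((2 : ℤ) • η) := by module
    rw [this, h2, smul_zero]
  let f : ZMod 24 × ZMod 3 →+ H := (zl 24 g (h24 g)).coprod (zl 3 t h3)
  have hf : ∀ c d : ℤ, f ((c : ZMod 24), (d : ZMod 3)) = c • g + d • t := by
    intro c d
    simp [f, zl_coe]
  have fs : Function.Surjective f := by
    intro y
    obtain ⟨c, d, rfl⟩ := hs y
    exact ⟨(c, d), hf c d⟩
  haveI : Finite H := Finite.of_surjective f fs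
  let q : Fin 12 × Fin 3 × Fin 2 → H := fun p => ((p.1 : ℕ) : ℤ) • ξ + ((p.2.1 : ℕ) : ℤ) • θ + ((p.2.2 : ℕ) : ℤ) • η
  have qi : Function.Injective q := by
    rintro ⟨a, b, c⟩ ⟨a', b', c'⟩ h
    have e : (((a : ℕ) : ℤ) - ((a' : ℕ) : ℤ)) • ξ + (((b : ℕ) : ℤ) - ((b' : ℕ) : ℤ)) • θ + (((c : ℕ) : ℤ) - ((c' : ℕ) : ℤ)) • η = 0 := by
      have h' := sub_eq_zero.2 h
      rw [← h']; simp only [q]; module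
    have e1 := hi _ _ _ e
    have a1 := a.isLt
    have a2 := a'.isLt
    have b1 := b.isLt
    have b2 := b'.isLt
    have c1 := c.isLt
    have c2 := c'.isLt
    have ea : (a : ℕ) = a' := by omega
    have eb : (b : ℕ) = b' := by omega
    rw [ea, eb, sub_self, sub_self, zero_smul, zero_smul, zero_add, zero_add, hz] at e
    have ec : (c : ℕ) = c' := by omega
    rw [Fin.ext ea, Fin.ext eb, Fin.ext ec]
  have card : Nat.card (ZMod 24 × ZMod 3) ≤ Nat.card H := by
    have := Nat.card_le_card_of_injective q qi
    simp [Nat.card_prod] at this ⊢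
    omega
  exact ⟨(AddEquiv.ofBijective f (fs.bijective_of_nat_card_le card)).symm⟩
end alg
end SLC

namespace SLC
open CategoryTheory

section chi
variable {M : Type} [AddCommGroup M] {F : GG → M} (hF : ∀ g h, F (g * h) = F g + F h)
include hF

lemma chi_one : F 1 = 0 := by
  have := hF 1 1
  rw [mul_one] at this
  simpa using this

lemma sU_eq : sU = sS * sT := by decide

lemma chi_S (φ : SZ →* GG) : F (φ sS) = -(3 : ℤ) • F (φ sT) := by
  have h : sU ^ 3 = sS ^ 2 := by rw [sU3, sS2]
  have e := congrArg (fun x => F (φ x)) h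
  simp only [pow_succ, pow_zero, one_mul, map_mul, hF, sU_eq hF] at e
  have : F (φ sS) + (3 : ℤ) • F (φ sT) = 0 := by
    have e' := sub_eq_zero.2 e
    rw [← e']; module
  rw [neg_smul]
  exact eq_neg_of_add_eq_zero_left this

/-- The diagonal element. -/
noncomputable def dD : GG := ⟨!![2, 0; 0, hf], by simp [two_hf]⟩

lemma chi_T : (3 : ℤ) • F (phA sT) = 0 := by
  have h : dD * phA sT = phA sT * phA sT * phA sT * phA sT * dD := by
    have a := two_hf
    apply sl_ext <;> simp only [m00, m01, m10, m11, phA_apply, sT00, sT01, sT10, sT11] <;>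
      simp [dD] <;> linear_combination (-2) * a
  have e := congrArg F h
  simp only [hF] at e
  have e' := sub_eq_zero.2 e
  rw [← neg_eq_zero, ← e']; module

lemma chi_BT : F (phB sT) = (2 : ℤ) • F (phA sT) := by
  have h : phB sT * phA sS = phA sS * phA sT * phA sT := by
    apply sl_ext <;> simp only [m00, m01, m10, m11, phA_apply, sT00, sT01, sT10, sT11,
      sS00, sS01, sS10, sS11, pB00, pB01, pB10, pB11] <;> push_cast <;> ring
  have e := congrArg F h
  simp only [hF] at e
  have e' := sub_eq_zero.2 e
  rw [← sub_eq_zero, ← e']; module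

lemma chi_zero (h : F (phA sT) = 0) (g : GG) : F g = 0 := by
  have key : ∀ φ : SZ →* GG, F (φ sT) = 0 → ∀ x, F (φ x) = 0 := by
    intro φ hφ
    let f : GG →* Multiplicative M :=
      { toFun := fun g => Multiplicative.ofAdd (F g)
        map_one' := by rw [chi_one hF]; rfl
        map_mul' := fun a b => by rw [hF]; rfl }
    have hh : ∀ x, x ∈ (f.comp φ).ker ↔ F (φ x) = 0 := fun x => Iff.rfl
    intro x
    rw [← hh]
    refine SZ_ind _ ?_ ?_ x
    · rw [hh, chi_S hF, hφ, smul_zero]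
    · rw [hh, hφ]
  have hA := key phA h
  have hB := key phB (by rw [chi_BT hF, h, smul_zero])
  rw [gen_inv F (fun g x => by rw [hF, hA, add_zero]) (fun g x => by rw [hF, hB, add_zero]), chi_one hF]

end chi

/-- trivial coefficients mod `n` -/
noncomputable abbrev TZ (n : ℕ) : Rep.{0} ℤ GG := Rep.trivial ℤ GG (ZMod n)

noncomputable def mulN (n : ℕ) : TT ℤ GG ⟶ TT ℤ GG := mkH (LinearMap.lsmul ℤ ℤ (n : ℤ)) (fun g a => rfl)
noncomputable def redN (n : ℕ) : TT ℤ GG ⟶ TZ n := mkH (Int.castAddHom (ZMod n)).toIntLinearMap (fun g a => rfl)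

lemma sesN (n : ℕ) (hn : n ≠ 0) : SES (mulN n) (redN n) where
  inj := by
    intro a b h
    have : (n : ℤ) * (a : ℤ) = n * (b : ℤ) := h
    have hz : (n : ℤ) ≠ 0 := by exact_mod_cast hn
    exact mul_left_cancel₀ hz this
  surj := ZMod.intCast_surjective
  zero := by
    intro a
    change (((n : ℤ) * (a : ℤ) : ℤ) : ZMod n) = 0
    simp
  ex := by
    intro b hb
    have : (((b : ℤ)) : ZMod n) = 0 := hb
    rw [ZMod.intCast_zmod_eq_zero_iff_dvd] at this
    obtain ⟨c, hc⟩ := this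
    exact ⟨c, hc.symm⟩

lemma hmap_mulN (n m : ℕ) (x : Hc (TT ℤ GG) m) : hmap (mulN n) m x = (n : ℤ) • x := by
  induction n with
  | zero =>
    have : mulN 0 = 0 := hom_ext' fun a => by
      change ((0 : ℕ) : ℤ) * (a : ℤ) = 0
      simp
    rw [this, hmap_zero]; simp
  | succ n ih =>
    have : mulN (n + 1) = mulN n + 𝟙 _ := hom_ext' fun a => by
      change ((n + 1 : ℕ) : ℤ) * (a : ℤ) = (n : ℤ) * a + a
      push_cast; ring
    rw [this, hmap_add, ih, hmap_id]
    rw [Nat.cast_succ, ← zs_add]; congr 1; exact (_root_.one_zsmul x).symm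

/-- the homomorphism attached to a class in degree one -/
noncomputable def toF (n : ℕ) (y : Hc (TZ n) 1) : GG → ZMod n := fun g =>
  (groupCohomology.H1IsoOfIsTrivial (TZ n)).hom y (Additive.ofMul g)

lemma toF_mul (n : ℕ) (y : Hc (TZ n) 1) (g h : GG) : toF n y (g * h) = toF n y g + toF n y h := by
  unfold toF
  rw [ofMul_mul, map_add]

lemma toF_add (n : ℕ) (y z : Hc (TZ n) 1) (g : GG) : toF n (y + z) g = toF n y g + toF n z g := by
  unfold toF
  rw [map_add]; rfl

noncomputable def toFh (n : ℕ) (g : GG) : Hc (TZ n) 1 →+ ZMod n :=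
  AddMonoidHom.mk' (fun y => toF n y g) (fun y z => toF_add n y z g)

lemma toF_inj (n : ℕ) (y : Hc (TZ n) 1) (h : ∀ g, toF n y g = 0) : y = 0 := by
  have e : (groupCohomology.H1IsoOfIsTrivial (TZ n)).hom y = 0 := by
    apply AddMonoidHom.ext
    intro g
    exact h g.toMul
  have := congrArg (groupCohomology.H1IsoOfIsTrivial (TZ n)).inv e
  simpa using this

lemma tors (n : ℕ) (hn : n ≠ 0) (x : Hc (TT ℤ GG) 2) (hx : (n : ℤ) • x = 0) :
    ∃ y, (sesN n hn).δ 1 y = x :=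
  (sesN n hn).ex_A 1 x (by rw [hmap_mulN]; exact hx)

lemma no2 (x : Hc (TT ℤ GG) 2) (hx : (2 : ℤ) • x = 0) : x = 0 := by
  obtain ⟨y, rfl⟩ := tors 2 (by norm_num) x hx
  have : y = 0 := by
    apply toF_inj
    apply chi_zero (toF_mul 2 y)
    have h := chi_T (toF_mul 2 y)
    revert h
    generalize toF 2 y (phA sT) = z
    revert z
    decide
  rw [this, map_zero]

lemma tor3 (x x' : Hc (TT ℤ GG) 2) (hx : (3 : ℤ) • x = 0) (hx' : (3 : ℤ) • x' = 0) :
    ∃ c d : ℤ, ¬ (3 ∣ c ∧ 3 ∣ d) ∧ c • x + d • x' = 0 := by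
  obtain ⟨y, rfl⟩ := tors 3 (by norm_num) x hx
  obtain ⟨y', rfl⟩ := tors 3 (by norm_num) x' hx'
  have : ∀ z z' : ZMod 3, ∃ c d : Fin 3, ¬ (c = 0 ∧ d = 0) ∧ ((c : ℕ) : ℤ) • z + ((d : ℕ) : ℤ) • z' = 0 := by decide
  obtain ⟨c, d, h, e⟩ := this (toF 3 y (phA sT)) (toF 3 y' (phA sT))
  refine ⟨((c : ℕ) : ℤ), ((d : ℕ) : ℤ), ?_, ?_⟩
  · rintro ⟨h1, h2⟩
    exact h ⟨Fin.ext (by have := c.isLt; simp; omega), Fin.ext (by have := d.isLt; simp; omega)⟩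
  · rw [← map_zsmul, ← map_zsmul, ← map_add]
    have : ((c : ℕ) : ℤ) • y + ((d : ℕ) : ℤ) • y' = 0 := by
      apply toF_inj
      apply chi_zero (toF_mul 3 _)
      change toFh 3 _ _ = 0
      rw [map_add, map_zsmul, map_zsmul]
      exact e
    rw [this, map_zero]

end SLC

namespace SLC
open CategoryTheory

noncomputable def evY : FR YG (TT ℤ GG) ⟶ TT ℤ GG :=
  mkH (LinearMap.proj (QuotientGroup.mk (1 : GG) : YG)) (fun g f => by
    change f _ = f _
    exact congrArg f (YG_sub _ _))

noncomputable def cstY : TT ℤ GG ⟶ FR YG (TT ℤ GG) :=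
  mkH (LinearMap.pi fun _ : YG => LinearMap.id) (fun g a => rfl)

noncomputable def eqY (n : ℕ) : HX YG n ≃+ Hc (TT ℤ GG) n :=
  { hmap evY n with
    invFun := hmap cstY n
    left_inv := fun x => by
      change hmap cstY n (hmap evY n x) = x
      rw [← hmap_comp]
      have : evY ≫ cstY = 𝟙 _ := hom_ext' fun f => by
        funext y
        exact congrArg f (YG_sub _ _)
      rw [this, hmap_id]
    right_inv := fun x => by
      change hmap evY n (hmap cstY n x) = x
      rw [← hmap_comp]
      have : cstY ≫ evY = 𝟙 _ := hom_ext' fun f => rfl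
      rw [this, hmap_id] }

lemma no2Y (x : HX YG 2) (hx : (2 : ℤ) • x = 0) : x = 0 := by
  apply (eqY 2).injective
  rw [map_zero]
  apply no2
  have := congrArg (eqY 2) hx
  rw [map_zsmul, map_zero] at this
  exact this

lemma tor3Y (x x' : HX YG 2) (hx : (3 : ℤ) • x = 0) (hx' : (3 : ℤ) • x' = 0) :
    ∃ c d : ℤ, ¬ (3 ∣ c ∧ 3 ∣ d) ∧ c • x + d • x' = 0 := by
  have h1 := congrArg (eqY 2) hx
  have h2 := congrArg (eqY 2) hx'
  rw [map_zsmul, map_zero] at h1 h2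
  obtain ⟨c, d, h, e⟩ := tor3 _ _ h1 h2
  refine ⟨c, d, h, (eqY 2).injective ?_⟩
  rw [map_add, map_zsmul, map_zsmul, map_zero]
  exact e

lemma H2Y : ∃ g t : HX YG (2 * (0 + 1)), (3 : ℤ) • t = 0 ∧ (∀ y, ∃ c d : ℤ, y = c • g + d • t) ∧
      ∀ c d : ℤ, c • g + d • t = 0 → c = 0 ∧ 3 ∣ d := by
  obtain ⟨ξ, θ, η, ⟨u, hu⟩, ⟨v, hv⟩, hg, hi, hz⟩ := cohG.2 0
  exact H2_gen hu hv hg hi (fun c h => (ord_zero c).1 ((hz c).1 h)) no2Y tor3Y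

lemma genY (j : ℕ) : ∃ g t : HX YG (2 * (j + 1)), (3 : ℤ) • t = 0 ∧ ∀ y, ∃ c d : ℤ, y = c • g + d • t := by
  induction j with
  | zero =>
    obtain ⟨g, t, h, h', -⟩ := H2Y
    exact ⟨g, t, h, h'⟩
  | succ j ih =>
    obtain ⟨g, t, h, h'⟩ := ih
    obtain ⟨P, hP⟩ : ∃ P : HX YG (2 * (j + 1)) →+ HX YG (2 * (j + 1 + 1)), P = Phi Om s00 ℤ YG (2 * (j + 1)) := ⟨_, rfl⟩
    refine ⟨P g, P t, ?_, ?_⟩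
    · rw [← map_zsmul, h, map_zero]
    · intro y
      obtain ⟨x, hx⟩ := surjG j y
      have hx' : P x = y := by rw [hP]; exact hx
      obtain ⟨c, d, rfl⟩ := h' x
      exact ⟨c, d, by rw [← hx', map_add, map_zsmul, map_zsmul]⟩

lemma H4Y (j : ℕ) : Nonempty (HX YG (2 * (j + 1 + 1)) ≃+ (ZMod 24 × ZMod 3)) := by
  obtain ⟨ξ, θ, η, ⟨u, hu⟩, ⟨v, hv⟩, hg, hi, hz⟩ := cohG.2 (j + 1)
  obtain ⟨g, t, h, h'⟩ := genY (j + 1)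
  refine H4_equiv hu hv hg hi (fun c => (hz c).trans ?_) h h'
  exact rot_ord rot1 j c

lemma fin2 : Nonempty (Hc (TT ℤ GG) 2 ≃+ (ℤ × ZMod 3)) := by
  obtain ⟨g, t, h, h', h''⟩ := H2Y
  obtain ⟨e⟩ := H2_equiv h h' h''
  exact ⟨(eqY 2).symm.trans e⟩

lemma fin4 (i : ℕ) (h4 : 4 ≤ i) (h2 : i % 2 = 0) : Nonempty (Hc (TT ℤ GG) i ≃+ (ZMod 24 × ZMod 3)) := by
  obtain ⟨j, rfl⟩ : ∃ j, i = 2 * (j + 1 + 1) := ⟨i / 2 - 2, by omega⟩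
  obtain ⟨e⟩ := H4Y j
  exact ⟨(eqY _).symm.trans e⟩

lemma fin1 (i : ℕ) (h2 : i % 2 = 1) : Subsingleton (Hc (TT ℤ GG) i) := by
  obtain ⟨j, rfl⟩ : ∃ j, i = 2 * j + 1 := ⟨i / 2, by omega⟩
  have key : ∀ x : Hc (TT ℤ GG) (2 * j + 1), x = 0 := fun x => by
    apply (eqY _).symm.injective
    rw [map_zero]
    exact cohG.1 j _
  exact ⟨fun a b => (key a).trans (key b).symm⟩

lemma toLin {M N : Type} [AddCommGroup M] [Module ℤ M] [AddCommGroup N] [Module ℤ N]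
    (h : Nonempty (M ≃+ N)) : Nonempty (M ≃ₗ[ℤ] N) := h.map fun e => e.toIntLinearEquiv

end SLC

/-- The integral cohomology of `SL₂(ℤ[1/2])`: it vanishes in odd degrees, is
`ℤ ⊕ ℤ/3` in degree 2, and is `ℤ/24 ⊕ ℤ/3` in even degrees `≥ 4`. -/
theorem cohomology_SL2_Z_inv_two :
    (∀ i : ℕ, 1 ≤ i → i % 2 = 1 →
      Subsingleton (groupCohomology (Rep.trivial ℤ
        (Matrix.SpecialLinearGroup (Fin 2) (Localization.Away (2 : ℤ))) ℤ) i)) ∧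
    Nonempty ((groupCohomology (Rep.trivial ℤ
      (Matrix.SpecialLinearGroup (Fin 2) (Localization.Away (2 : ℤ))) ℤ) 2) ≃ₗ[ℤ]
        (ℤ × ZMod 3)) ∧
    (∀ i : ℕ, 4 ≤ i → i % 2 = 0 →
      Nonempty ((groupCohomology (Rep.trivial ℤ
        (Matrix.SpecialLinearGroup (Fin 2) (Localization.Away (2 : ℤ))) ℤ) i) ≃ₗ[ℤ]
          (ZMod 24 × ZMod 3))) := by
  exact ⟨fun i _ h => SLC.fin1 i h, SLC.toLin SLC.fin2, fun i h4 h2 => SLC.toLin (SLC.fin4 i h4 h2)⟩
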